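/- Let ⟨S | R⟩ be a classical C'(1/6) presentation with group G. If g ∈ G has infinite order, the subgroup ⟨g⟩ lies at finite Hausdorff distance from some bi-infinite geodesic in Cay(G,S), and g is hyperbolic for the action on the coned-off space (i.e., n ↦ gⁿ is a quasi-isometric embedding of ℤ into (G, d_{S∪W})), then ⟨g⟩ is strongly contracting in Cay(G,S). -/

import Mathlib

/- Common definitions: words, classical C'(1/6) presentations, word metrics,
   contraction, Morse property, etc. -/

namespace GSC

open Filter

/-- A word over the alphabet `S`: a list of letters with an exponent `±1`
(`true` = the letter, `false` = its formal inverse). -/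
abbrev Word (S : Type) := List (S × Bool)

/-- The formal inverse of a word. -/
def wordInv {S : Type} (w : Word S) : Word S := (w.map fun l => (l.1, !l.2)).reverse

/-- A word is (freely) reduced if no letter is followed by its formal inverse. -/
def Reduced {S : Type} (w : Word S) : Prop :=
  List.Chain' (fun a b => a.1 ≠ b.1 ∨ a.2 = b.2) w

/-- A word is cyclically reduced if its square is reduced. -/
def CyclicallyReduced {S : Type} (w : Word S) : Prop := Reduced (w ++ w)

/-- A piece with respect to a set of relators `R`: a word occurring as a prefix of
two distinct elements of `R`. -/
def IsPiece {S : Type} (R : Set (Word S)) (p : Word S) : Prop :=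
  ∃ r₁ ∈ R, ∃ r₂ ∈ R, r₁ ≠ r₂ ∧ p <+: r₁ ∧ p <+: r₂

/-- Closure of a set of words under inversion and cyclic permutation. -/
def symmClosure {S : Type} (R : Set (Word S)) : Set (Word S) :=
  {w | ∃ r ∈ R, ∃ n : ℕ, w = r.rotate n ∨ w = wordInv (r.rotate n)}

/-- A classical `C'(1/den)` collection of cyclically reduced words: after closing under
inversion and cyclic permutation, every piece `p` contained in a relator `r` satisfies
`den * |p| < |r|`. -/
def CprimeCollection {S : Type} (den : ℕ) (R : Set (Word S)) : Prop :=
  (∀ r ∈ R, CyclicallyReduced r) ∧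
  ∀ r ∈ symmClosure R, ∀ p : Word S, p <+: r → IsPiece (symmClosure R) p →
    den * p.length < r.length

/-- A classical `C'(1/6)` presentation: a set of cyclically reduced relators, closed under
inversion and cyclic permutation, in which every piece contained in a relator `r` has
length `< |r|/6`. -/
structure C6Presentation (S : Type) where
  rels : Set (Word S)
  cyclically_reduced : ∀ r ∈ rels, CyclicallyReduced r
  inv_mem : ∀ r ∈ rels, wordInv r ∈ rels
  rotate_mem : ∀ r ∈ rels, ∀ n : ℕ, r.rotate n ∈ rels
  small_cancellation : ∀ r ∈ rels, ∀ p : Word S, p <+: r → IsPiece rels p →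
    6 * p.length < r.length

/-- The element of the free group represented by a word. -/
def wordVal {S : Type} (w : Word S) : FreeGroup S :=
  (w.map fun l => (FreeGroup.of l.1) ^ (if l.2 then (1 : ℤ) else -1)).prod

/-- The group defined by a `C'(1/6)` presentation. -/
abbrev C6Presentation.Grp {S : Type} (P : C6Presentation S) : Type :=
  PresentedGroup (wordVal '' P.rels)

/-- The generating set of the presented group (the images of the letters of `S`). -/
def C6Presentation.gens {S : Type} (P : C6Presentation S) : Set P.Grp :=
  Set.range fun a : S => (PresentedGroup.of a : P.Grp)

/-- The element of the presented group represented by a word. -/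
def C6Presentation.elt {S : Type} (P : C6Presentation S) (w : Word S) : P.Grp :=
  (w.map fun l => (PresentedGroup.of l.1 : P.Grp) ^ (if l.2 then (1 : ℤ) else -1)).prod

/-- The word length of `g` with respect to a generating set `S ⊆ G`: the least `n`
such that `g` is a product of `n` elements of `S ∪ S⁻¹`. -/
noncomputable def wordLength {G : Type*} [Group G] (S : Set G) (g : G) : ℕ :=
  sInf {n : ℕ | ∃ l : List G, l.length = n ∧ (∀ x ∈ l, x ∈ S ∨ x⁻¹ ∈ S) ∧ l.prod = g}

/-- The word metric on `G` with respect to `S`, as a real-valued function. -/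
noncomputable def wdist {G : Type*} [Group G] (S : Set G) (g h : G) : ℝ :=
  (wordLength S (g⁻¹ * h) : ℝ)

/-- Distance from a point to a subset, in the word metric. -/
noncomputable def setDist {G : Type*} [Group G] (S : Set G) (x : G) (Y : Set G) : ℝ :=
  sInf (wdist S x '' Y)

/-- Closest point projection to a subset `Y`, in the word metric. -/
def proj {G : Type*} [Group G] (S : Set G) (Y : Set G) (x : G) : Set G :=
  {y ∈ Y | wdist S x y = setDist S x Y}

/-- Diameter of a subset, in the word metric. -/
noncomputable def setDiam {G : Type*} [Group G] (S : Set G) (A : Set G) : ℝ :=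
  sSup {d : ℝ | ∃ x ∈ A, ∃ y ∈ A, d = wdist S x y}

/-- Admissibility of a pair of contraction gauges `(ρ₁, ρ₂)`: both non-decreasing and
eventually non-negative, `ρ₁ r ≤ r`, `ρ₁` unbounded, and `ρ₂/ρ₁ → 0` at infinity. -/
def Admissible (ρ₁ ρ₂ : ℝ → ℝ) : Prop :=
  Monotone ρ₁ ∧ Monotone ρ₂ ∧
  (∀ᶠ r in atTop, 0 ≤ ρ₁ r) ∧ (∀ᶠ r in atTop, 0 ≤ ρ₂ r) ∧
  (∀ r : ℝ, ρ₁ r ≤ r) ∧ (∀ M : ℝ, ∃ r : ℝ, M ≤ ρ₁ r) ∧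
  Tendsto (fun r => ρ₂ r / ρ₁ r) atTop (nhds 0)

/-- `Y` is `(ρ₁,ρ₂)`-contracting inside the subspace `X` (with the metric induced by the
word metric of `S`): whenever `x, x' ∈ X` satisfy `d(x,x') ≤ ρ₁(d(x,Y))`, the projections
`π(x) ∪ π(x')` have diameter at most `ρ₂(d(x,Y))`. -/
def ContractingIn {G : Type*} [Group G] (S : Set G) (X Y : Set G) (ρ₁ ρ₂ : ℝ → ℝ) : Prop :=
  Admissible ρ₁ ρ₂ ∧
  ∀ x ∈ X, ∀ x' ∈ X, wdist S x x' ≤ ρ₁ (setDist S x Y) →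
    ∀ y ∈ proj S Y x ∪ proj S Y x', ∀ y' ∈ proj S Y x ∪ proj S Y x',
      wdist S y y' ≤ ρ₂ (setDist S x Y)

/-- `Y` is `(ρ₁,ρ₂)`-contracting in `Cay(G,S)`. -/
def ContractingWith {G : Type*} [Group G] (S : Set G) (ρ₁ ρ₂ : ℝ → ℝ) (Y : Set G) : Prop :=
  ContractingIn S Set.univ Y ρ₁ ρ₂

/-- `Y` is strongly contracting: `(r, C)`-contracting for some constant `C`. -/
def StronglyContracting {G : Type*} [Group G] (S : Set G) (Y : Set G) : Prop :=
  ∃ C : ℝ, ContractingWith S (fun r => r) (fun _ => C) Y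

/-- A sublinear function: non-decreasing, eventually non-negative, `f(r)/r → 0`. -/
def Sublinear (f : ℝ → ℝ) : Prop :=
  Monotone f ∧ (∀ᶠ r in atTop, 0 ≤ f r) ∧ Tendsto (fun r => f r / r) atTop (nhds 0)

/-- `f ⪯ g`: there are constants `C₁, C₂ > 0` and `C₃, C₄ ≥ 0` with
`f(x) ≤ C₁ g(C₂ x + C₃) + C₄` for all `x`. -/
def Preceq (f g : ℝ → ℝ) : Prop :=
  ∃ C₁ C₂ C₃ C₄ : ℝ, 0 < C₁ ∧ 0 < C₂ ∧ 0 ≤ C₃ ∧ 0 ≤ C₄ ∧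
    ∀ x : ℝ, f x ≤ C₁ * g (C₂ * x + C₃) + C₄

/-- `f ≍ g`: `f ⪯ g` and `g ⪯ f`. -/
def Asymp (f g : ℝ → ℝ) : Prop := Preceq f g ∧ Preceq g f

/-- `α ⊆ G` is a geodesic of `Cay(G,S)`: the image of an isometric embedding of a
subinterval of `ℤ` into `(G, d_S)`. -/
def IsGeodesic {G : Type*} [Group G] (S : Set G) (α : Set G) : Prop :=
  ∃ (I : Set ℤ) (γ : ℤ → G), I.OrdConnected ∧
    (∀ m ∈ I, ∀ n ∈ I, wdist S (γ m) (γ n) = |(m : ℝ) - (n : ℝ)|) ∧ α = γ '' I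

/-- `α ⊆ G` is a bi-infinite geodesic of `Cay(G,S)`. -/
def IsBiInfGeodesic {G : Type*} [Group G] (S : Set G) (α : Set G) : Prop :=
  ∃ γ : ℤ → G, (∀ m n : ℤ, wdist S (γ m) (γ n) = |(m : ℝ) - (n : ℝ)|) ∧ α = Set.range γ

/-- `Y` is Morse: there is `μ` such that every `(L,A)`-quasi-geodesic with endpoints on
`Y` stays in the `μ(L,A)`-neighborhood of `Y`. -/
def IsMorse {G : Type*} [Group G] (S : Set G) (Y : Set G) : Prop :=
  ∃ μ : ℝ → ℝ → ℝ, ∀ L A : ℝ, 1 ≤ L → 0 ≤ A →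
    ∀ (q : ℤ → G) (m n : ℤ), m ≤ n → q m ∈ Y → q n ∈ Y →
    (∀ i j : ℤ, m ≤ i → i ≤ n → m ≤ j → j ≤ n →
      L⁻¹ * |(i : ℝ) - (j : ℝ)| - A ≤ wdist S (q i) (q j) ∧
      wdist S (q i) (q j) ≤ L * |(i : ℝ) - (j : ℝ)| + A) →
    ∀ i : ℤ, m ≤ i → i ≤ n → setDist S (q i) Y ≤ μ L A

/-- Two subsets are at finite Hausdorff distance in the word metric. -/
def FinHausdorffDist {G : Type*} [Group G] (S : Set G) (A B : Set G) : Prop :=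
  ∃ ε : ℝ, (∀ a ∈ A, ∃ b ∈ B, wdist S a b ≤ ε) ∧ ∀ b ∈ B, ∃ a ∈ A, wdist S a b ≤ ε

/-- The embedded relator cycle determined by `g ∈ G(Γ)` and a relator `r`:
the set `{g ⋅ p̄ : p a prefix of r}`. -/
def relatorCycle {S : Type} (P : C6Presentation S) (g : P.Grp) (r : Word S) :
    Set P.Grp :=
  {x | ∃ p : Word S, p <+: r ∧ x = g * P.elt p}

/-- A geodesic `α` is locally `(ρ₁,ρ₂)`-contracting: for every embedded relator cycle
`Γ₀` meeting `α`, the set `Γ₀ ∩ α` is `(ρ₁,ρ₂)`-contracting as a subspace of `Γ₀`. -/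
def LocallyContracting {S : Type} (P : C6Presentation S) (α : Set P.Grp)
    (ρ₁ ρ₂ : ℝ → ℝ) : Prop :=
  ∀ (g : P.Grp) (r : Word S), r ∈ P.rels → (relatorCycle P g r ∩ α).Nonempty →
    ContractingIn P.gens (relatorCycle P g r) (relatorCycle P g r ∩ α) ρ₁ ρ₂

/-- The generating set `S ∪ W` of the coned-off space: `W` is the set of elements
represented by subwords of cyclic permutations of relators (equivalently, by prefixes
of relators, since the relator set is closed under cyclic permutation). -/
def conedGens {S : Type} (P : C6Presentation S) : Set P.Grp :=
  P.gens ∪ {x | ∃ r ∈ P.rels, ∃ p : Word S, p <+: r ∧ x = P.elt p}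

/-- The exponential growth rate of `(G,S)`. -/
noncomputable def growthRate {G : Type*} [Group G] (S : Set G) : ℝ :=
  limsup (fun n : ℕ => Real.log (Nat.card {g : G // wordLength S g ≤ n}) / (n : ℝ)) atTop

/-- Quasi-isometry of marked groups `(G,S)` and `(H,T)` via word metrics. -/
def QIsom {G H : Type*} [Group G] [Group H] (S : Set G) (T : Set H) : Prop :=
  ∃ (f : G → H) (L A : ℝ), 1 ≤ L ∧ 0 ≤ A ∧
    (∀ x y : G, L⁻¹ * wdist S x y - A ≤ wdist T (f x) (f y) ∧
      wdist T (f x) (f y) ≤ L * wdist S x y + A) ∧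
    ∀ h : H, ∃ x : G, wdist T (f x) h ≤ A

/-- A subgroup is virtually cyclic if it contains a cyclic subgroup of finite index. -/
def VirtuallyCyclic {G : Type*} [Group G] (E : Subgroup G) : Prop :=
  ∃ g : G, Subgroup.zpowers g ≤ E ∧ ((Subgroup.zpowers g).subgroupOf E).index ≠ 0

end GSC

namespace GSC

section Words

variable {S : Type}

/-- The formal inverse of a letter. -/
def linv (l : S × Bool) : S × Bool := (l.1, !l.2)

@[simp] theorem linv_linv (l : S × Bool) : linv (linv l) = l := by
  simp [linv]

theorem linv_ne (l : S × Bool) : linv l ≠ l := by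
  rcases l with ⟨a, b⟩
  cases b <;> simp [linv]

theorem linv_injective : Function.Injective (linv : S × Bool → S × Bool) :=
  Function.LeftInverse.injective linv_linv

theorem linv_eq_iff {a b : S × Bool} : linv a = b ↔ a = linv b :=
  ⟨fun h => by rw [← h, linv_linv], fun h => by rw [h, linv_linv]⟩

theorem wordInv_eq (w : Word S) : wordInv w = (w.map linv).reverse := rfl

@[simp] theorem length_wordInv (w : Word S) : (wordInv w).length = w.length := by
  simp [wordInv]

@[simp] theorem wordInv_nil : wordInv ([] : Word S) = [] := rfl

theorem wordInv_append (v w : Word S) : wordInv (v ++ w) = wordInv w ++ wordInv v := by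
  simp [wordInv]

theorem wordInv_cons (a : S × Bool) (w : Word S) : wordInv (a :: w) = wordInv w ++ [linv a] := by
  simp [wordInv, linv]

@[simp] theorem wordInv_wordInv (w : Word S) : wordInv (wordInv w) = w := by
  induction w with
  | nil => rfl
  | cons a w ih => rw [wordInv_cons, wordInv_append, ih]; simp [wordInv, linv]

/-- The value of a letter in the free group. -/
def fltr (l : S × Bool) : FreeGroup S := (FreeGroup.of l.1) ^ (if l.2 then (1 : ℤ) else -1)

theorem fltr_linv (l : S × Bool) : fltr (linv l) = (fltr l)⁻¹ := by
  rcases l with ⟨a, b⟩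
  cases b <;> simp [fltr, linv]

@[simp] theorem wordVal_nil : wordVal ([] : Word S) = 1 := rfl

theorem wordVal_cons (a : S × Bool) (w : Word S) : wordVal (a :: w) = fltr a * wordVal w := rfl

theorem wordVal_append (v w : Word S) : wordVal (v ++ w) = wordVal v * wordVal w := by
  simp [wordVal]

theorem wordVal_singleton (a : S × Bool) : wordVal [a] = fltr a := by
  simp [wordVal_cons]

theorem wordVal_wordInv (w : Word S) : wordVal (wordInv w) = (wordVal w)⁻¹ := by
  induction w with
  | nil => simp
  | cons a w ih => rw [wordInv_cons, wordVal_append, ih, wordVal_singleton, fltr_linv,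
      wordVal_cons, mul_inv_rev]

theorem wordVal_eq_mk (w : Word S) : wordVal w = FreeGroup.mk w := by
  induction w with
  | nil => rfl
  | cons a w ih =>
    rw [wordVal_cons, ih]
    rcases a with ⟨a, b⟩
    cases b <;> simp [fltr, FreeGroup.of, FreeGroup.inv_mk, FreeGroup.invRev]

theorem exists_wordVal (x : FreeGroup S) : ∃ w : Word S, wordVal w = x :=
  let ⟨w, hw⟩ := Quot.exists_rep x
  ⟨w, (wordVal_eq_mk w).trans hw⟩

end Words

section Elt

variable {S : Type} (P : C6Presentation S)

theorem elt_eq_mk (w : Word S) : P.elt w = PresentedGroup.mk (wordVal '' P.rels) (wordVal w) := by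
  simp only [C6Presentation.elt, wordVal, map_list_prod, List.map_map]
  congr 1

@[simp] theorem elt_nil : P.elt [] = 1 := rfl

theorem elt_append (v w : Word S) : P.elt (v ++ w) = P.elt v * P.elt w := by
  simp [elt_eq_mk, wordVal_append]

theorem elt_cons (a : S × Bool) (w : Word S) : P.elt (a :: w) = P.elt [a] * P.elt w := by
  rw [← elt_append]; rfl

theorem elt_wordInv (w : Word S) : P.elt (wordInv w) = (P.elt w)⁻¹ := by
  simp [elt_eq_mk, wordVal_wordInv]

theorem elt_linv (a : S × Bool) : P.elt [linv a] = (P.elt [a])⁻¹ := by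
  rw [← elt_wordInv]; rfl

theorem elt_eq_one_iff (w : Word S) :
    P.elt w = 1 ↔ wordVal w ∈ Subgroup.normalClosure (wordVal '' P.rels) := by
  rw [elt_eq_mk, PresentedGroup.mk_eq_one_iff]

theorem elt_rel {r : Word S} (h : r ∈ P.rels) : P.elt r = 1 := by
  rw [elt_eq_one_iff]
  exact Subgroup.subset_normalClosure ⟨r, h, rfl⟩

theorem exists_elt (x : P.Grp) : ∃ w : Word S, P.elt w = x := by
  obtain ⟨y, rfl⟩ := PresentedGroup.mk_surjective (wordVal '' P.rels) x
  obtain ⟨w, rfl⟩ := exists_wordVal y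
  exact ⟨w, elt_eq_mk P w⟩

end Elt

section Metric

theorem wordLength_le {G : Type*} [Group G] {A : Set G} (l : List G)
    (hl : ∀ x ∈ l, x ∈ A ∨ x⁻¹ ∈ A) : wordLength A l.prod ≤ l.length :=
  Nat.sInf_le ⟨l, rfl, hl, rfl⟩

/-- `A` generates `G` as a monoid with its inverses. -/
def Gen {G : Type*} [Group G] (A : Set G) : Prop :=
  ∀ g : G, ∃ l : List G, (∀ x ∈ l, x ∈ A ∨ x⁻¹ ∈ A) ∧ l.prod = g

theorem Gen.exists_list {G : Type*} [Group G] {A : Set G} (hA : Gen A) (g : G) :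
    ∃ l : List G, l.length = wordLength A g ∧ (∀ x ∈ l, x ∈ A ∨ x⁻¹ ∈ A) ∧ l.prod = g := by
  have : {n : ℕ | ∃ l : List G, l.length = n ∧ (∀ x ∈ l, x ∈ A ∨ x⁻¹ ∈ A) ∧ l.prod = g}.Nonempty := by
    obtain ⟨l, h1, h2⟩ := hA g
    exact ⟨l.length, l, rfl, h1, h2⟩
  exact Nat.sInf_mem this

theorem Gen.wordLength_mul_le {G : Type*} [Group G] {A : Set G} (hA : Gen A) (g h : G) :
    wordLength A (g * h) ≤ wordLength A g + wordLength A h := by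
  obtain ⟨l, h1, h2, h3⟩ := hA.exists_list g
  obtain ⟨m, k1, k2, k3⟩ := hA.exists_list h
  rw [← h1, ← k1, ← List.length_append]
  conv_lhs => rw [← h3, ← k3, ← List.prod_append]
  apply wordLength_le
  intro x hx
  rcases List.mem_append.1 hx with hx | hx
  exacts [h2 x hx, k2 x hx]

theorem Gen.wordLength_inv_le {G : Type*} [Group G] {A : Set G} (hA : Gen A) (g : G) :
    wordLength A g⁻¹ ≤ wordLength A g := by
  obtain ⟨l, h1, h2, h3⟩ := hA.exists_list g
  rw [← h1]
  conv_lhs => rw [← h3, List.prod_inv_reverse]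
  refine (wordLength_le _ ?_).trans (by simp)
  intro x hx
  simp only [List.mem_reverse, List.mem_map] at hx
  obtain ⟨y, hy, rfl⟩ := hx
  rw [inv_inv]
  exact (h2 y hy).symm

theorem Gen.wordLength_inv {G : Type*} [Group G] {A : Set G} (hA : Gen A) (g : G) :
    wordLength A g⁻¹ = wordLength A g :=
  le_antisymm (hA.wordLength_inv_le g) (by simpa using hA.wordLength_inv_le g⁻¹)

@[simp] theorem wordLength_one {G : Type*} [Group G] (A : Set G) : wordLength A 1 = 0 :=
  Nat.le_zero.1 (wordLength_le (A := A) [] (by simp))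

variable {S : Type} (P : C6Presentation S)

theorem elt_singleton_mem (a : S × Bool) : P.elt [a] ∈ P.gens ∨ (P.elt [a])⁻¹ ∈ P.gens := by
  rcases a with ⟨a, b⟩
  cases b
  · right; simp [C6Presentation.elt, C6Presentation.gens]
  · left; simp [C6Presentation.elt, C6Presentation.gens]

theorem elt_eq_prod (w : Word S) : P.elt w = (w.map fun a => P.elt [a]).prod := by
  induction w with
  | nil => rfl
  | cons a w ih => rw [elt_cons, ih]; simp

theorem gen_gens : Gen P.gens := by
  intro g
  obtain ⟨w, rfl⟩ := exists_elt P g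
  refine ⟨w.map fun a => P.elt [a], ?_, (elt_eq_prod P w).symm⟩
  intro x hx
  obtain ⟨a, -, rfl⟩ := List.mem_map.1 hx
  exact elt_singleton_mem P a

theorem wordLength_elt_le (w : Word S) : wordLength P.gens (P.elt w) ≤ w.length := by
  rw [elt_eq_prod]
  refine (wordLength_le _ ?_).trans (by simp)
  intro x hx
  obtain ⟨a, -, rfl⟩ := List.mem_map.1 hx
  exact elt_singleton_mem P a

theorem exists_letter {x : P.Grp} (h : x ∈ P.gens ∨ x⁻¹ ∈ P.gens) : ∃ a, P.elt [a] = x := by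
  rcases h with ⟨a, ha⟩ | ⟨a, ha⟩
  · exact ⟨(a, true), by simpa [C6Presentation.elt] using ha⟩
  · refine ⟨(a, false), ?_⟩
    rw [← inv_inj, ← ha]
    simp [C6Presentation.elt]

/-- A geodesic word. -/
def Geo (w : Word S) : Prop := wordLength P.gens (P.elt w) = w.length

theorem exists_geo (x : P.Grp) : ∃ w, P.elt w = x ∧ Geo P w := by
  obtain ⟨l, h1, h2, h3⟩ := (gen_gens P).exists_list x
  have : ∃ w : Word S, w.map (fun a => P.elt [a]) = l := by
    clear h1 h3
    induction l with
    | nil => exact ⟨[], rfl⟩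
    | cons y l ih =>
      obtain ⟨w, hw⟩ := ih fun x hx => h2 x (List.mem_cons_of_mem _ hx)
      obtain ⟨a, ha⟩ := exists_letter P (h2 y List.mem_cons_self)
      exact ⟨a :: w, by simp [ha, hw]⟩
  obtain ⟨w, hw⟩ := this
  have e : P.elt w = x := by rw [elt_eq_prod, hw, h3]
  exact ⟨w, e, by rw [Geo, e, ← h1, ← hw, List.length_map]⟩

theorem Geo.of_append {u v w : Word S} (h : Geo P (u ++ v ++ w)) : Geo P v := by
  have h1 := (gen_gens P).wordLength_mul_le (P.elt u * P.elt v) (P.elt w)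
  have h2 := (gen_gens P).wordLength_mul_le (P.elt u) (P.elt v)
  have h3 := wordLength_elt_le P u
  have h4 := wordLength_elt_le P v
  have h5 := wordLength_elt_le P w
  unfold Geo at *
  rw [elt_append, elt_append] at h
  simp only [List.length_append] at h
  omega

theorem Geo.subword {v w : Word S} (h : Geo P w) (hv : v <:+: w) : Geo P v := by
  obtain ⟨a, b, rfl⟩ := hv
  exact h.of_append P

/-- The word metric with natural number values. -/
noncomputable def dst (x y : P.Grp) : ℕ := wordLength P.gens (x⁻¹ * y)

theorem wdist_eq_dst (x y : P.Grp) : wdist P.gens x y = (dst P x y : ℝ) := rfl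

@[simp] theorem dst_self (x : P.Grp) : dst P x x = 0 := by simp [dst]

theorem dst_comm (x y : P.Grp) : dst P x y = dst P y x := by
  unfold dst
  rw [← (gen_gens P).wordLength_inv]
  congr 1
  group

theorem dst_triangle (x y z : P.Grp) : dst P x z ≤ dst P x y + dst P y z := by
  unfold dst
  convert (gen_gens P).wordLength_mul_le (x⁻¹ * y) (y⁻¹ * z) using 2
  group

theorem dst_mul_left (a x y : P.Grp) : dst P (a * x) (a * y) = dst P x y := by
  unfold dst
  congr 1
  group

theorem dst_mul_elt_le (x : P.Grp) (w : Word S) : dst P x (x * P.elt w) ≤ w.length := by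
  unfold dst
  rw [inv_mul_cancel_left]
  exact wordLength_elt_le P w

theorem Geo.dst {w : Word S} (h : Geo P w) (x : P.Grp) : dst P x (x * P.elt w) = w.length := by
  unfold GSC.dst
  rw [inv_mul_cancel_left]
  exact h

theorem gen_coned : Gen (conedGens P) := by
  intro g
  obtain ⟨l, h1, h2⟩ := gen_gens P g
  exact ⟨l, fun x hx => (h1 x hx).imp Or.inl Or.inl, h2⟩

theorem coned_le_gens (x : P.Grp) : wordLength (conedGens P) x ≤ wordLength P.gens x := by
  obtain ⟨l, h1, h2, h3⟩ := (gen_gens P).exists_list x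
  rw [← h1, ← h3]
  exact wordLength_le _ fun x hx => (h2 x hx).imp Or.inl Or.inl

theorem coned_prefix_le {r p : Word S} (hr : r ∈ P.rels) (hp : p <+: r) :
    wordLength (conedGens P) (P.elt p) ≤ 1 := by
  have := wordLength_le (A := conedGens P) [P.elt p] (by
    intro x hx
    rw [List.mem_singleton] at hx
    exact Or.inl (Or.inr ⟨r, hr, p, hp, hx⟩))
  simpa using this

end Metric

section

section ConjProd

/-- The element `x` times a product of conjugates of the members of the list is trivial. -/
def CP {F : Type*} [Group F] : F → List F → Prop
  | x, [] => x = 1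
  | x, f :: fs => ∃ u, CP (x * u * f * u⁻¹) fs

theorem CP.map {F F' : Type*} [Group F] [Group F'] (h : F →* F') {fs : List F} {x : F}
    (H : CP x fs) : CP (h x) (fs.map h) := by
  induction fs generalizing x with
  | nil => simp only [CP, List.map_nil] at *; rw [H, map_one]
  | cons f fs ih =>
    obtain ⟨u, hu⟩ := H
    exact ⟨h u, by simpa using ih hu⟩

theorem CP.filter {F : Type*} [Group F] (R : F → Prop) {fs : List F} {x : F} (H : CP x fs)
    (hR : ∀ f ∈ fs, f = 1 ∨ R f) :
    ∃ gs : List F, CP x gs ∧ (∀ f ∈ gs, R f) ∧ gs.length ≤ fs.length ∧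
      (1 ∈ fs → gs.length < fs.length) := by
  induction fs generalizing x with
  | nil => exact ⟨[], H, by simp, by simp, by simp⟩
  | cons f fs ih =>
    obtain ⟨u, hu⟩ := H
    obtain ⟨gs, h1, h2, h3, h4⟩ := ih hu fun f hf => hR f (List.mem_cons_of_mem _ hf)
    by_cases hf : f = 1
    · subst hf
      refine ⟨gs, by simpa using h1, h2, h3.trans (by simp), fun _ => ?_⟩
      simp only [List.length_cons]; omega
    · refine ⟨f :: gs, ⟨u, h1⟩, ?_, by simpa using h3, ?_⟩
      · intro y hy
        rcases List.mem_cons.1 hy with rfl | hy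
        · exact (hR y List.mem_cons_self).resolve_left hf
        · exact h2 y hy
      · intro h
        rcases List.mem_cons.1 h with h | h
        · exact absurd h.symm hf
        · simpa using h4 h

theorem CP.append {F : Type*} [Group F] {fs gs : List F} {x y : F} (H : CP x fs) (H' : CP y gs) :
    CP (y * x) (fs ++ gs) := by
  induction fs generalizing x with
  | nil =>
    simp only [CP] at H
    simpa [H] using H'
  | cons f fs ih =>
    obtain ⟨u, hu⟩ := H
    refine ⟨u, ?_⟩
    have := ih hu
    simp only [mul_assoc] at this ⊢
    exact this

theorem CP.conj {F : Type*} [Group F] {fs : List F} {x : F} (H : CP x fs) (v : F) :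
    CP (v * x * v⁻¹) fs := by
  induction fs generalizing x with
  | nil => simp only [CP] at *; simp [H]
  | cons f fs ih =>
    obtain ⟨u, hu⟩ := H
    refine ⟨v * u, ?_⟩
    convert ih hu using 1
    group

variable {S : Type} (P : C6Presentation S)

/-- `x` is a product of `n` conjugates of relators. -/
def NProd (n : ℕ) (x : FreeGroup S) : Prop :=
  ∃ fs : List (FreeGroup S), fs.length = n ∧ (∀ f ∈ fs, f ∈ wordVal '' P.rels) ∧ CP x fs

theorem exists_nProd {x : FreeGroup S} (h : x ∈ Subgroup.normalClosure (wordVal '' P.rels)) :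
    ∃ n, NProd P n x := by
  suffices ∃ fs : List (FreeGroup S), (∀ f ∈ fs, f ∈ wordVal '' P.rels) ∧ CP x fs by
    obtain ⟨fs, h1, h2⟩ := this
    exact ⟨_, fs, rfl, h1, h2⟩
  let N : Subgroup (FreeGroup S) :=
    { carrier := {x | ∃ fs : List (FreeGroup S), (∀ f ∈ fs, f ∈ wordVal '' P.rels) ∧ CP x fs}
      one_mem' := ⟨[], by simp, rfl⟩
      mul_mem' := by
        rintro a b ⟨fs, h1, h2⟩ ⟨gs, h3, h4⟩
        refine ⟨gs ++ fs, ?_, h4.append h2⟩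
        intro f hf
        rcases List.mem_append.1 hf with hf | hf
        exacts [h3 f hf, h1 f hf]
      inv_mem' := by
        rintro a ⟨fs, h1, h2⟩
        suffices H : ∀ fs : List (FreeGroup S), (∀ f ∈ fs, f ∈ wordVal '' P.rels) →
            ∀ x, CP x fs → ∃ gs : List (FreeGroup S),
            (∀ f ∈ gs, f ∈ wordVal '' P.rels) ∧ CP x⁻¹ gs from H fs h1 a h2
        clear h1 h2 fs a
        intro fs
        induction fs with
        | nil =>
          intro _ x hx
          refine ⟨[], by simp, ?_⟩
          simp only [CP] at *
          simp [hx]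
        | cons f fs ih =>
          rintro hf x ⟨u, hu⟩
          obtain ⟨gs, h1, h2⟩ := ih (fun y hy => hf y (List.mem_cons_of_mem _ hy)) _ hu
          obtain ⟨r, hr, hrf⟩ := hf f List.mem_cons_self
          refine ⟨gs ++ [f⁻¹], ?_, ?_⟩
          · intro y hy
            rcases List.mem_append.1 hy with hy | hy
            · exact h1 y hy
            · rw [List.mem_singleton] at hy
              exact ⟨_, P.inv_mem r hr, by rw [wordVal_wordInv, hrf, hy]⟩
          · have h3 : CP (x⁻¹ * (x * u * f * u⁻¹)) [f⁻¹] := ⟨u, by simp only [CP]; group⟩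
            have := h2.append h3
            simpa [mul_assoc] using this }
  have hN : N.Normal := ⟨by
    rintro a ⟨fs, h1, h2⟩ v
    exact ⟨fs, h1, h2.conj v⟩⟩
  have : Subgroup.normalClosure (wordVal '' P.rels) ≤ N := by
    apply Subgroup.normalClosure_le_normal
    rintro - ⟨r, hr, rfl⟩
    refine ⟨[wordVal (wordInv r)], ?_, 1, ?_⟩
    · intro f hf
      rw [List.mem_singleton] at hf
      exact hf ▸ ⟨_, P.inv_mem r hr, rfl⟩
    · simp [CP, wordVal_wordInv]
  exact this h

end ConjProd

section Walks

/-- A walk along a list of darts. -/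
def IsWalk (src : ℕ × Bool → ℕ) : ℕ → Word ℕ → ℕ → Prop
  | u, [], v => u = v
  | u, d :: l, v => src d = u ∧ IsWalk src (src (linv d)) l v

variable {src : ℕ × Bool → ℕ}

theorem isWalk_append {l m : Word ℕ} {u v : ℕ} :
    IsWalk src u (l ++ m) v ↔ ∃ w, IsWalk src u l w ∧ IsWalk src w m v := by
  induction l generalizing u with
  | nil => simp [IsWalk]
  | cons d l ih => simp [IsWalk, ih, and_assoc]

theorem IsWalk.comp {l : Word ℕ} {u v : ℕ} (h : IsWalk src u l v) (π : ℕ → ℕ) :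
    IsWalk (π ∘ src) (π u) l (π v) := by
  induction l generalizing u with
  | nil => simp only [IsWalk] at *; rw [h]
  | cons d l ih => exact ⟨congrArg π h.1, ih h.2⟩

theorem IsWalk.congr {src' : ℕ × Bool → ℕ} {l : Word ℕ} {u v : ℕ} (h : IsWalk src u l v)
    (H : ∀ d ∈ l, src' d = src d ∧ src' (linv d) = src (linv d)) : IsWalk src' u l v := by
  induction l generalizing u with
  | nil => exact h
  | cons d l ih =>
    have h1 := H d List.mem_cons_self
    refine ⟨h1.1.trans h.1, ?_⟩
    rw [h1.2]
    exact ih h.2 fun e he => H e (List.mem_cons_of_mem _ he)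

theorem IsWalk.map {l : Word ℕ} {u v : ℕ} (h : IsWalk src u l v) {ρ : ℕ × Bool → ℕ × Bool}
    (h1 : ∀ d, src (ρ d) = src d) (h2 : ∀ d, ρ (linv d) = linv (ρ d)) :
    IsWalk src u (l.map ρ) v := by
  induction l generalizing u with
  | nil => exact h
  | cons d l ih =>
    refine ⟨(h1 d).trans h.1, ?_⟩
    rw [← h2, h1]
    exact ih h.2

theorem IsWalk.mem_or {l : Word ℕ} {u v : ℕ} (h : IsWalk src u l v) :
    u = v ∨ u ∈ l.map src := by
  cases l with
  | nil => exact Or.inl h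
  | cons d l => right; simp [← h.1]

end Walks

variable {S : Type} (P : C6Presentation S)

/-- A (singular) disc diagram over `P` with boundary word `W`, as a gluing pattern of polygons;
darts are letters over `ℕ`, and `linv` interchanges the two darts of an edge. -/
structure Dia (k : ℕ) (W : Word S) where
  out : Word ℕ
  faces : List (Word ℕ)
  L : ℕ × Bool → S × Bool
  src : ℕ × Bool → ℕ
  base : ℕ
  val : ℕ → P.Grp
  faces_length : faces.length = k
  L_linv : ∀ d, L (linv d) = linv (L d)
  nodup : (out ++ faces.flatten).Nodup
  closed : ∀ d ∈ out ++ faces.flatten, linv d ∈ out ++ faces.flatten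
  out_label : out.map L = W
  face_rel : ∀ f ∈ faces, f.map L ∈ P.rels
  out_walk : IsWalk src base out base
  face_walk : ∀ f ∈ faces, ∃ u, IsWalk src u f u
  euler : (out ++ faces.flatten).length + 2 ≤
    2 * (insert base ((out ++ faces.flatten).map src).toFinset).card + 2 * k
  val_step : ∀ d ∈ out ++ faces.flatten, val (src (linv d)) = val (src d) * P.elt [L d]
  cp : CP (wordVal out) (faces.map wordVal)

variable {P}

theorem Dia.val_walk {k : ℕ} {W : Word S} (D : Dia P k W) {l : Word ℕ}
    (hl : ∀ d ∈ l, d ∈ D.out ++ D.faces.flatten) {u v : ℕ} (h : IsWalk D.src u l v) :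
    D.val v = D.val u * P.elt (l.map D.L) := by
  induction l generalizing u with
  | nil => simp [show u = v from h]
  | cons d l ih =>
    rw [ih (fun e he => hl e (List.mem_cons_of_mem _ he)) h.2,
      D.val_step d (hl d List.mem_cons_self), h.1, List.map_cons, elt_cons P _ (l.map _), mul_assoc]

theorem Dia.empty (s : S) : Nonempty (Dia P 0 []) :=
  ⟨{  out := []
      faces := []
      L := fun d => (s, d.2)
      src := fun _ => 0
      base := 0
      val := fun _ => 1
      faces_length := rfl
      L_linv := fun _ => rfl
      nodup := by simp
      closed := by simp
      out_label := rfl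
      face_rel := by simp
      out_walk := rfl
      face_walk := by simp
      euler := by simp
      val_step := by simp
      cp := rfl }⟩

end

section

variable {S : Type} {P : C6Presentation S}

theorem toFinset_map_comp (π : ℕ → ℕ) (b : ℕ) (src : ℕ × Bool → ℕ) (l : Word ℕ) :
    insert (π b) (l.map (π ∘ src)).toFinset = (insert b (l.map src).toFinset).image π := by
  rw [Finset.image_insert, ← List.map_map]
  congr 1
  ext x
  simp only [List.mem_toFinset, List.mem_map, Finset.mem_image]

theorem card_image_merge (u u' : ℕ) (s : Finset ℕ) :
    s.card ≤ (s.image fun v => if v = u' then u else v).card + 1 := by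
  have h1 : (s.erase u').card ≤ (s.image fun v => if v = u' then u else v).card := by
    rw [← Finset.card_image_of_injOn (f := fun v => if v = u' then u else v) (s := s.erase u')]
    · exact Finset.card_le_card (Finset.image_subset_image (Finset.erase_subset _ _))
    · intro a ha b hb h
      simp only [Finset.coe_erase, Set.mem_sdiff, Set.mem_singleton_iff] at ha hb
      simpa [ha.2, hb.2] using h
  have h2 := Finset.pred_card_le_card_erase (s := s) (a := u')
  omega

theorem Dia.cut {k : ℕ} {A B r : Word S} (D : Dia P k (A ++ r ++ B)) (hr : r ∈ P.rels) :
    Nonempty (Dia P (k + 1) (A ++ B)) := by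
  obtain ⟨l₁₂, l₂, h1, h2, h3⟩ := List.map_eq_append_iff.1 D.out_label
  obtain ⟨l₁, m, h4, h5, h6⟩ := List.map_eq_append_iff.1 h2
  subst h4
  have hw := D.out_walk
  rw [h1, isWalk_append] at hw
  obtain ⟨u', hw, hw3⟩ := hw
  rw [isWalk_append] at hw
  obtain ⟨u, hw1, hw2⟩ := hw
  let π : ℕ → ℕ := fun v => if v = u' then u else v
  have hu : π u = u := by simp only [π]; split_ifs <;> rfl
  have hu' : π u' = u := by simp [π]
  have hsub : ∀ d ∈ m, d ∈ D.out ++ D.faces.flatten := by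
    intro d hd; rw [h1]; simp [hd]
  have hval : D.val u' = D.val u := by
    rw [D.val_walk hsub hw2, h6, elt_rel P hr, mul_one]
  have hvπ : ∀ v, D.val (π v) = D.val v := by
    intro v
    simp only [π]
    split_ifs with h
    · rw [h, hval]
    · rfl
  have hperm : ((l₁ ++ l₂) ++ (m :: D.faces).flatten).Perm (D.out ++ D.faces.flatten) := by
    rw [h1, List.flatten_cons]
    simp only [List.append_assoc]
    refine List.Perm.append_left _ ?_
    rw [← List.append_assoc, ← List.append_assoc]
    exact List.Perm.append_right _ List.perm_append_comm
  refine ⟨⟨l₁ ++ l₂, m :: D.faces, D.L, π ∘ D.src, π D.base, D.val,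
    ?_, ?_, ?_, ?_, ?_, ?_, ?_, ?_, ?_, ?_, ?_⟩⟩
  · simp [D.faces_length]
  · exact D.L_linv
  · exact hperm.nodup_iff.2 D.nodup
  · intro d hd
    rw [hperm.mem_iff] at hd ⊢
    exact D.closed d hd
  · rw [List.map_append, h5, h3]
  · intro f hf
    rcases List.mem_cons.1 hf with rfl | hf
    · rw [h6]; exact hr
    · exact D.face_rel f hf
  · rw [isWalk_append]
    refine ⟨u, ?_, ?_⟩
    · rw [← hu]; exact hw1.comp π
    · rw [← hu']; exact hw3.comp π
  · intro f hf
    rcases List.mem_cons.1 hf with rfl | hf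
    · refine ⟨u, ?_⟩
      have := hw2.comp π
      rwa [hu, hu'] at this
    · obtain ⟨v, hv⟩ := D.face_walk f hf
      exact ⟨π v, hv.comp π⟩
  · have h7 := D.euler
    have h8 := card_image_merge u u' (insert D.base ((D.out ++ D.faces.flatten).map D.src).toFinset)
    rw [← hperm.length_eq] at h7
    rw [List.toFinset_eq_of_perm _ _ (hperm.map (π ∘ D.src)), toFinset_map_comp]
    change _ ≤ (Finset.image π _).card + 1 at h8
    omega
  · intro d hd
    rw [hperm.mem_iff] at hd
    simp only [Function.comp, hvπ]
    exact D.val_step d hd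
  · refine ⟨(wordVal l₂)⁻¹, ?_⟩
    have := D.cp
    rw [h1] at this
    simpa [wordVal_append, mul_assoc] using this

theorem Dia.insertPair {k : ℕ} {A B : Word S} (D : Dia P k (A ++ B)) (a : S × Bool) :
    Nonempty (Dia P k (A ++ [a, linv a] ++ B)) := by
  obtain ⟨l₁, l₂, h1, h2, h3⟩ := List.map_eq_append_iff.1 D.out_label
  have hw := D.out_walk
  rw [h1, isWalk_append] at hw
  obtain ⟨u, hw1, hw2⟩ := hw
  set ds := D.out ++ D.faces.flatten with hds
  obtain ⟨e, he⟩ := Infinite.exists_notMem_finset (ds.map Prod.fst).toFinset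
  obtain ⟨v, hv⟩ := Infinite.exists_notMem_finset (insert u (insert D.base (ds.map D.src).toFinset))
  have hne : ∀ d ∈ ds, d.1 ≠ e := by
    rintro d hd rfl
    exact he (List.mem_toFinset.2 (List.mem_map.2 ⟨d, hd, rfl⟩))
  have hvs : ∀ d ∈ ds, D.src d ≠ v := by
    rintro d hd rfl
    exact hv (Finset.mem_insert_of_mem (Finset.mem_insert_of_mem
      (List.mem_toFinset.2 (List.mem_map.2 ⟨d, hd, rfl⟩))))
  have hvb : v ≠ D.base := fun h => hv (h ▸ by simp)
  have hvu : v ≠ u := fun h => hv (h ▸ by simp)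
  let L : ℕ × Bool → S × Bool := fun d => if d.1 = e then (if d.2 then a else linv a) else D.L d
  let src : ℕ × Bool → ℕ := fun d => if d.1 = e then (if d.2 then u else v) else D.src d
  let val : ℕ → P.Grp := fun x => if x = v then D.val u * P.elt [a] else D.val x
  have hL : ∀ d ∈ ds, L d = D.L d := fun d hd => if_neg (hne d hd)
  have hsrc : ∀ d ∈ ds, src d = D.src d := fun d hd => if_neg (hne d hd)
  have hsrc' : ∀ d ∈ ds, src (linv d) = D.src (linv d) := fun d hd => if_neg (hne d hd)
  have hLf : ∀ l : Word ℕ, (∀ d ∈ l, d ∈ ds) → l.map L = l.map D.L := fun l hl =>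
    List.map_congr_left fun d hd => hL d (hl d hd)
  have hwf : ∀ (l : Word ℕ) (x y : ℕ), (∀ d ∈ l, d ∈ ds) → IsWalk D.src x l y → IsWalk src x l y :=
    fun l x y hl h => h.congr fun d hd => ⟨hsrc d (hl d hd), hsrc' d (hl d hd)⟩
  have m1 : ∀ d ∈ l₁, d ∈ ds := fun d hd => by rw [hds, h1]; simp [hd]
  have m2 : ∀ d ∈ l₂, d ∈ ds := fun d hd => by rw [hds, h1]; simp [hd]
  have m3 : ∀ f ∈ D.faces, ∀ d ∈ f, d ∈ ds := fun f hf d hd => by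
    rw [hds]; exact List.mem_append_right _ (List.mem_flatten.2 ⟨f, hf, hd⟩)
  have hperm : ((l₁ ++ [(e, true), (e, false)] ++ l₂) ++ D.faces.flatten).Perm
      ((e, true) :: (e, false) :: ds) := by
    rw [hds, h1]
    simp only [List.append_assoc, List.cons_append, List.nil_append]
    exact (List.perm_middle.trans (List.Perm.cons _ List.perm_middle))
  refine ⟨⟨l₁ ++ [(e, true), (e, false)] ++ l₂, D.faces, L, src, D.base, val,
    ?_, ?_, ?_, ?_, ?_, ?_, ?_, ?_, ?_, ?_, ?_⟩⟩
  · exact D.faces_length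
  · rintro ⟨x, b⟩
    by_cases hx : x = e
    · cases b <;> simp [L, linv, hx]
    · simp only [L, linv, hx, if_false]
      exact D.L_linv (x, b)
  · rw [hperm.nodup_iff]
    refine List.nodup_cons.2 ⟨?_, List.nodup_cons.2 ⟨?_, D.nodup⟩⟩
    · intro h
      rcases List.mem_cons.1 h with h | h
      · simp at h
      · exact hne _ h rfl
    · intro h
      exact hne _ h rfl
  · intro d hd
    rw [hperm.mem_iff] at hd ⊢
    simp only [List.mem_cons] at hd ⊢
    rcases hd with rfl | rfl | hd
    · simp [linv]
    · simp [linv]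
    · exact Or.inr (Or.inr (D.closed d hd))
  · rw [List.map_append, List.map_append, hLf _ m1, hLf _ m2, h2, h3]
    simp [L]
  · intro f hf
    rw [hLf f (m3 f hf)]
    exact D.face_rel f hf
  · rw [isWalk_append]
    refine ⟨u, ?_, hwf _ _ _ m2 hw2⟩
    rw [isWalk_append]
    refine ⟨u, hwf _ _ _ m1 hw1, ?_⟩
    simp [IsWalk, src, linv]
  · intro f hf
    obtain ⟨x, hx⟩ := D.face_walk f hf
    exact ⟨x, hwf _ _ _ (m3 f hf) hx⟩
  · have h7 := D.euler
    rw [hperm.length_eq, List.toFinset_eq_of_perm _ _ (hperm.map src)]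
    have : insert v (insert D.base (ds.map D.src).toFinset) ⊆
        insert D.base (((e, true) :: (e, false) :: ds).map src).toFinset := by
      intro x hx
      simp only [Finset.mem_insert, List.mem_toFinset, List.mem_map, List.map_cons,
        List.mem_cons] at hx ⊢
      rcases hx with rfl | rfl | ⟨d, hd, rfl⟩
      · simp [src]
      · simp
      · exact Or.inr (Or.inr (Or.inr ⟨d, hd, hsrc d hd⟩))
    have h8 := Finset.card_le_card this
    rw [Finset.card_insert_of_notMem (fun h => hv (Finset.mem_insert_of_mem h))] at h8
    simp only [List.length_cons]
    rw [← hds] at h7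
    omega
  · intro d hd
    rw [hperm.mem_iff] at hd
    simp only [List.mem_cons] at hd
    rcases hd with rfl | rfl | hd
    · simp [src, linv, val, L, hvu.symm]
    · have := elt_linv P a
      simp [src, linv, val, L, hvu.symm] at this ⊢
      rw [this, mul_inv_cancel_right]
    · rw [hsrc d hd, hsrc' d hd, hL d hd]
      have n1 := hvs d hd
      have n2 := hvs _ (D.closed d hd)
      simp only [val, n1, n2, if_false]
      exact D.val_step d hd
  · have := D.cp
    rw [h1] at this
    simp only [wordVal_append] at this ⊢
    have e1 : wordVal [(e, true), (e, false)] = (1 : FreeGroup ℕ) := by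
      simp [wordVal]
    rw [e1, mul_one]
    exact this

end

section

variable {S : Type} {P : C6Presentation S}

theorem IsWalk.mem_src {src : ℕ × Bool → ℕ} {l₂ : Word ℕ} {b u : ℕ} (l₁ : Word ℕ)
    (h2 : IsWalk src u l₂ b) :
    u ∈ insert b ((l₁ ++ l₂).map src).toFinset := by
  rcases h2.mem_or with h | h
  · simp [h]
  · refine Finset.mem_insert_of_mem (List.mem_toFinset.2 ?_)
    rw [List.map_append]
    exact List.mem_append_right _ h

theorem Dia.delete {k : ℕ} {l₁ l₂ : Word ℕ} {d : ℕ × Bool} {W : Word S} (D : Dia P k W)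
    (h : D.out = l₁ ++ [d, linv d] ++ l₂) :
    Nonempty (Dia P k (l₁.map D.L ++ l₂.map D.L)) := by
  have hw := D.out_walk
  rw [h, isWalk_append] at hw
  obtain ⟨u', hw, hw3⟩ := hw
  rw [isWalk_append] at hw
  obtain ⟨u, hw1, hw2⟩ := hw
  have hu : D.src d = u := hw2.1
  have hu' : u' = u := by
    have := hw2.2.2
    simp only [IsWalk, linv_linv] at this
    rw [← this, hu]
  subst hu'
  have hperm : (D.out ++ D.faces.flatten).Perm (d :: linv d :: ((l₁ ++ l₂) ++ D.faces.flatten)) := by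
    rw [h]
    simp only [List.append_assoc, List.cons_append, List.nil_append]
    exact (List.perm_middle.trans (List.Perm.cons _ List.perm_middle))
  have hnd := hperm.nodup_iff.1 D.nodup
  have hsub : ∀ e ∈ (l₁ ++ l₂) ++ D.faces.flatten, e ∈ D.out ++ D.faces.flatten := fun e he =>
    hperm.mem_iff.2 (List.mem_cons_of_mem _ (List.mem_cons_of_mem _ he))
  refine ⟨⟨l₁ ++ l₂, D.faces, D.L, D.src, D.base, D.val, D.faces_length, D.L_linv, ?_, ?_,
    List.map_append, D.face_rel, isWalk_append.2 ⟨_, hw1, hw3⟩, D.face_walk, ?_, ?_, ?_⟩⟩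
  · exact (List.nodup_cons.1 (List.nodup_cons.1 hnd).2).2
  · intro e he
    have h1 := hperm.mem_iff.1 (D.closed e (hsub e he))
    simp only [List.mem_cons] at h1
    rcases h1 with h1 | h1 | h1
    · rw [linv_eq_iff] at h1
      exact absurd (h1 ▸ he) (List.nodup_cons.1 (List.nodup_cons.1 hnd).2).1
    · rw [linv_injective h1] at he
      exact absurd (List.mem_cons_of_mem _ he) (List.nodup_cons.1 hnd).1
    · exact h1
  · have h7 := D.euler
    rw [hperm.length_eq, List.toFinset_eq_of_perm _ _ (hperm.map D.src)] at h7
    have hm := hw3.mem_src l₁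
    have : insert D.base ((d :: linv d :: ((l₁ ++ l₂) ++ D.faces.flatten)).map D.src).toFinset ⊆
        insert (D.src (linv d)) (insert D.base (((l₁ ++ l₂) ++ D.faces.flatten).map D.src).toFinset) := by
      intro x hx
      simp only [Finset.mem_insert, List.mem_toFinset, List.map_cons, List.mem_cons,
        List.mem_append, List.map_append] at hx hm ⊢
      rcases hx with hx | hx | hx | hx
      · tauto
      · rw [hx, hu]; tauto
      · tauto
      · tauto
    have h8 := Finset.card_le_card this
    have h9 := Finset.card_insert_le (D.src (linv d))
      (insert D.base (((l₁ ++ l₂) ++ D.faces.flatten).map D.src).toFinset)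
    simp only [List.length_cons] at h7
    omega
  · exact fun e he => D.val_step e (hsub e he)
  · have := D.cp
    rw [h] at this
    have e1 : wordVal [d, linv d] = (1 : FreeGroup ℕ) := by
      rw [wordVal_cons, wordVal_singleton, fltr_linv, mul_inv_cancel]
    simpa only [wordVal_append, e1, mul_one] using this

theorem Dia.glue {k : ℕ} {l₁ l₂ : Word ℕ} {d₁ d₂ : ℕ × Bool} {W : Word S} (D : Dia P k W)
    (h : D.out = l₁ ++ [d₁, d₂] ++ l₂) (hne : d₂ ≠ linv d₁) (hL : D.L d₂ = linv (D.L d₁)) :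
    Nonempty (Dia P k (l₁.map D.L ++ l₂.map D.L)) := by
  have hw := D.out_walk
  rw [h, isWalk_append] at hw
  obtain ⟨u', hw, hw3⟩ := hw
  rw [isWalk_append] at hw
  obtain ⟨u, hw1, hw2⟩ := hw
  have hu : D.src d₁ = u := hw2.1
  have hv : D.src d₂ = D.src (linv d₁) := hw2.2.1
  have hu' : D.src (linv d₂) = u' := hw2.2.2
  set rest := (l₁ ++ l₂) ++ D.faces.flatten with hrest
  have hperm : (D.out ++ D.faces.flatten).Perm (d₁ :: d₂ :: rest) := by
    rw [h]
    simp only [hrest, List.append_assoc, List.cons_append, List.nil_append]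
    exact (List.perm_middle.trans (List.Perm.cons _ List.perm_middle))
  have hnd := hperm.nodup_iff.1 D.nodup
  have hd12 : d₁ ≠ d₂ := fun e => (List.nodup_cons.1 hnd).1 (by simp [e])
  have hd1 : d₁ ∉ rest := fun e => (List.nodup_cons.1 hnd).1 (by simp [e])
  have hd2 : d₂ ∉ rest := (List.nodup_cons.1 (List.nodup_cons.1 hnd).2).1
  have hne' : linv d₂ ≠ d₁ := fun e => hne (by rw [← e, linv_linv])
  have hsub : ∀ e ∈ rest, e ∈ D.out ++ D.faces.flatten := fun e he =>
    hperm.mem_iff.2 (List.mem_cons_of_mem _ (List.mem_cons_of_mem _ he))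
  have hm1 : d₁ ∈ D.out ++ D.faces.flatten := hperm.mem_iff.2 (by simp)
  have hm2 : d₂ ∈ D.out ++ D.faces.flatten := hperm.mem_iff.2 (by simp)
  have hr1 : linv d₁ ∈ rest := by
    have := hperm.mem_iff.1 (D.closed _ hm1)
    simp only [List.mem_cons] at this
    rcases this with e | e | e
    · exact absurd e (linv_ne _)
    · exact absurd e.symm hne
    · exact e
  have hr2 : linv d₂ ∈ rest := by
    have := hperm.mem_iff.1 (D.closed _ hm2)
    simp only [List.mem_cons] at this
    rcases this with e | e | e
    · exact absurd e hne'
    · exact absurd e (linv_ne _)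
    · exact e
  let π : ℕ → ℕ := fun v => if v = u' then u else v
  have pu : π u = u := by simp only [π]; split_ifs <;> rfl
  have pu' : π u' = u := by simp [π]
  let ρ : ℕ × Bool → ℕ × Bool := fun e => if e = linv d₂ then d₁ else if e = d₂ then linv d₁ else e
  have ρ1 : ρ (linv d₂) = d₁ := by simp [ρ]
  have ρ2 : ρ d₂ = linv d₁ := by simp [ρ, (linv_ne d₂).symm]
  have ρ3 : ∀ e, e ≠ linv d₂ → e ≠ d₂ → ρ e = e := fun e h1 h2 => by simp [ρ, h1, h2]
  have ρL : ∀ e, D.L (ρ e) = D.L e := by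
    intro e
    by_cases h1 : e = linv d₂
    · rw [h1, ρ1, D.L_linv, hL, linv_linv]
    by_cases h2 : e = d₂
    · rw [h2, ρ2, D.L_linv, hL]
    rw [ρ3 e h1 h2]
  have ρlinv : ∀ e, ρ (linv e) = linv (ρ e) := by
    intro e
    by_cases h1 : e = linv d₂
    · rw [h1, ρ1, linv_linv, ρ2]
    by_cases h2 : e = d₂
    · rw [h2, ρ1, ρ2, linv_linv]
    rw [ρ3 e h1 h2, ρ3]
    · exact fun h => h2 (linv_injective h)
    · exact fun h => h1 (by rw [← h, linv_linv])
  have ρsrc : ∀ e, (π ∘ D.src) (ρ e) = (π ∘ D.src) e := by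
    intro e
    simp only [Function.comp]
    by_cases h1 : e = linv d₂
    · rw [h1, ρ1, hu, hu', pu, pu']
    by_cases h2 : e = d₂
    · rw [h2, ρ2, hv]
    rw [ρ3 e h1 h2]
  have ρinj : ∀ a ∈ rest, ∀ b ∈ rest, ρ a = ρ b → a = b := by
    intro a ha b hb hab
    have ha2 : a ≠ d₂ := fun e => hd2 (e ▸ ha)
    have hb2 : b ≠ d₂ := fun e => hd2 (e ▸ hb)
    by_cases h1 : a = linv d₂
    · by_cases h3 : b = linv d₂
      · rw [h1, h3]
      · rw [h1, ρ1, ρ3 b h3 hb2] at hab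
        exact absurd (hab ▸ hb) hd1
    · by_cases h3 : b = linv d₂
      · rw [h3, ρ1, ρ3 a h1 ha2] at hab
        exact absurd (hab ▸ ha) hd1
      · rwa [ρ3 a h1 ha2, ρ3 b h3 hb2] at hab
  have hval : D.val u' = D.val u := by
    have e1 := D.val_step d₁ hm1
    have e2 := D.val_step d₂ hm2
    rw [hu', hv, e1, hu, hL, elt_linv, mul_inv_cancel_right] at e2
    exact e2
  have hvπ : ∀ v, D.val (π v) = D.val v := by
    intro v
    simp only [π]
    split_ifs with h
    · rw [h, hval]
    · rfl
  have hflat : (D.faces.map (List.map ρ)).flatten = D.faces.flatten.map ρ := List.map_flatten.symm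
  have hds : (l₁.map ρ ++ l₂.map ρ) ++ (D.faces.map (List.map ρ)).flatten = rest.map ρ := by
    rw [hflat, hrest, List.map_append, List.map_append]
  have hLm : ∀ l : Word ℕ, (l.map ρ).map D.L = l.map D.L := by
    intro l
    rw [List.map_map]
    exact List.map_congr_left fun e _ => ρL e
  let φ : FreeGroup ℕ →* FreeGroup ℕ := FreeGroup.lift fun n => fltr (ρ (n, true))
  have hφ : ∀ e, φ (fltr e) = fltr (ρ e) := by
    rintro ⟨n, b⟩
    cases b
    · have : ((n, false) : ℕ × Bool) = linv (n, true) := rfl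
      rw [this, fltr_linv, map_inv, ρlinv, fltr_linv]
      simp [φ, fltr]
    · simp [φ, fltr]
  have hφw : ∀ l : Word ℕ, φ (wordVal l) = wordVal (l.map ρ) := by
    intro l
    induction l with
    | nil => simp
    | cons a l ih => rw [wordVal_cons, map_mul, ih, hφ, List.map_cons, wordVal_cons]
  refine ⟨⟨l₁.map ρ ++ l₂.map ρ, D.faces.map (List.map ρ), D.L, π ∘ D.src, π D.base, D.val,
    ?_, D.L_linv, ?_, ?_, ?_, ?_, ?_, ?_, ?_, ?_, ?_⟩⟩
  · rw [List.length_map, D.faces_length]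
  · rw [hds]
    exact (List.nodup_map_iff_inj_on (List.nodup_cons.1 (List.nodup_cons.1 hnd).2).2).2
      fun a ha b hb => ρinj a ha b hb
  · rw [hds]
    intro e he
    obtain ⟨x, hx, rfl⟩ := List.mem_map.1 he
    rw [← ρlinv]
    by_cases h1 : x = linv d₂
    · rw [h1, linv_linv, ρ2, ← ρ3 (linv d₁) (fun e => hd12 (linv_injective e)) hne.symm]
      exact List.mem_map_of_mem hr1
    by_cases h2 : x = linv d₁
    · rw [h2, linv_linv, ρ3 d₁ hne'.symm hd12, ← ρ1]
      exact List.mem_map_of_mem hr2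
    refine List.mem_map_of_mem ?_
    have := hperm.mem_iff.1 (D.closed _ (hsub x hx))
    simp only [List.mem_cons] at this
    rcases this with e | e | e
    · exact absurd (linv_eq_iff.1 e) h2
    · exact absurd (linv_eq_iff.1 e) h1
    · exact e
  · rw [List.map_append, hLm, hLm]
  · intro f hf
    obtain ⟨f', hf', rfl⟩ := List.mem_map.1 hf
    rw [hLm]
    exact D.face_rel f' hf'
  · have e1 := (hw1.comp π).map ρsrc ρlinv
    have e2 := (hw3.comp π).map ρsrc ρlinv
    rw [pu] at e1
    rw [pu'] at e2
    exact isWalk_append.2 ⟨_, e1, e2⟩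
  · intro f hf
    obtain ⟨f', hf', rfl⟩ := List.mem_map.1 hf
    obtain ⟨v, hv⟩ := D.face_walk f' hf'
    exact ⟨π v, (hv.comp π).map ρsrc ρlinv⟩
  · have h7 := D.euler
    rw [hperm.length_eq, List.toFinset_eq_of_perm _ _ (hperm.map D.src)] at h7
    rw [hds, List.map_map, show (π ∘ D.src) ∘ ρ = π ∘ D.src from funext ρsrc, toFinset_map_comp,
      List.length_map]
    have h8 := card_image_merge u u' (insert D.base ((d₁ :: d₂ :: rest).map D.src).toFinset)
    change _ ≤ (Finset.image π _).card + 1 at h8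
    have : (insert D.base ((d₁ :: d₂ :: rest).map D.src).toFinset).image π ⊆
        (insert D.base (rest.map D.src).toFinset).image π := by
      intro y hy
      obtain ⟨x, hx, rfl⟩ := Finset.mem_image.1 hy
      simp only [Finset.mem_insert, List.map_cons, List.mem_toFinset, List.mem_cons] at hx
      rcases hx with hx | hx | hx | hx
      · exact Finset.mem_image_of_mem _ (by simp [hx])
      · rw [hx, hu, pu, ← pu', ← hu']
        exact Finset.mem_image_of_mem _ (Finset.mem_insert_of_mem
          (List.mem_toFinset.2 (List.mem_map_of_mem hr2)))
      · rw [hx, hv]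
        exact Finset.mem_image_of_mem _ (Finset.mem_insert_of_mem
          (List.mem_toFinset.2 (List.mem_map_of_mem hr1)))
      · exact Finset.mem_image_of_mem _ (Finset.mem_insert_of_mem (List.mem_toFinset.2 hx))
    have h9 := Finset.card_le_card this
    simp only [List.length_cons] at h7
    omega
  · intro e he
    rw [hds] at he
    obtain ⟨x, hx, rfl⟩ := List.mem_map.1 he
    rw [← ρlinv, ρsrc, ρsrc, ρL]
    simp only [Function.comp, hvπ]
    exact D.val_step x (hsub x hx)
  · have := D.cp.map φ
    rw [h] at this
    simp only [wordVal_append, map_mul, hφw] at this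
    have e1 : wordVal (List.map ρ [d₁, d₂]) = (1 : FreeGroup ℕ) := by
      simp only [List.map_cons, List.map_nil]
      rw [ρ3 d₁ hne'.symm hd12, ρ2, wordVal_cons, wordVal_singleton, fltr_linv, mul_inv_cancel]
    rw [e1, mul_one, List.map_map] at this
    rw [wordVal_append, List.map_map]
    convert this using 2
    exact funext fun f => (hφw f).symm

end

section

variable {S : Type} {P : C6Presentation S}

theorem Dia.fold {k : ℕ} {A B : Word S} {a : S × Bool} (D : Dia P k (A ++ [a, linv a] ++ B)) :
    Nonempty (Dia P k (A ++ B)) := by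
  obtain ⟨l₁₂, l₂, h1, h2, h3⟩ := List.map_eq_append_iff.1 D.out_label
  obtain ⟨l₁, m, h4, h5, h6⟩ := List.map_eq_append_iff.1 h2
  subst h4
  obtain ⟨d₁, m', rfl, h7, h8⟩ := List.map_eq_cons_iff.1 h6
  obtain ⟨d₂, m'', rfl, h9, h10⟩ := List.map_eq_cons_iff.1 h8
  rw [List.map_eq_nil_iff] at h10
  subst h10
  have key : Nonempty (Dia P k (l₁.map D.L ++ l₂.map D.L)) := by
    by_cases hd : d₂ = linv d₁
    · subst hd
      exact D.delete h1
    · exact D.glue h1 hd (by rw [h9, h7])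
  rwa [h5, h3] at key

theorem Dia.foldWord {k : ℕ} {A : Word S} (u : Word S) (D : Dia P k (A ++ u ++ wordInv u)) :
    Nonempty (Dia P k A) := by
  induction u using List.reverseRecOn with
  | nil =>
    rw [wordInv_nil, List.append_nil, List.append_nil] at D
    exact ⟨D⟩
  | append_singleton u a ih =>
    have e : A ++ (u ++ [a]) ++ wordInv (u ++ [a]) = (A ++ u) ++ [a, linv a] ++ wordInv u := by
      rw [wordInv_append]
      simp [wordInv, linv]
    rw [e] at D
    obtain ⟨D'⟩ := D.fold
    exact ih D'

theorem exists_dia (s : S) {n : ℕ} {W : Word S} (h : NProd P n (wordVal W)) :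
    Nonempty (Dia P n W) := by
  induction n generalizing W with
  | zero =>
    obtain ⟨fs, h1, -, h2⟩ := h
    rw [List.length_eq_zero_iff] at h1
    subst h1
    have h3 : FreeGroup.Red W [] := by
      have : FreeGroup.mk W = FreeGroup.mk [] := by
        rw [← wordVal_eq_mk]
        exact h2
      obtain ⟨c, h4, h5⟩ := FreeGroup.Red.exact.1 this
      rw [FreeGroup.Red.nil_iff] at h5
      exact h5 ▸ h4
    clear h2
    induction h3 using Relation.ReflTransGen.head_induction_on with
    | refl => exact Dia.empty s
    | head hab _ ih =>
      obtain ⟨D⟩ := ih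
      cases hab with
      | @not L₁ L₂ x b =>
        obtain ⟨D'⟩ := D.insertPair (x, b)
        have e : L₁ ++ (x, b) :: (x, !b) :: L₂ = L₁ ++ [(x, b), linv (x, b)] ++ L₂ := by
          simp [linv]
        rw [e]
        exact ⟨D'⟩
  | succ n ih =>
    obtain ⟨fs, h1, h2, h3⟩ := h
    cases fs with
    | nil => simp at h1
    | cons f fs =>
      obtain ⟨u, hu⟩ := h3
      obtain ⟨r, hr, rfl⟩ := h2 f List.mem_cons_self
      obtain ⟨u, rfl⟩ := exists_wordVal u
      obtain ⟨D⟩ := @ih ((W ++ u) ++ r ++ wordInv u) ⟨fs, by simpa using h1,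
        fun f hf => h2 f (List.mem_cons_of_mem _ hf), by
          simpa only [wordVal_append, wordVal_wordInv] using hu⟩
      obtain ⟨D'⟩ := D.cut hr
      exact D'.foldWord u

theorem eq_of_mem_of_nodup_flatten {α : Type*} {ls : List (List α)} (h : ls.flatten.Nodup)
    {f g : List α} (hf : f ∈ ls) (hg : g ∈ ls) {x : α} (hxf : x ∈ f) (hxg : x ∈ g) : f = g := by
  induction ls with
  | nil => simp at hf
  | cons a ls ih =>
    rw [List.flatten_cons, List.nodup_append] at h
    rcases List.mem_cons.1 hf with rfl | hf' <;> rcases List.mem_cons.1 hg with rfl | hg'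
    · rfl
    · exact absurd rfl (h.2.2 x hxf x (List.mem_flatten.2 ⟨_, hg', hxg⟩))
    · exact absurd rfl (h.2.2 x hxg x (List.mem_flatten.2 ⟨_, hf', hxf⟩))
    · exact ih h.2.1 hf' hg'

/-- No representation of `wordVal W` as a product of conjugates of relators is shorter than `n`. -/
def MinArea (P : C6Presentation S) (n : ℕ) (W : Word S) : Prop :=
  ∀ m, NProd P m (wordVal W) → n ≤ m

theorem Dia.ne_one {k : ℕ} {W : Word S} (D : Dia P k W) (hmin : MinArea P k W)
    (φ : FreeGroup ℕ →* FreeGroup S) (hout : φ (wordVal D.out) = wordVal W)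
    (hf : ∀ f ∈ D.faces, φ (wordVal f) = 1 ∨ φ (wordVal f) ∈ wordVal '' P.rels) :
    ∀ f ∈ D.faces, φ (wordVal f) ≠ 1 := by
  intro f hfm h1
  have h2 := D.cp.map φ
  rw [hout, List.map_map] at h2
  obtain ⟨gs, h3, h4, h5, h6⟩ := h2.filter (· ∈ wordVal '' P.rels) (by
    intro y hy
    obtain ⟨f, hf', rfl⟩ := List.mem_map.1 hy
    exact hf f hf')
  have h7 := h6 (List.mem_map.2 ⟨f, hfm, h1⟩)
  have h8 := hmin _ ⟨gs, rfl, h4, h3⟩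
  rw [List.length_map, D.faces_length] at h7
  omega

/-- The homomorphism of free groups induced by a labelling of edges. -/
theorem hom_wordVal {L : ℕ × Bool → S × Bool} (hL : ∀ d, L (linv d) = linv (L d)) {v : ℕ → FreeGroup S}
    {l : Word ℕ} (hl : ∀ d ∈ l, v d.1 = fltr (L (d.1, true))) :
    FreeGroup.lift v (wordVal l) = wordVal (l.map L) := by
  induction l with
  | nil => simp
  | cons a l ih =>
    rw [wordVal_cons, map_mul, ih fun d hd => hl d (List.mem_cons_of_mem _ hd), List.map_cons,
      wordVal_cons]
    congr 1
    have h1 := hl a List.mem_cons_self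
    rcases a with ⟨n, b⟩
    cases b
    · have : ((n, false) : ℕ × Bool) = linv (n, true) := rfl
      rw [this, fltr_linv, map_inv, hL, fltr_linv, ← h1]
      simp [fltr]
    · rw [← h1]
      simp [fltr]

theorem Dia.faces_ne_nil {k : ℕ} {W : Word S} (D : Dia P k W) (hmin : MinArea P k W) :
    ∀ f ∈ D.faces, f ≠ [] := by
  rintro f hf rfl
  refine D.ne_one hmin (FreeGroup.lift fun n => fltr (D.L (n, true))) ?_ ?_ [] hf (by simp)
  · rw [hom_wordVal D.L_linv (fun _ _ => rfl), D.out_label]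
  · intro f hf
    rw [hom_wordVal D.L_linv (fun _ _ => rfl)]
    exact Or.inr ⟨_, D.face_rel f hf, rfl⟩

theorem map_wordVal_isRotated {F : Type*} [Group F] {φ : FreeGroup ℕ →* F} {f g : Word ℕ}
    (h : f ~r g) (hg : φ (wordVal g) = 1) : φ (wordVal f) = 1 := by
  obtain ⟨n, rfl⟩ := h
  rw [List.rotate_eq_drop_append_take_mod, wordVal_append, map_mul] at hg
  rw [← List.take_append_drop (n % f.length) f, wordVal_append, map_mul]
  exact mul_eq_one_comm.1 hg

theorem Dia.reduced {k : ℕ} {W : Word S} (D : Dia P k W) (hmin : MinArea P k W)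
    {f g a b : Word ℕ} {d : ℕ × Bool} (hf : f ∈ D.faces) (hg : g ∈ D.faces) (hfg : f ≠ g)
    (hfd : f ~r d :: a) (hgd : g ~r linv d :: b) : b.map D.L ≠ wordInv (a.map D.L) := by
  intro hab
  have hnd := D.nodup
  rw [List.nodup_append] at hnd
  obtain ⟨-, hnf, hdis⟩ := hnd
  have hnodf : ∀ f ∈ D.faces, f.Nodup := (List.nodup_flatten.1 hnf).1
  have hdf : d ∈ f := hfd.mem_iff.2 List.mem_cons_self
  have hdg : linv d ∈ g := hgd.mem_iff.2 List.mem_cons_self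
  have key : ∀ x : ℕ × Bool, x.1 = d.1 → x = d ∨ x = linv d := by
    rintro ⟨x, c⟩ h
    rcases d with ⟨y, c'⟩
    simp only at h
    subst h
    cases c <;> cases c' <;> simp [linv]
  let t : FreeGroup S := (wordVal (a.map D.L))⁻¹
  let v : ℕ → FreeGroup S := fun n => if n = d.1 then (if d.2 then t else t⁻¹) else
    fltr (D.L (n, true))
  have hv : ∀ l : Word ℕ, d ∉ l → linv d ∉ l →
      FreeGroup.lift v (wordVal l) = wordVal (l.map D.L) := by
    intro l h1 h2
    refine hom_wordVal D.L_linv fun x hx => if_neg fun h => ?_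
    rcases key x h with rfl | rfl
    exacts [h1 hx, h2 hx]
  have hvd : FreeGroup.lift v (fltr d) = t := by
    rcases d with ⟨y, c⟩
    cases c <;> simp [v, fltr]
  have da1 : d ∉ a := (List.nodup_cons.1 (hfd.nodup_iff.1 (hnodf f hf))).1
  have da2 : linv d ∉ a := fun h => hfg (eq_of_mem_of_nodup_flatten hnf hf hg
    (hfd.mem_iff.2 (List.mem_cons_of_mem _ h)) hdg)
  have db1 : d ∉ b := fun h => hfg (eq_of_mem_of_nodup_flatten hnf hf hg hdf
    (hgd.mem_iff.2 (List.mem_cons_of_mem _ h)))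
  have db2 : linv d ∉ b := (List.nodup_cons.1 (hgd.nodup_iff.1 (hnodf g hg))).1
  have f1 : FreeGroup.lift v (wordVal f) = 1 := by
    refine map_wordVal_isRotated hfd ?_
    rw [wordVal_cons, map_mul, hvd, hv a da1 da2]
    simp [t]
  have g1 : FreeGroup.lift v (wordVal g) = 1 := by
    refine map_wordVal_isRotated hgd ?_
    rw [wordVal_cons, map_mul, fltr_linv, map_inv, hvd, hv b db1 db2, hab, wordVal_wordInv]
    simp [t]
  have o1 : d ∉ D.out := fun h => hdis _ h _ (List.mem_flatten.2 ⟨f, hf, hdf⟩) rfl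
  have o2 : linv d ∉ D.out := fun h => hdis _ h _ (List.mem_flatten.2 ⟨g, hg, hdg⟩) rfl
  refine D.ne_one hmin (FreeGroup.lift v) ?_ ?_ f hf f1
  · rw [hv _ o1 o2, D.out_label]
  · intro f' hf'
    by_cases h1 : d ∈ f'
    · rw [← eq_of_mem_of_nodup_flatten hnf hf hf' hdf h1]
      exact Or.inl f1
    by_cases h2 : linv d ∈ f'
    · rw [← eq_of_mem_of_nodup_flatten hnf hg hf' hdg h2]
      exact Or.inl g1
    · rw [hv _ h1 h2]
      exact Or.inr ⟨_, D.face_rel f' hf', rfl⟩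

theorem exists_minimal_dia (s : S) {W : Word S} (h : P.elt W = 1) :
    ∃ k, Nonempty (Dia P k W) ∧ MinArea P k W := by
  classical
  have := exists_nProd P ((elt_eq_one_iff P W).1 h)
  exact ⟨Nat.find this, exists_dia s (Nat.find_spec this), fun m hm => Nat.find_le hm⟩

end

/-- The word of length `m` read along the orbit of `d` under `φ`. -/
def rd {S D : Type} (φ : Equiv.Perm D) (lab : D → S × Bool) (d : D) (m : ℕ) : Word S :=
  (List.range m).map fun t => lab ((φ ^ t) d)

/-- A reduced disc diagram, encoded by permutations of its set `D` of darts: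
`φ` moves to the next dart along a face, `α` reverses a dart; the outer face is `none`. -/
structure Disc {S : Type} (P : C6Presentation S) (W : Word S) where
  D : Type
  [fD : Fintype D]
  [dD : DecidableEq D]
  F : Type
  [fF : Fintype F]
  [dF : DecidableEq F]
  φ : Equiv.Perm D
  α : D → D
  face : D → Option F
  lab : D → S × Bool
  pos : D → P.Grp
  src : D → ℕ
  idx : D → ℕ
  N : F → ℕ
  α_α : ∀ d, α (α d) = d
  lab_α : ∀ d, lab (α d) = linv (lab d)
  pos_φ : ∀ d, pos (φ d) = pos d * P.elt [lab d]
  src_φ : ∀ d, src (φ (α d)) = src d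
  pos_src : ∀ d e, src d = src e → pos d = pos e
  face_φ : ∀ d, face (φ d) = face d
  exists_pow : ∀ d e, face d = face e → ∃ k : ℕ, (φ ^ k) d = e
  exists_face : ∀ f, ∃ d, face d = some f
  card_face : ∀ f, (Finset.univ.filter fun d => face d = some f).card = N f
  idx_lt : ∀ d, face d = none → idx d < W.length
  idx_φ : ∀ d, face d = none → idx (φ d) = (idx d + 1) % W.length
  pos_idx : ∀ d, face d = none → pos d = P.elt (W.take (idx d))
  exists_idx : ∀ j < W.length, ∃ d, face d = none ∧ idx d = j
  idx_inj : ∀ d e, face d = none → face e = none → idx d = idx e → d = e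
  rel : ∀ d f, face d = some f → rd φ lab d (N f) ∈ P.rels
  reduced : ∀ d f g, face d = some f → face (α d) = some g → f ≠ g →
    rd φ lab (φ (α d)) (N g) ≠ wordInv (rd φ lab d (N f))
  euler : Fintype.card D + 2 ≤ 2 * (Finset.univ.image src).card + 2 * Fintype.card F

attribute [instance] Disc.fD Disc.dD Disc.fF Disc.dF

section Construction

theorem prod_formPerm_apply {α : Type*} [DecidableEq α] {ls : List (List α)} (h : ls.flatten.Nodup)
    {c : List α} (hc : c ∈ ls) {x : α} (hx : x ∈ c) :
    (ls.map List.formPerm).prod x = c.formPerm x := by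
  induction ls with
  | nil => simp at hc
  | cons a ls ih =>
    rw [List.flatten_cons, List.nodup_append] at h
    simp only [List.map_cons, List.prod_cons, Equiv.Perm.mul_apply]
    have key : ∀ (ms : List (List α)) (y : α), y ∉ ms.flatten → (ms.map List.formPerm).prod y = y := by
      intro ms y hy
      induction ms with
      | nil => simp
      | cons b ms ihm =>
        simp only [List.flatten_cons, List.mem_append, not_or] at hy
        simp [ihm hy.2, List.formPerm_apply_of_notMem hy.1]
    rcases List.mem_cons.1 hc with rfl | hc'
    · rw [key]
      exact fun hh => h.2.2 x hx x hh rfl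
    · rw [ih h.2.1 hc', List.formPerm_apply_of_notMem]
      exact fun hh => h.2.2 _ hh _
        (List.mem_flatten.2 ⟨c, hc', List.formPerm_apply_mem_of_mem hx⟩) rfl

theorem prod_formPerm_pow {α : Type*} [DecidableEq α] {ls : List (List α)} (h : ls.flatten.Nodup)
    {q : List α} (hc : q ∈ ls) (n i : ℕ) (hi : i < q.length) :
    ((ls.map List.formPerm).prod ^ n) (q[i]) =
      (q[(i + n) % q.length]'(Nat.mod_lt _ (by omega))) := by
  have hcn : q.Nodup := (List.nodup_flatten.1 h).1 q hc
  induction n with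
  | zero => simp [Nat.mod_eq_of_lt hi]
  | succ n ih =>
    rw [pow_succ', Equiv.Perm.mul_apply, ih, prod_formPerm_apply h hc (List.getElem_mem _),
      List.formPerm_apply_getElem _ hcn]
    simp [← Nat.add_assoc]

theorem IsWalk.src_getElem {src : ℕ × Bool → ℕ} {l : Word ℕ} {u v : ℕ} (h : IsWalk src u l v)
    (i : ℕ) (hi : i < l.length) : src l[i] = if i = 0 then u else src (linv (l[i - 1]'(by omega))) := by
  induction l generalizing u i with
  | nil => simp at hi
  | cons d l ih =>
    cases i with
    | zero => simpa using h.1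
    | succ i =>
      have := ih h.2 i (by simpa using hi)
      rw [List.getElem_cons_succ, this]
      rcases i with - | i
      · simp
      · simp

theorem IsWalk.src_last {src : ℕ × Bool → ℕ} {l : Word ℕ} {u v : ℕ} (h : IsWalk src u l v)
    (hl : 0 < l.length) : src (linv (l[l.length - 1])) = v := by
  induction l generalizing u with
  | nil => simp at hl
  | cons d l ih =>
    rcases Nat.eq_zero_or_pos l.length with h0 | h0
    · rw [List.length_eq_zero_iff] at h0
      subst h0
      exact h.2
    · have := ih h.2 h0
      rw [← this]
      congr 2
      simp only [List.length_cons, Nat.add_sub_cancel]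
      rw [List.getElem_cons, dif_neg (by omega)]

theorem IsWalk.src_next {src : ℕ × Bool → ℕ} {l : Word ℕ} {u : ℕ} (h : IsWalk src u l u)
    (i : ℕ) (hi : i < l.length) :
    src (l[(i + 1) % l.length]'(Nat.mod_lt _ (by omega))) = src (linv l[i]) := by
  rw [h.src_getElem]
  by_cases h1 : i + 1 = l.length
  · have h2 : (i + 1) % l.length = 0 := by rw [h1, Nat.mod_self]
    rw [if_pos h2, ← h.src_last (by omega)]
    simp only [← h1, Nat.add_sub_cancel]
  · have h2 : (i + 1) % l.length = i + 1 := Nat.mod_eq_of_lt (by omega)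
    simp only [h2]
    simp

theorem IsWalk.take {src : ℕ × Bool → ℕ} {l : Word ℕ} {u v : ℕ} (h : IsWalk src u l v)
    (i : ℕ) (hi : i < l.length) : IsWalk src u (l.take i) (src l[i]) := by
  rw [← List.take_append_drop i l, isWalk_append] at h
  obtain ⟨w, h1, h2⟩ := h
  rw [List.drop_eq_getElem_cons hi] at h2
  rw [h2.1]
  exact h1

theorem nodup_of_nodup_flatten {α : Type*} {ls : List (List α)} (h : ls.flatten.Nodup)
    (hne : ∀ l ∈ ls, l ≠ []) : ls.Nodup := by
  induction ls with
  | nil => simp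
  | cons a ls ih =>
    rw [List.flatten_cons, List.nodup_append] at h
    refine List.nodup_cons.2 ⟨fun ha => ?_, ih h.2.1 fun l hl => hne l (List.mem_cons_of_mem _ hl)⟩
    obtain ⟨x, hx⟩ := List.exists_mem_of_ne_nil a (hne a List.mem_cons_self)
    exact h.2.2 x hx x (List.mem_flatten.2 ⟨a, ha, hx⟩) rfl

theorem rd_eq_rotate {S : Type} {D : Type} {φ : Equiv.Perm D} {lab : D → S × Bool} {X : Type}
    {L : X → S × Bool} {ι : D → X} (hl : ∀ d, lab d = L (ι d)) {Φ : Equiv.Perm X}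
    (hφ : ∀ (n : ℕ) d, ι ((φ ^ n) d) = (Φ ^ n) (ι d)) {f : List X} {i : ℕ} (hi : i < f.length) {d : D}
    (hd : ι d = f[i]) (hΦ : ∀ n, (Φ ^ n) f[i] = f[(i + n) % f.length]'(Nat.mod_lt _ (by omega))) :
    rd φ lab d f.length = (f.rotate i).map L := by
  apply List.ext_getElem
  · simp [rd]
  · intro t h1 h2
    simp only [rd, List.getElem_map, List.getElem_range, hl, hφ, hd, hΦ, List.getElem_rotate,
      Nat.add_comm]

theorem rotate_eq_cons {α : Type*} {f : List α} {i : ℕ} (hi : i < f.length) :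
    f.rotate i = f[i] :: (f.drop (i + 1) ++ f.take i) := by
  rw [List.rotate_eq_drop_append_take hi.le, List.drop_eq_getElem_cons hi, List.cons_append]

end Construction

section

variable {S : Type} {P : C6Presentation S}

theorem Dia.exists_disc {k : ℕ} {W : Word S} (Δ : Dia P k W) (hmin : MinArea P k W)
    (hW : 0 < W.length) : Nonempty (Disc P W) := by
  classical
  set ds := Δ.out ++ Δ.faces.flatten with hds
  have hfl : (Δ.out :: Δ.faces).flatten = ds := List.flatten_cons
  have hnd : (Δ.out :: Δ.faces).flatten.Nodup := hfl ▸ Δ.nodup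
  have hnd' := Δ.nodup
  rw [List.nodup_append] at hnd'
  have hne := Δ.faces_ne_nil hmin
  have hfnd := nodup_of_nodup_flatten hnd'.2.1 hne
  set Φ := ((Δ.out :: Δ.faces).map List.formPerm).prod with hΦ
  have hlen : Δ.out.length = W.length := by
    simpa using congrArg List.length Δ.out_label
  have hmem : ∀ x ∈ ds, ∃ q ∈ Δ.out :: Δ.faces, ∃ (i : ℕ) (hi : i < q.length), x = q[i] := by
    intro x hx
    rw [← hfl] at hx
    obtain ⟨q, hc, hxc⟩ := List.mem_flatten.1 hx
    obtain ⟨i, hi, rfl⟩ := List.mem_iff_getElem.1 hxc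
    exact ⟨q, hc, i, hi, rfl⟩
  have hmem' : ∀ q ∈ Δ.out :: Δ.faces, ∀ x ∈ q, x ∈ ds := by
    intro q hc x hx
    rw [← hfl]
    exact List.mem_flatten.2 ⟨q, hc, hx⟩
  have hΦn : ∀ q ∈ Δ.out :: Δ.faces, ∀ (n i : ℕ) (hi : i < q.length),
      (Φ ^ n) (q[i]) = (q[(i + n) % q.length]'(Nat.mod_lt _ (by omega))) :=
    fun q hq n i hi => prod_formPerm_pow hnd hq n i hi
  have hΦ1 : ∀ q ∈ Δ.out :: Δ.faces, ∀ (i : ℕ) (hi : i < q.length),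
      Φ (q[i]) = (q[(i + 1) % q.length]'(Nat.mod_lt _ (by omega))) :=
    fun q hq i hi => by simpa using hΦn q hq 1 i hi
  have hΦc : ∀ c ∈ Δ.out :: Δ.faces, ∀ x ∈ c, Φ x ∈ c := by
    intro q hq x hx
    obtain ⟨i, hi, rfl⟩ := List.mem_iff_getElem.1 hx
    rw [hΦ1 q hq i hi]
    exact List.getElem_mem _
  have hΦds : ∀ x, x ∈ ds → Φ x ∈ ds := by
    intro x hx
    obtain ⟨q, hq, i, hi, rfl⟩ := hmem x hx
    exact hmem' q hq _ (hΦc q hq _ (List.getElem_mem _))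
  have hsrcΦ : ∀ x ∈ ds, Δ.src (Φ x) = Δ.src (linv x) := by
    intro x hx
    obtain ⟨q, hq, i, hi, rfl⟩ := hmem x hx
    rw [hΦ1 q hq i hi]
    rcases List.mem_cons.1 hq with rfl | hq'
    · exact Δ.out_walk.src_next i hi
    · obtain ⟨u, hu⟩ := Δ.face_walk q hq'
      exact hu.src_next i hi
  let D := {x // x ∈ ds}
  let F := {f // f ∈ Δ.faces}
  let φ : Equiv.Perm D := Φ.subtypePermOfFintype hΦds
  have hφ : ∀ (n : ℕ) (d : D), ((φ ^ n) d).1 = (Φ ^ n) d.1 := by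
    intro n d
    induction n with
    | zero => rfl
    | succ n ih =>
      rw [pow_succ', pow_succ', Equiv.Perm.mul_apply, Equiv.Perm.mul_apply, ← ih]
      rfl
  have hφ1 : ∀ d : D, (φ d).1 = Φ d.1 := fun d => rfl
  have hface : ∀ d : D, ∃ o : Option F, (∀ f, o = some f ↔ d.1 ∈ f.1) ∧ (o = none ↔ d.1 ∈ Δ.out) := by
    intro d
    by_cases h : d.1 ∈ Δ.out
    · refine ⟨none, fun f => ⟨fun h => by simp at h, fun hf => ?_⟩, by simp [h]⟩
      exact absurd rfl (hnd'.2.2 _ h _ (List.mem_flatten.2 ⟨f.1, f.2, hf⟩))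
    · obtain ⟨f, hf, hdf⟩ := List.mem_flatten.1 ((List.mem_append.1 d.2).resolve_left h)
      refine ⟨some ⟨f, hf⟩, fun g => ⟨?_, fun hg => ?_⟩, by simp [h]⟩
      · intro h
        rw [Option.some.injEq] at h
        rw [← h]
        exact hdf
      · rw [Option.some.injEq]
        exact Subtype.ext (eq_of_mem_of_nodup_flatten hnd'.2.1 hf g.2 hdf hg)
  choose face hfaceS hfaceN using hface
  have hcell : ∀ d : D, ∃ q ∈ Δ.out :: Δ.faces, d.1 ∈ q ∧ ∀ e : D, face e = face d ↔ e.1 ∈ q := by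
    intro d
    rcases h : face d with - | f
    · exact ⟨_, List.mem_cons_self, (hfaceN d).1 h, fun e => hfaceN e⟩
    · exact ⟨f.1, List.mem_cons_of_mem _ f.2, (hfaceS d f).1 h, fun e => hfaceS e f⟩
  have hrot : ∀ (d : D) (q : Word ℕ), q ∈ Δ.out :: Δ.faces → ∀ i (hi : i < q.length), d.1 = q[i] →
      rd φ (fun d => Δ.L d.1) d q.length = (q.rotate i).map Δ.L :=
    fun d q hq i hi hd => rd_eq_rotate (ι := Subtype.val) (Φ := Φ) (fun _ => rfl) hφ hi hd
      fun n => hΦn q hq n i hi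
  have hval0 : ∀ i (hi : i < Δ.out.length), (Δ.val Δ.base)⁻¹ * Δ.val (Δ.src Δ.out[i]) =
      P.elt (W.take i) := by
    intro i hi
    have h1 := Δ.val_walk (l := Δ.out.take i)
      (fun d hd => hmem' Δ.out List.mem_cons_self d (List.mem_of_mem_take hd)) (Δ.out_walk.take i hi)
    have h2 : W.take i = (Δ.out.take i).map Δ.L := by
      simpa [List.map_take] using (congrArg (List.take i) Δ.out_label).symm
    rw [h1, inv_mul_cancel_left, h2]
  have honodup : Δ.out.Nodup := hnd'.1
  refine ⟨{
    D := D, F := F, φ := φ, α := fun d => ⟨linv d.1, Δ.closed _ d.2⟩, face := face,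
    lab := fun d => Δ.L d.1, pos := fun d => (Δ.val Δ.base)⁻¹ * Δ.val (Δ.src d.1),
    src := fun d => Δ.src d.1, idx := fun d => Δ.out.idxOf d.1, N := fun f => f.1.length,
    α_α := fun d => Subtype.ext (linv_linv _), lab_α := fun d => Δ.L_linv _,
    pos_φ := ?pos_φ, src_φ := ?src_φ, pos_src := ?pos_src, face_φ := ?face_φ,
    exists_pow := ?exists_pow,
    exists_face := ?exists_face, card_face := ?card_face, idx_lt := ?idx_lt, idx_φ := ?idx_φ,
    pos_idx := ?pos_idx, exists_idx := ?exists_idx, idx_inj := ?idx_inj, rel := ?rel,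
    reduced := ?reduced, euler := ?euler }⟩
  case pos_φ =>
    intro d
    rw [hφ1, hsrcΦ d.1 d.2, Δ.val_step d.1 d.2, mul_assoc]
  case src_φ =>
    intro d
    rw [hφ1, hsrcΦ _ (Δ.closed _ d.2), linv_linv]
  case pos_src =>
    intro d e h
    rw [show Δ.src d.1 = Δ.src e.1 from h]
  case face_φ =>
    intro d
    obtain ⟨q, hq, hd, h⟩ := hcell d
    exact (h _).2 (hΦc q hq _ hd)
  case exists_pow =>
    intro d e hde
    obtain ⟨q, hq, hd, h⟩ := hcell d
    have he := (h e).1 hde.symm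
    obtain ⟨i, hi, hi'⟩ := List.mem_iff_getElem.1 hd
    obtain ⟨j, hj, hj'⟩ := List.mem_iff_getElem.1 he
    refine ⟨j + (q.length - i), Subtype.ext ?_⟩
    rw [hφ, ← hi', hΦn q hq _ i hi, ← hj']
    congr 1
    rw [show i + (j + (q.length - i)) = j + q.length by omega, Nat.add_mod_right, Nat.mod_eq_of_lt hj]
  case exists_face =>
    intro f
    obtain ⟨x, hx⟩ := List.exists_mem_of_ne_nil f.1 (hne f.1 f.2)
    exact ⟨⟨x, hmem' _ (List.mem_cons_of_mem _ f.2) x hx⟩, (hfaceS _ f).2 hx⟩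
  case card_face =>
    intro f
    have hfn : f.1.Nodup := (List.nodup_flatten.1 hnd'.2.1).1 f.1 f.2
    rw [← List.toFinset_card_of_nodup hfn, ← Finset.card_image_of_injective _ Subtype.val_injective]
    congr 1
    ext x
    simp only [Finset.mem_image, Finset.mem_filter, Finset.mem_univ, true_and, hfaceS,
      List.mem_toFinset]
    constructor
    · rintro ⟨d, hd, rfl⟩
      exact hd
    · intro hx
      exact ⟨⟨x, hmem' _ (List.mem_cons_of_mem _ f.2) x hx⟩, hx, rfl⟩
  case idx_lt =>
    intro d hd
    rw [← hlen]
    exact List.idxOf_lt_length_of_mem ((hfaceN d).1 hd)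
  case idx_φ =>
    intro d hd
    have hd' := (hfaceN d).1 hd
    have hi := List.idxOf_lt_length_of_mem hd'
    have h1 : d.1 = Δ.out[Δ.out.idxOf d.1] := (List.getElem_idxOf hi).symm
    rw [hφ1]
    conv_lhs => rw [h1]
    rw [hΦ1 _ List.mem_cons_self, ← hlen]
    exact honodup.idxOf_getElem _ _
  case pos_idx =>
    intro d hd
    have hd' := (hfaceN d).1 hd
    have hi := List.idxOf_lt_length_of_mem hd'
    have h1 : d.1 = Δ.out[Δ.out.idxOf d.1] := (List.getElem_idxOf hi).symm
    rw [← hval0 _ hi, ← h1]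
  case exists_idx =>
    intro j hj
    rw [← hlen] at hj
    exact ⟨⟨Δ.out[j], hmem' _ List.mem_cons_self _ (List.getElem_mem _)⟩,
      (hfaceN _).2 (List.getElem_mem _), honodup.idxOf_getElem _ _⟩
  case idx_inj =>
    intro d e hd he h
    exact Subtype.ext ((List.idxOf_inj ((hfaceN d).1 hd)).1 h)
  case rel =>
    intro d f hd
    obtain ⟨i, hi, hi'⟩ := List.mem_iff_getElem.1 ((hfaceS d f).1 hd)
    rw [hrot d f.1 (List.mem_cons_of_mem _ f.2) i hi hi'.symm, List.map_rotate]
    exact P.rotate_mem _ (Δ.face_rel _ f.2) i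
  case reduced =>
    intro d f g hd hg hfg
    obtain ⟨i, hi, hi'⟩ := List.mem_iff_getElem.1 ((hfaceS d f).1 hd)
    obtain ⟨j, hj, hj'⟩ := List.mem_iff_getElem.1 ((hfaceS _ g).1 hg)
    have hj1 : (j + 1) % g.1.length < g.1.length := Nat.mod_lt _ (by omega)
    rw [hrot d f.1 (List.mem_cons_of_mem _ f.2) i hi hi'.symm,
      hrot _ g.1 (List.mem_cons_of_mem _ g.2) _ hj1 (by
        rw [hφ1, ← hΦ1 _ (List.mem_cons_of_mem _ g.2) j hj]; rw [hj'])]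
    intro H
    rw [List.rotate_mod, ← List.rotate_rotate, rotate_eq_cons hj, List.rotate_cons_succ,
      List.rotate_zero, rotate_eq_cons hi, List.map_cons, wordInv_cons, List.map_append] at H
    have H2 := List.append_inj_left' H (by simp)
    refine Δ.reduced hmin f.2 g.2 (fun h => hfg (Subtype.ext h)) (d := d.1)
      (a := f.1.drop (i + 1) ++ f.1.take i) (b := g.1.drop (j + 1) ++ g.1.take j) ?_ ?_ H2
    · rw [← hi']
      exact ⟨i, rotate_eq_cons hi⟩
    · rw [show linv d.1 = g.1[j] from hj'.symm]
      exact ⟨j, rotate_eq_cons hj⟩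
  case euler =>
    have h1 := Δ.euler
    have h2 : Fintype.card D = ds.length := by
      rw [Fintype.card_of_subtype ds.toFinset (fun x => List.mem_toFinset),
        List.toFinset_card_of_nodup Δ.nodup]
    have h3 : Fintype.card F = k := by
      rw [Fintype.card_of_subtype Δ.faces.toFinset (fun x => List.mem_toFinset),
        List.toFinset_card_of_nodup hfnd, Δ.faces_length]
    have h4 : insert Δ.base (ds.map Δ.src).toFinset ⊆
        Finset.univ.image (fun d : D => Δ.src d.1) := by
      intro x hx
      have hb : Δ.base ∈ ds.map Δ.src := by
        rw [← hlen] at hW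
        have := Δ.out_walk.src_getElem 0 hW
        rw [if_pos rfl] at this
        rw [← this]
        exact List.mem_map_of_mem (hmem' _ List.mem_cons_self _ (List.getElem_mem _))
      have : x ∈ ds.map Δ.src := by
        rcases Finset.mem_insert.1 hx with rfl | hx
        · exact hb
        · exact List.mem_toFinset.1 hx
      obtain ⟨y, hy, rfl⟩ := List.mem_map.1 this
      exact Finset.mem_image_of_mem (fun d : D => Δ.src d.1) (Finset.mem_univ (⟨y, hy⟩ : D))
    have h5 := Finset.card_le_card h4
    rw [h2, h3]
    rw [← hds] at h1
    omega

end

theorem weighted_fiber_count {D : Type} [Fintype D] [DecidableEq D] (σ : Equiv.Perm D) (src : D → ℕ)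
    (hs : ∀ d, src (σ d) = src d) (hf : ∀ d, σ d ≠ d) :
    12 * (Finset.univ.image src).card + 2 * (Finset.univ.filter fun d => σ (σ d) ≠ d).card +
      (Finset.univ.filter fun d => σ (σ d) ≠ d ∧ σ (σ (σ d)) ≠ d).card ≤ 6 * Fintype.card D := by
  have key : ∀ v ∈ Finset.univ.image src,
      12 ≤ ∑ d ∈ Finset.univ.filter (fun d => src d = v),
        (if σ (σ d) = d then 6 else if σ (σ (σ d)) = d then 4 else 3) := by
    intro v hv
    obtain ⟨x, -, rfl⟩ := Finset.mem_image.1 hv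
    set w : D → ℕ := fun d => if σ (σ d) = d then 6 else if σ (σ (σ d)) = d then 4 else 3 with hw
    change 12 ≤ ∑ d ∈ _, w d
    have hsub : ∀ s : Finset D, (∀ y ∈ s, src y = src x) →
        ∑ d ∈ s, w d ≤ ∑ d ∈ Finset.univ.filter (fun d => src d = src x), w d :=
      fun s hs => Finset.sum_le_sum_of_subset fun y hy => by simp [hs y hy]
    have hσ : ∀ {a b}, σ a = σ b ↔ a = b := σ.injective.eq_iff
    by_cases h2 : σ (σ x) = x
    · refine le_trans ?_ (hsub {x, σ x} ?_)
      · rw [Finset.sum_pair (hf x).symm]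
        simp [hw, h2]
      · simp [hs]
    · by_cases h3 : σ (σ (σ x)) = x
      · refine le_trans ?_ (hsub {x, σ x, σ (σ x)} ?_)
        · rw [Finset.sum_insert, Finset.sum_pair (hf _).symm]
          · simp [hw, h2, h3, hσ, (hf x).symm]
          · simp only [Finset.mem_insert, Finset.mem_singleton, not_or]
            exact ⟨(hf x).symm, Ne.symm h2⟩
        · simp [hs]
      · refine le_trans ?_ (hsub {x, σ x, σ (σ x), σ (σ (σ x))} ?_)
        · have hle : ∀ d, 3 ≤ w d := by
            intro d
            simp only [hw]
            split_ifs <;> omega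
          rw [Finset.sum_insert, Finset.sum_insert, Finset.sum_pair (hf _).symm]
          · have := hle x
            have := hle (σ x)
            have := hle (σ (σ x))
            have := hle (σ (σ (σ x)))
            omega
          · simp only [Finset.mem_insert, Finset.mem_singleton, not_or]
            exact ⟨(hf _).symm, fun h => h2 (hσ.1 h).symm⟩
          · simp only [Finset.mem_insert, Finset.mem_singleton, not_or]
            exact ⟨(hf _).symm, Ne.symm h2, Ne.symm h3⟩
        · simp [hs]
  have h1 := Finset.card_nsmul_le_sum (Finset.univ.image src) _ 12 key
  rw [Finset.sum_fiberwise_of_maps_to (fun d _ => Finset.mem_image_of_mem src (Finset.mem_univ d)),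
    smul_eq_mul] at h1
  have h2 : ∑ d : D, (if σ (σ d) = d then 6 else if σ (σ (σ d)) = d then 4 else 3) +
      2 * (Finset.univ.filter fun d => σ (σ d) ≠ d).card +
      (Finset.univ.filter fun d => σ (σ d) ≠ d ∧ σ (σ (σ d)) ≠ d).card = 6 * Fintype.card D := by
    rw [Finset.card_filter, Finset.card_filter, Finset.mul_sum, ← Finset.sum_add_distrib,
      ← Finset.sum_add_distrib, ← Finset.card_univ, Finset.card_eq_sum_ones, Finset.mul_sum]
    refine Finset.sum_congr rfl fun d _ => ?_
    by_cases h2 : σ (σ d) = d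
    · simp [h2]
    · by_cases h3 : σ (σ (σ d)) = d
      · simp [h2, h3]
      · simp [h2, h3]
  omega

theorem perm_pow_eq_iff {D ι : Type} [Fintype D] [DecidableEq D] [DecidableEq ι] {φ : Equiv.Perm D}
    {face : D → ι} (hφ : ∀ d, face (φ d) = face d)
    (hpow : ∀ d e, face d = face e → ∃ k : ℕ, (φ ^ k) d = e) (d : D) :
    (∀ n, (φ ^ n) d = d ↔ (Finset.univ.filter fun e => face e = face d).card ∣ n) ∧
    (Finset.univ.filter fun e => face e = face d) =
      (Finset.range (Finset.univ.filter fun e => face e = face d).card).image (fun k => (φ ^ k) d) ∧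
    Set.InjOn (fun k => (φ ^ k) d)
      (Finset.range (Finset.univ.filter fun e => face e = face d).card : Set ℕ) := by
  have hface : ∀ n, face ((φ ^ n) d) = face d := by
    intro n
    induction n with
    | zero => rfl
    | succ n ih => rw [pow_succ', Equiv.Perm.mul_apply, hφ, ih]
  have hpp : 0 < Function.minimalPeriod φ d := by
    apply Function.IsPeriodicPt.minimalPeriod_pos (orderOf_pos φ)
    change (⇑φ)^[orderOf φ] d = d
    rw [← Equiv.Perm.coe_pow, pow_orderOf_eq_one]
    rfl
  have himg : (Finset.univ.filter fun e => face e = face d) =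
      (Finset.range (Function.minimalPeriod φ d)).image fun k => (φ ^ k) d := by
    ext e
    simp only [Finset.mem_filter, Finset.mem_univ, true_and, Finset.mem_image, Finset.mem_range]
    constructor
    · intro he
      obtain ⟨k, hk⟩ := hpow d e he.symm
      refine ⟨k % Function.minimalPeriod φ d, Nat.mod_lt _ hpp, ?_⟩
      rw [Equiv.Perm.coe_pow, Function.iterate_mod_minimalPeriod_eq, ← Equiv.Perm.coe_pow, hk]
    · rintro ⟨k, -, rfl⟩
      exact hface k
  have hinj : Set.InjOn (fun k => (φ ^ k) d) (Finset.range (Function.minimalPeriod φ d) : Set ℕ) := by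
    intro a ha b hb hab
    simp only [Finset.coe_range, Set.mem_Iio] at ha hb
    simp only [Equiv.Perm.coe_pow] at hab
    exact (Function.iterate_eq_iterate_iff_of_lt_minimalPeriod ha hb).1 hab
  have hper : (Finset.univ.filter fun e => face e = face d).card = Function.minimalPeriod φ d := by
    rw [himg, Finset.card_image_of_injOn hinj, Finset.card_range]
  rw [hper]
  refine ⟨fun n => ?_, himg, hinj⟩
  rw [← Function.isPeriodicPt_iff_minimalPeriod_dvd, Equiv.Perm.coe_pow]
  rfl

section rd

variable {S D : Type} (φ : Equiv.Perm D) (lab : D → S × Bool)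

theorem length_rd (d : D) (m : ℕ) : (rd φ lab d m).length = m := by simp [rd]

theorem rd_add (d : D) (a b : ℕ) : rd φ lab d (a + b) = rd φ lab d a ++ rd φ lab ((φ ^ a) d) b := by
  simp only [rd, List.range_add, List.map_append, List.map_map]
  congr 1
  apply List.map_congr_left
  intro t _
  simp [← Equiv.Perm.mul_apply, ← pow_add, Nat.add_comm]

theorem rd_prefix (d : D) {a b : ℕ} (h : a ≤ b) : rd φ lab d a <+: rd φ lab d b := by
  obtain ⟨e, rfl⟩ := Nat.exists_eq_add_of_le h
  exact ⟨_, (rd_add φ lab d a e).symm⟩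

end rd

namespace Disc

variable {S : Type} {P : C6Presentation S} {W : Word S} (Δ : Disc P W)

theorem pow_add_apply (a b : ℕ) (d : Δ.D) : (Δ.φ ^ (a + b)) d = (Δ.φ ^ a) ((Δ.φ ^ b) d) := by
  rw [pow_add, Equiv.Perm.mul_apply]

theorem pow_succ_apply (a : ℕ) (d : Δ.D) : (Δ.φ ^ (a + 1)) d = Δ.φ ((Δ.φ ^ a) d) := by
  rw [pow_succ', Equiv.Perm.mul_apply]

theorem face_pow (n : ℕ) (d : Δ.D) : Δ.face ((Δ.φ ^ n) d) = Δ.face d := by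
  induction n with
  | zero => rfl
  | succ n ih => rw [pow_succ_apply, Δ.face_φ, ih]

theorem pos_pow (n : ℕ) (d : Δ.D) : Δ.pos ((Δ.φ ^ n) d) = Δ.pos d * P.elt (rd Δ.φ Δ.lab d n) := by
  induction n with
  | zero => simp [rd, elt_nil]
  | succ n ih =>
    rw [pow_succ_apply, Δ.pos_φ, ih, rd_add, elt_append, mul_assoc]
    rfl

theorem pos_σ (d : Δ.D) : Δ.pos (Δ.φ (Δ.α d)) = Δ.pos d := Δ.pos_src _ _ (Δ.src_φ d)

theorem pos_α (d : Δ.D) : Δ.pos (Δ.α d) = Δ.pos (Δ.φ d) := by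
  rw [← Δ.pos_σ (Δ.α d), Δ.α_α]

theorem N_pos (f : Δ.F) : 0 < Δ.N f := by
  obtain ⟨d, hd⟩ := Δ.exists_face f
  rw [← Δ.card_face]
  exact Finset.card_pos.2 ⟨d, by simp [hd]⟩

theorem period {d : Δ.D} {f : Δ.F} (h : Δ.face d = some f) (n : ℕ) :
    (Δ.φ ^ n) d = d ↔ Δ.N f ∣ n := by
  rw [(perm_pow_eq_iff Δ.face_φ Δ.exists_pow d).1, h, Δ.card_face]

theorem pow_N {d : Δ.D} {f : Δ.F} (h : Δ.face d = some f) : (Δ.φ ^ Δ.N f) d = d :=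
  (Δ.period h _).2 dvd_rfl

theorem lab_φ_ne {d : Δ.D} {f : Δ.F} (h : Δ.face d = some f) : Δ.lab (Δ.φ d) ≠ linv (Δ.lab d) := by
  have h1 := P.cyclically_reduced _ (Δ.rel d f h)
  have h2 : rd Δ.φ Δ.lab d (Δ.N f) ++ rd Δ.φ Δ.lab d (Δ.N f) = rd Δ.φ Δ.lab d (Δ.N f + Δ.N f) := by
    rw [rd_add, Δ.pow_N h]
  obtain ⟨m, hm⟩ : ∃ m, Δ.N f + Δ.N f = 1 + (1 + m) :=
    ⟨Δ.N f + Δ.N f - 2, by have := Δ.N_pos f; omega⟩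
  rw [CyclicallyReduced, h2, hm, rd_add, rd_add] at h1
  have h3 := (List.isChain_cons_cons.1 h1).1
  intro H
  simp only [pow_zero, pow_one, Equiv.Perm.one_apply] at h3
  rw [H] at h3
  simp [linv] at h3

theorem pos_inj {d e : Δ.D} (hinj : ∀ i < W.length, ∀ j < W.length,
    P.elt (W.take i) = P.elt (W.take j) → i = j) (hd : Δ.face d = none) (he : Δ.face e = none)
    (h : Δ.pos d = Δ.pos e) : d = e := by
  rw [Δ.pos_idx d hd, Δ.pos_idx e he] at h
  exact Δ.idx_inj d e hd he (hinj _ (Δ.idx_lt d hd) _ (Δ.idx_lt e he) h)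

theorem idx_pow {d : Δ.D} (hd : Δ.face d = none) (n : ℕ) :
    Δ.idx ((Δ.φ ^ n) d) = (Δ.idx d + n) % W.length := by
  induction n with
  | zero => simp [Nat.mod_eq_of_lt (Δ.idx_lt d hd)]
  | succ n ih =>
    rw [pow_succ_apply, Δ.idx_φ _ (by rw [Δ.face_pow, hd]), ih, Nat.mod_add_mod, Nat.add_assoc]

theorem not_inverse {d : Δ.D} {f g : Δ.F} (hd : Δ.face d = some f) (hg : Δ.face (Δ.α d) = some g) :
    rd Δ.φ Δ.lab (Δ.φ (Δ.α d)) (Δ.N g) ≠ wordInv (rd Δ.φ Δ.lab d (Δ.N f)) := by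
  by_cases hfg : f = g
  swap
  · exact Δ.reduced d f g hd hg hfg
  subst hfg
  intro H
  obtain ⟨k', hk'⟩ := Δ.exists_pow d (Δ.α d) (hd.trans hg.symm)
  obtain ⟨k, hkn, hk⟩ : ∃ k < Δ.N f, (Δ.φ ^ k) d = Δ.α d := by
    refine ⟨k' % Δ.N f, Nat.mod_lt _ (Δ.N_pos f), ?_⟩
    have h1 : (Δ.φ ^ (k' % Δ.N f)) ((Δ.φ ^ (Δ.N f * (k' / Δ.N f))) d) = Δ.α d := by
      rw [← pow_add_apply, Nat.mod_add_div, hk']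
    rwa [(Δ.period hd _).2 (dvd_mul_right _ _)] at h1
  have key : ∀ a < Δ.N f, Δ.lab ((Δ.φ ^ (k - a)) ((Δ.φ ^ (Δ.N f)) d)) = linv (Δ.lab ((Δ.φ ^ a) d)) ∨
      k < a := by
    intro a ha
    rcases Nat.lt_or_ge k a with h | h
    · exact Or.inr h
    left
    have h1 := congrArg (fun l => l[Δ.N f - 1 - a]?) H
    simp only [wordInv_eq, rd] at h1
    rw [List.getElem?_eq_getElem (by simp; omega), List.getElem?_eq_getElem (by simp; omega),
      Option.some.injEq] at h1
    simp only [List.getElem_map, List.getElem_range, List.getElem_reverse, List.length_map,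
      List.length_range] at h1
    rw [← hk, ← pow_succ_apply, ← pow_add_apply,
      show Δ.N f - 1 - a + (k + 1) = (k - a) + Δ.N f by omega,
      show Δ.N f - 1 - (Δ.N f - 1 - a) = a by omega, pow_add_apply] at h1
    exact h1
  rw [Δ.pow_N hd] at key
  rcases Nat.even_or_odd' k with ⟨a, rfl | rfl⟩
  · rcases key a (by omega) with h | h
    · rw [show 2 * a - a = a by omega] at h
      exact linv_ne _ h.symm
    · omega
  · rcases key a (by omega) with h | h
    · rw [show 2 * a + 1 - a = a + 1 by omega, pow_succ_apply] at h
      exact Δ.lab_φ_ne (f := f) (by rw [Δ.face_pow, hd]) h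
    · omega

end Disc

namespace Disc

variable {S : Type} {P : C6Presentation S} {W : Word S} (Δ : Disc P W)

/-- Rotation of darts about their source vertex. -/
def σ : Equiv.Perm Δ.D := Δ.φ * Function.Involutive.toPerm Δ.α Δ.α_α

theorem σ_apply (d : Δ.D) : Δ.σ d = Δ.φ (Δ.α d) := rfl

/-- A dart whose source is not a vertex of degree two. -/
def Brk (d : Δ.D) : Prop := Δ.σ (Δ.σ d) ≠ d

theorem brk_σ (d : Δ.D) : Δ.Brk (Δ.σ d) ↔ Δ.Brk d := not_congr Δ.σ.injective.eq_iff

theorem brk_α (d : Δ.D) : Δ.Brk (Δ.α d) ↔ Δ.Brk (Δ.φ d) := by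
  rw [← Δ.brk_σ, σ_apply, Δ.α_α]

theorem φ_α_of_not_brk {d : Δ.D} (h : ¬ Δ.Brk (Δ.φ d)) : Δ.φ (Δ.α (Δ.φ d)) = Δ.α d := by
  have h1 : Δ.φ (Δ.α (Δ.φ (Δ.α (Δ.φ d)))) = Δ.φ d := not_not.1 h
  have h2 := congrArg Δ.α (Δ.φ.injective h1)
  rwa [Δ.α_α] at h2

theorem α_run {d : Δ.D} {k : ℕ} (h : ∀ i, 1 ≤ i → i < k → ¬ Δ.Brk ((Δ.φ ^ i) d)) {i t : ℕ}
    (ht : t ≤ i) (hi : i < k) : (Δ.φ ^ t) (Δ.α ((Δ.φ ^ i) d)) = Δ.α ((Δ.φ ^ (i - t)) d) := by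
  induction t with
  | zero => rfl
  | succ t ih =>
    obtain ⟨j, hj⟩ : ∃ j, i - t = j + 1 := ⟨i - t - 1, by omega⟩
    rw [pow_succ_apply, ih (by omega), hj, show i - (t + 1) = j by omega, pow_succ_apply]
    apply Δ.φ_α_of_not_brk
    rw [← pow_succ_apply]
    exact h _ (by omega) (by omega)

theorem face_α_run {d : Δ.D} {k : ℕ} (h : ∀ i, 1 ≤ i → i < k → ¬ Δ.Brk ((Δ.φ ^ i) d)) {i : ℕ}
    (hi : i < k) : Δ.face (Δ.α ((Δ.φ ^ i) d)) = Δ.face (Δ.α d) := by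
  rw [← Δ.face_pow i, Δ.α_run h le_rfl hi, Nat.sub_self]
  rfl

theorem run_piece {d : Δ.D} {k : ℕ} (h : ∀ i, 1 ≤ i → i < k → ¬ Δ.Brk ((Δ.φ ^ i) d)) (hk : 1 ≤ k)
    {f g : Δ.F} (hd : Δ.face d = some f) (hg : Δ.face (Δ.α d) = some g) : 6 * k < Δ.N f := by
  set m := min k (min (Δ.N f) (Δ.N g)) with hm
  have hNf := Δ.N_pos f
  have hNg := Δ.N_pos g
  have hm1 : 1 ≤ m := by omega
  set e := Δ.α ((Δ.φ ^ (m - 1)) d) with he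
  have hef : Δ.face e = some g := by rw [he, Δ.face_α_run h (by omega), hg]
  have hem : (Δ.φ ^ m) e = Δ.φ (Δ.α d) := by
    obtain ⟨j, hj⟩ : ∃ j, m = j + 1 := ⟨m - 1, by omega⟩
    rw [he, hj, pow_succ_apply, Nat.add_sub_cancel, Δ.α_run h le_rfl (by omega), Nat.sub_self]
    rfl
  have hrd : wordInv (rd Δ.φ Δ.lab e m) = rd Δ.φ Δ.lab d m := by
    rw [wordInv_eq]
    apply List.ext_getElem
    · simp [rd]
    · intro t h1 h2
      rw [length_rd] at h2
      simp only [rd, List.getElem_reverse, List.getElem_map, List.getElem_range, List.length_map,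
        List.length_range]
      rw [he, Δ.α_run h (by omega) (by omega), Δ.lab_α, linv_linv,
        show m - 1 - (m - 1 - t) = t by omega]
  have hr2 : rd Δ.φ Δ.lab d m <+: wordInv (rd Δ.φ Δ.lab (Δ.φ (Δ.α d)) (Δ.N g)) := by
    obtain ⟨j, hj⟩ : ∃ j, Δ.N g = j + m := ⟨Δ.N g - m, by omega⟩
    rw [← hem, hj, rd_add, wordInv_append, ← pow_add_apply, ← hj, Δ.pow_N hef, hrd]
    exact List.prefix_append _ _
  have hr1 : rd Δ.φ Δ.lab d m <+: rd Δ.φ Δ.lab d (Δ.N f) := rd_prefix _ _ _ (by omega)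
  have hR1 := Δ.rel d f hd
  have hR2 := P.inv_mem _ (Δ.rel (Δ.φ (Δ.α d)) g (by rw [Δ.face_φ, hg]))
  have hp : IsPiece P.rels (rd Δ.φ Δ.lab d m) := by
    refine ⟨_, hR1, _, hR2, fun H => Δ.not_inverse hd hg ?_, hr1, hr2⟩
    rw [H, wordInv_wordInv]
  have h1 := P.small_cancellation _ hR1 _ hr1 hp
  have h2 := P.small_cancellation _ hR2 _ hr2 hp
  rw [length_wordInv, length_rd, length_rd] at h2
  rw [length_rd, length_rd] at h1
  omega

theorem pos_idx_pow (hW : P.elt W = 1) {e : Δ.D} (he : Δ.face e = none) {m : ℕ}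
    (hm : Δ.idx e + m ≤ W.length) : Δ.pos ((Δ.φ ^ m) e) = P.elt (W.take (Δ.idx e + m)) := by
  rw [Δ.pos_idx _ (by rw [Δ.face_pow, he]), Δ.idx_pow he]
  rcases hm.eq_or_lt with h | h
  · rw [h, Nat.mod_self, List.take_length, hW]
    simp [elt_nil]
  · rw [Nat.mod_eq_of_lt h]

theorem idx_no_wrap {C : Finset ℕ} (h0 : 0 ∈ C) {e : Δ.D} (he : Δ.face e = none) {k : ℕ}
    (h : ∀ t < k, Δ.idx ((Δ.φ ^ t) e) ∉ C) :
    Δ.idx e + k ≤ W.length ∧ ∀ i, Δ.idx e ≤ i → i < Δ.idx e + k → i ∉ C := by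
  induction k with
  | zero => exact ⟨(Δ.idx_lt e he).le, fun i h1 h2 => by omega⟩
  | succ k ih =>
    obtain ⟨h1, h2⟩ := ih fun t ht => h t (by omega)
    have h3 := h k (by omega)
    rw [Δ.idx_pow he] at h3
    rcases h1.eq_or_lt with h4 | h4
    · rw [h4, Nat.mod_self] at h3
      exact absurd h0 h3
    · rw [Nat.mod_eq_of_lt h4] at h3
      refine ⟨by omega, fun i hi1 hi2 => ?_⟩
      rcases (show i ≤ Δ.idx e + k by omega).eq_or_lt with rfl | hi
      · exact h3
      · exact h2 i hi1 hi

/-- A face not adjacent to a corner dart of the outer face. -/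
def Clean (C : Finset ℕ) (f : Δ.F) : Prop :=
  ∀ d, Δ.face d = some f → Δ.face (Δ.α d) = none → Δ.idx (Δ.α d) ∉ C

theorem run_clean {C : Finset ℕ} (h0 : 0 ∈ C) (hW : P.elt W = 1)
    (hwin : ∀ j k, j + k ≤ W.length → (∀ i, j ≤ i → i < j + k → i ∉ C) →
      dst P (P.elt (W.take j)) (P.elt (W.take (j + k))) = k)
    {d : Δ.D} {k : ℕ} (h : ∀ i, 1 ≤ i → i < k → ¬ Δ.Brk ((Δ.φ ^ i) d)) (hk : 1 ≤ k)
    {f : Δ.F} (hf : Δ.Clean C f) (hd : Δ.face d = some f) (hg : Δ.face (Δ.α d) = none) :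
    2 * k ≤ Δ.N f := by
  set m := min k (Δ.N f) with hm
  have hNf := Δ.N_pos f
  have hm1 : 1 ≤ m := by omega
  set e := Δ.α ((Δ.φ ^ (m - 1)) d) with he
  have hef : Δ.face e = none := by rw [he, Δ.face_α_run h (by omega), hg]
  have het : ∀ t < m, (Δ.φ ^ t) e = Δ.α ((Δ.φ ^ (m - 1 - t)) d) := fun t ht =>
    Δ.α_run h (by omega) (by omega)
  obtain ⟨h1, h2⟩ := Δ.idx_no_wrap (k := m) h0 hef fun t ht => by
    rw [het t ht]
    refine hf _ (by rw [Δ.face_pow, hd]) ?_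
    rw [← het t ht, Δ.face_pow, hef]
  have h3 := hwin _ _ h1 h2
  obtain ⟨j, hj⟩ : ∃ j, m = j + 1 := ⟨m - 1, by omega⟩
  have h4 : Δ.pos ((Δ.φ ^ m) e) = Δ.pos d := by
    rw [hj, pow_succ_apply, het j (by omega), show m - 1 - j = 0 by omega]
    exact Δ.pos_σ d
  have h5 : Δ.pos e = Δ.pos ((Δ.φ ^ m) d) := by
    conv_rhs => rw [hj, pow_succ_apply, ← Δ.pos_α]
    rw [he, show m - 1 = j by omega]
  rw [← Δ.pos_idx e hef, ← Δ.pos_idx_pow hW hef h1, h4, h5] at h3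
  have h6 : Δ.pos d = Δ.pos ((Δ.φ ^ m) d) * P.elt (rd Δ.φ Δ.lab ((Δ.φ ^ m) d) (Δ.N f - m)) := by
    rw [← pos_pow, ← pow_add_apply, show Δ.N f - m + m = Δ.N f by omega, Δ.pow_N hd]
  have h7 := dst_mul_elt_le P (Δ.pos ((Δ.φ ^ m) d)) (rd Δ.φ Δ.lab ((Δ.φ ^ m) d) (Δ.N f - m))
  rw [← h6, h3, length_rd] at h7
  omega

theorem φ_φ_ne (h3 : 3 ≤ W.length) {d : Δ.D} (hd : Δ.face d = none) : Δ.φ (Δ.φ d) ≠ d := by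
  intro h
  have h1 := Δ.idx_pow hd 2
  rw [show (Δ.φ ^ 2) d = Δ.φ (Δ.φ d) by rw [pow_two]; rfl, h] at h1
  have h2 := Δ.idx_lt d hd
  rcases Nat.lt_or_ge (Δ.idx d + 2) W.length with h4 | h4
  · rw [Nat.mod_eq_of_lt h4] at h1
    omega
  · rw [Nat.mod_eq_sub_mod h4, Nat.mod_eq_of_lt (by omega)] at h1
    omega

theorem inner_α (h3 : 3 ≤ W.length) (hinj : ∀ i < W.length, ∀ j < W.length,
    P.elt (W.take i) = P.elt (W.take j) → i = j) {d : Δ.D} (hd : Δ.face d = none) :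
    Δ.face (Δ.α d) ≠ none := by
  intro h
  have h1 : Δ.α d = Δ.φ d := Δ.pos_inj hinj h (by rw [Δ.face_φ, hd]) (Δ.pos_α d)
  have h2 : Δ.φ (Δ.α d) = d := Δ.pos_inj hinj (by rw [Δ.face_φ, h]) hd (Δ.pos_σ d)
  rw [h1] at h2
  exact Δ.φ_φ_ne h3 hd h2

theorem σ_ne (h3 : 3 ≤ W.length) (hinj : ∀ i < W.length, ∀ j < W.length,
    P.elt (W.take i) = P.elt (W.take j) → i = j) (d : Δ.D) : Δ.σ d ≠ d := by
  intro h
  rw [σ_apply] at h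
  rcases hf : Δ.face (Δ.α d) with - | f
  · refine Δ.inner_α h3 hinj hf ?_
    rw [Δ.α_α, ← h, Δ.face_φ, hf]
  · have := Δ.lab_φ_ne hf
    rw [h, Δ.lab_α, linv_linv] at this
    exact this rfl

theorem brk_count (h3 : 3 ≤ W.length) (hinj : ∀ i < W.length, ∀ j < W.length,
    P.elt (W.take i) = P.elt (W.take j) → i = j) :
    2 * (Finset.univ.filter fun d => Δ.σ (Δ.σ d) ≠ d).card +
      (Finset.univ.filter fun d => Δ.σ (Δ.σ d) ≠ d ∧ Δ.σ (Δ.σ (Δ.σ d)) ≠ d).card + 12 ≤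
      12 * Fintype.card Δ.F := by
  have h1 := weighted_fiber_count Δ.σ Δ.src Δ.src_φ (Δ.σ_ne h3 hinj)
  have h2 := Δ.euler
  omega

theorem run_le {L K : ℕ} (hL : L < W.length) (hinj : ∀ i < W.length, ∀ j < W.length,
    P.elt (W.take i) = P.elt (W.take j) → i = j) (hW : P.elt W = 1) (h3 : 3 ≤ W.length)
    (hK : ∀ a ≤ L, ∀ b ≤ L, ∀ r ∈ P.rels, ∀ p, p <+: r →
      P.elt (W.take a) * P.elt p = P.elt (W.take b) → a ≤ b + K)
    {d : Δ.D} {k : ℕ} (h : ∀ i, 1 ≤ i → i < k → ¬ Δ.Brk ((Δ.φ ^ i) d)) (hd : Δ.face d = none)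
    (hk : 1 ≤ k) (hkL : Δ.idx d + k ≤ L) : k ≤ K := by
  obtain ⟨g, hg⟩ := Option.ne_none_iff_exists'.1 (Δ.inner_α h3 hinj hd)
  have hNg := Δ.N_pos g
  set m := min k (Δ.N g) with hm
  have hm1 : 1 ≤ m := by omega
  obtain ⟨j, hj⟩ : ∃ j, m = j + 1 := ⟨m - 1, by omega⟩
  set e := Δ.α ((Δ.φ ^ j) d) with he
  have hef : Δ.face e = some g := by rw [he, Δ.face_α_run h (by omega), hg]
  have h4 : Δ.pos ((Δ.φ ^ m) e) = Δ.pos d := by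
    rw [hj, pow_succ_apply, he, Δ.α_run h le_rfl (by omega), Nat.sub_self]
    exact Δ.pos_σ d
  have h5 : Δ.pos e = Δ.pos ((Δ.φ ^ m) d) := by
    rw [hj, pow_succ_apply, ← Δ.pos_α]
  rw [pos_pow, h5, Δ.pos_idx_pow hW hd (by omega), Δ.pos_idx d hd] at h4
  have h6 := hK _ (by omega) _ (by omega) _ (Δ.rel e g hef) _
    (rd_prefix _ _ _ (min_le_right _ _)) h4
  rcases Nat.lt_or_ge k (Δ.N g) with h7 | h7
  · omega
  · rw [show m = Δ.N g by omega, elt_rel P (Δ.rel e g hef), mul_one] at h4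
    have := hinj _ (by omega) _ (by omega) h4
    omega

end Disc

/-- A reduced map with vertices of degree two suppressed, given by the set `B` of
its darts, together with the small cancellation data on its faces. The face `none` is the outer
face; the outer vertices with `idx ≤ L` lie along a geodesic. -/
structure BMap (K A₀ A₁ L : ℕ) where
  B : Type
  [fB : Fintype B]
  [dB : DecidableEq B]
  F : Type
  [fF : Fintype F]
  [dF : DecidableEq F]
  X : Type
  dist : X → X → ℕ
  σ : Equiv.Perm B
  nx : Equiv.Perm B
  ι : B → B
  face : B → Option F
  len : B → ℕ
  N : F → ℕ
  Clean : F → Prop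
  pos : B → X
  idx : B → ℕ
  dist_comm : ∀ x y, dist x y = dist y x
  dist_triangle : ∀ x y z, dist x z ≤ dist x y + dist y z
  ι_ι : ∀ b, ι (ι b) = b
  σ_ι : ∀ b, σ (ι b) = nx b
  len_ι : ∀ b, len (ι b) = len b
  len_pos : ∀ b, 1 ≤ len b
  face_nx : ∀ b, face (nx b) = face b
  exists_pow : ∀ b e, face b = face e → ∃ k : ℕ, (nx ^ k) b = e
  inner_ι : ∀ b, face b = none → face (ι b) ≠ none
  not_pinched : ∀ b, face b ≠ none → face (ι b) = none → face (ι (nx b)) ≠ none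
  piece : ∀ b f, face b = some f → face (ι b) ≠ none → 6 * len b < N f
  clean_len : ∀ b f, Clean f → face b = some f → face (ι b) = none → 2 * len b ≤ N f
  N_le : ∀ f, Clean f → N f ≤ ∑ b ∈ Finset.univ.filter (fun b => face b = some f), len b
  N_pos : ∀ f, 0 < N f
  card_not_clean : ∃ s : Finset F, s.card ≤ 6 ∧ ∀ f, f ∉ s → Clean f
  count : 2 * Fintype.card B + (Finset.univ.filter fun b => σ (σ (σ b)) ≠ b).card + 12 ≤
    12 * Fintype.card F
  pos_σ : ∀ b, pos (σ b) = pos b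
  dist_nx : ∀ b, dist (pos b) (pos (nx b)) ≤ len b
  pos_inj : ∀ b e, face b = none → face e = none → pos b = pos e → b = e
  idx_nx : ∀ b f, face b = none → face (ι b) = some f → Clean f →
    idx (nx b) = 0 ∨ idx (nx b) = idx b + len b
  geo : ∀ b e, face b = none → face e = none → idx b ≤ idx e → idx e ≤ L →
    dist (pos b) (pos e) = idx e - idx b
  far : ∀ b e, face b = none → face e = none → A₀ ≤ idx b → idx b ≤ A₁ → (idx e = 0 ∨ L ≤ idx e) →
    2 * K < dist (pos b) (pos e)
  idx_nx_of_le : ∀ b, face b = none → idx b + K + 1 ≤ L → idx (nx b) = idx b + len b ∧ len b ≤ K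
  exists_start : A₀ + K + 1 ≤ L → ∃ b, face b = none ∧ A₀ ≤ idx b ∧ idx b ≤ A₀ + K

attribute [instance] BMap.fB BMap.dB BMap.fF BMap.dF

namespace Disc

variable {S : Type} {P : C6Presentation S} {W : Word S} (Δ : Disc P W)

theorem exists_brk {d : Δ.D} (h : Δ.Brk d) : ∃ k, 1 ≤ k ∧ Δ.Brk ((Δ.φ ^ k) d) :=
  ⟨orderOf Δ.φ, orderOf_pos _, by rwa [pow_orderOf_eq_one]⟩

open Classical in
/-- The distance along the face to the next break. -/
noncomputable def len (b : {d // Δ.Brk d}) : ℕ := Nat.find (Δ.exists_brk b.2)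

theorem one_le_len (b : {d // Δ.Brk d}) : 1 ≤ Δ.len b := by
  classical
  exact (Nat.find_spec (Δ.exists_brk b.2)).1

theorem brk_len (b : {d // Δ.Brk d}) : Δ.Brk ((Δ.φ ^ Δ.len b) b.1) := by
  classical
  exact (Nat.find_spec (Δ.exists_brk b.2)).2

theorem len_le (b : {d // Δ.Brk d}) {k : ℕ} (hk : 1 ≤ k) (h : Δ.Brk ((Δ.φ ^ k) b.1)) :
    Δ.len b ≤ k := by
  classical
  exact Nat.find_min' (Δ.exists_brk b.2) ⟨hk, h⟩

theorem not_brk_of_lt (b : {d // Δ.Brk d}) (i : ℕ) (hi : 1 ≤ i) (h : i < Δ.len b) :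
    ¬ Δ.Brk ((Δ.φ ^ i) b.1) := fun H => by
  have := Δ.len_le b hi H
  omega

/-- The next break along the face. -/
noncomputable def nxFun (b : {d // Δ.Brk d}) : {d // Δ.Brk d} :=
  ⟨(Δ.φ ^ Δ.len b) b.1, Δ.brk_len b⟩

theorem nxFun_injective : Function.Injective Δ.nxFun := by
  have key : ∀ b e, Δ.nxFun b = Δ.nxFun e → Δ.len b ≤ Δ.len e → b = e := by
    intro b e h hle
    have h1 : (Δ.φ ^ Δ.len b) b.1 = (Δ.φ ^ Δ.len e) e.1 := congrArg Subtype.val h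
    obtain ⟨j, hj⟩ := Nat.exists_eq_add_of_le hle
    rw [hj, pow_add_apply] at h1
    have h2 := (Δ.φ ^ Δ.len b).injective h1
    rcases Nat.eq_zero_or_pos j with rfl | hj0
    · exact Subtype.ext h2
    · have := Δ.len_le e hj0 (h2 ▸ b.2)
      have := Δ.one_le_len b
      omega
  intro b e h
  rcases le_total (Δ.len b) (Δ.len e) with hle | hle
  · exact key b e h hle
  · exact (key e b h.symm hle).symm

/-- The next break along the face, as a permutation. -/
noncomputable def nx : Equiv.Perm {d // Δ.Brk d} :=
  Equiv.ofBijective Δ.nxFun (Finite.injective_iff_bijective.1 Δ.nxFun_injective)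

theorem nx_val (b : {d // Δ.Brk d}) : (Δ.nx b).1 = (Δ.φ ^ Δ.len b) b.1 := rfl

/-- The break starting the reverse of the edge path from a break to the next one. -/
noncomputable def ι (b : {d // Δ.Brk d}) : {d // Δ.Brk d} :=
  ⟨Δ.α ((Δ.φ ^ (Δ.len b - 1)) b.1), by
    rw [brk_α, ← pow_succ_apply, Nat.sub_add_cancel (Δ.one_le_len b)]
    exact Δ.brk_len b⟩

theorem α_run_brk (b : {d // Δ.Brk d}) {t : ℕ} (ht : t < Δ.len b) :
    (Δ.φ ^ t) (Δ.ι b).1 = Δ.α ((Δ.φ ^ (Δ.len b - 1 - t)) b.1) :=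
  Δ.α_run (Δ.not_brk_of_lt b) (by omega) (by have := Δ.one_le_len b; omega)

theorem pow_len_ι (b : {d // Δ.Brk d}) : (Δ.φ ^ Δ.len b) (Δ.ι b).1 = Δ.σ b.1 := by
  obtain ⟨j, hj⟩ : ∃ j, Δ.len b = j + 1 := ⟨Δ.len b - 1, by have := Δ.one_le_len b; omega⟩
  have h := Δ.α_run_brk b (t := j) (by omega)
  rw [show Δ.len b - 1 - j = 0 by omega] at h
  conv_lhs => rw [hj, pow_succ_apply, h]
  rfl

theorem len_ι (b : {d // Δ.Brk d}) : Δ.len (Δ.ι b) = Δ.len b := by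
  have h1 := Δ.one_le_len b
  have h2 : Δ.len (Δ.ι b) ≤ Δ.len b := by
    refine Δ.len_le _ h1 ?_
    rw [pow_len_ι, brk_σ]
    exact b.2
  refine le_antisymm h2 (not_lt.1 fun hlt => ?_)
  have h3 := Δ.brk_len (Δ.ι b)
  have h4 := Δ.one_le_len (Δ.ι b)
  rw [Δ.α_run_brk b hlt, brk_α, ← pow_succ_apply] at h3
  exact Δ.not_brk_of_lt b _ (by omega) (by omega) h3

theorem ι_ι (b : {d // Δ.Brk d}) : Δ.ι (Δ.ι b) = b := by
  have h1 := Δ.one_le_len b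
  apply Subtype.ext
  change Δ.α ((Δ.φ ^ (Δ.len (Δ.ι b) - 1)) (Δ.ι b).1) = b.1
  rw [len_ι, Δ.α_run_brk b (by omega), Δ.α_α, Nat.sub_self]
  rfl

theorem face_ι (b : {d // Δ.Brk d}) : Δ.face (Δ.ι b).1 = Δ.face (Δ.α b.1) :=
  Δ.face_α_run (Δ.not_brk_of_lt b) (by have := Δ.one_le_len b; omega)

theorem exists_nx_pow {b e : {d // Δ.Brk d}} (h : Δ.face b.1 = Δ.face e.1) :
    ∃ k : ℕ, (Δ.nx ^ k) b = e := by
  obtain ⟨k, hk⟩ := Δ.exists_pow _ _ h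
  clear h
  induction k using Nat.strong_induction_on generalizing b with
  | _ k ih =>
    rcases Nat.eq_zero_or_pos k with rfl | hk0
    · exact ⟨0, Subtype.ext hk⟩
    · have hle := Δ.len_le b hk0 (hk ▸ e.2)
      have h1 := Δ.one_le_len b
      obtain ⟨m, hm⟩ := ih (k - Δ.len b) (by omega) (b := Δ.nx b) (by
        rw [nx_val, ← pow_add_apply, Nat.sub_add_cancel hle, hk])
      exact ⟨m + 1, by rw [pow_succ, Equiv.Perm.mul_apply, hm]⟩

theorem exists_cover {b : {d // Δ.Brk d}} {d : Δ.D} (h : Δ.face b.1 = Δ.face d) :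
    ∃ e : {d // Δ.Brk d}, Δ.face e.1 = Δ.face d ∧ ∃ i < Δ.len e, (Δ.φ ^ i) e.1 = d := by
  obtain ⟨k, hk⟩ := Δ.exists_pow _ _ h
  induction k using Nat.strong_induction_on generalizing b with
  | _ k ih =>
    rcases Nat.lt_or_ge k (Δ.len b) with hlt | hge
    · exact ⟨b, h, k, hlt, hk⟩
    · have h1 := Δ.one_le_len b
      exact ih (k - Δ.len b) (by omega) (b := Δ.nx b) (by rw [nx_val, face_pow, h]) (by
        rw [nx_val, ← pow_add_apply, Nat.sub_add_cancel hge, hk])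

theorem not_pinched (hinj : ∀ i < W.length, ∀ j < W.length,
    P.elt (W.take i) = P.elt (W.take j) → i = j) {d : Δ.D} (h1 : Δ.face (Δ.α d) = none)
    (h2 : Δ.face (Δ.α (Δ.φ d)) = none) : ¬ Δ.Brk (Δ.φ d) := by
  have h3 : Δ.φ (Δ.α (Δ.φ d)) = Δ.α d :=
    Δ.pos_inj hinj (by rw [Δ.face_φ, h2]) h1 (by rw [Δ.pos_σ, Δ.pos_α])
  intro h
  apply h
  change Δ.φ (Δ.α (Δ.φ (Δ.α (Δ.φ d)))) = _
  rw [h3, Δ.α_α]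

end Disc

theorem Disc.exists_bmap {S : Type} {P : C6Presentation S} {W : Word S} (Δ : Disc P W)
    (h3 : 3 ≤ W.length) (hinj : ∀ i < W.length, ∀ j < W.length,
      P.elt (W.take i) = P.elt (W.take j) → i = j) (hW : P.elt W = 1)
    {C : Finset ℕ} (hC : C.card ≤ 6) (h0 : 0 ∈ C)
    (hwin : ∀ j k, j + k ≤ W.length → (∀ i, j ≤ i → i < j + k → i ∉ C) →
      dst P (P.elt (W.take j)) (P.elt (W.take (j + k))) = k)
    {K A₀ A₁ L : ℕ} (hL : L < W.length)
    (hgeo : ∀ i j, i ≤ j → j ≤ L → dst P (P.elt (W.take i)) (P.elt (W.take j)) = j - i)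
    (hK : ∀ a ≤ L, ∀ b ≤ L, ∀ r ∈ P.rels, ∀ p, p <+: r →
      P.elt (W.take a) * P.elt p = P.elt (W.take b) → a ≤ b + K)
    (hfar : ∀ a b, A₀ ≤ a → a ≤ A₁ → b < W.length → (b = 0 ∨ L ≤ b) →
      2 * K < dst P (P.elt (W.take a)) (P.elt (W.take b))) :
    Nonempty (BMap K A₀ A₁ L) := by
  classical
  have hbrk : ∀ d, Δ.face d = none → Δ.idx d + K + 1 ≤ L → ∃ k, 1 ≤ k ∧ k ≤ K ∧
      Δ.Brk ((Δ.φ ^ k) d) := by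
    intro d hd hle
    by_contra hcon
    push Not at hcon
    have := Δ.run_le hL hinj hW h3 hK (d := d) (k := K + 1)
      (fun i h1 h2 => hcon i h1 (by omega)) hd (by omega) (by omega)
    omega
  refine ⟨{
    B := {d // Δ.Brk d}, F := Δ.F, X := P.Grp, dist := dst P,
    σ := Δ.σ.subtypePerm Δ.brk_σ, nx := Δ.nx, ι := Δ.ι, face := fun b => Δ.face b.1, len := Δ.len,
    N := Δ.N, Clean := Δ.Clean C, pos := fun b => Δ.pos b.1, idx := fun b => Δ.idx b.1,
    dist_comm := dst_comm P, dist_triangle := dst_triangle P, ι_ι := Δ.ι_ι, σ_ι := ?σ_ι,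
    len_ι := Δ.len_ι, len_pos := Δ.one_le_len, face_nx := fun b => Δ.face_pow _ _,
    exists_pow := fun b e h => Δ.exists_nx_pow h, inner_ι := ?inner_ι, not_pinched := ?np,
    piece := ?piece, clean_len := ?clean_len, N_le := ?N_le, N_pos := Δ.N_pos,
    card_not_clean := ?cnc, count := ?count, pos_σ := fun b => Δ.pos_σ b.1,
    dist_nx := ?dist_nx, pos_inj := ?pos_inj, idx_nx := ?idx_nx, geo := ?geo,
    far := ?far, idx_nx_of_le := ?idx_nx_of_le, exists_start := ?exists_start }⟩
  case σ_ι =>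
    intro b
    apply Subtype.ext
    change Δ.φ (Δ.α (Δ.α ((Δ.φ ^ (Δ.len b - 1)) b.1))) = (Δ.φ ^ Δ.len b) b.1
    rw [Δ.α_α, ← Δ.pow_succ_apply, Nat.sub_add_cancel (Δ.one_le_len b)]
  case inner_ι =>
    intro b hb
    rw [Δ.face_ι]
    exact Δ.inner_α h3 hinj hb
  case np =>
    intro b _ h1 h2
    rw [Δ.face_ι, Δ.nx_val, ← Nat.sub_add_cancel (Δ.one_le_len b), Δ.pow_succ_apply] at h2
    refine Δ.not_pinched hinj h1 h2 ?_
    rw [← Δ.pow_succ_apply, Nat.sub_add_cancel (Δ.one_le_len b)]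
    exact Δ.brk_len b
  case piece =>
    intro b f hb h1
    rw [Δ.face_ι] at h1
    obtain ⟨g, hg⟩ := Option.ne_none_iff_exists'.1 h1
    exact Δ.run_piece (Δ.not_brk_of_lt b) (Δ.one_le_len b) hb hg
  case clean_len =>
    intro b f hf hb h1
    rw [Δ.face_ι] at h1
    exact Δ.run_clean h0 hW hwin (Δ.not_brk_of_lt b) (Δ.one_le_len b) hf hb h1
  case N_le =>
    intro f hf
    obtain ⟨d, hd⟩ := Δ.exists_face f
    have hN := Δ.N_pos f
    obtain ⟨b, hb⟩ : ∃ b : {d // Δ.Brk d}, Δ.face b.1 = some f := by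
      by_contra hcon
      push Not at hcon
      have hrun : ∀ i, 1 ≤ i → i < Δ.N f → ¬ Δ.Brk ((Δ.φ ^ i) d) := fun i _ _ h =>
        hcon ⟨_, h⟩ (by rw [Δ.face_pow, hd])
      rcases hg : Δ.face (Δ.α d) with - | g
      · have := Δ.run_clean h0 hW hwin hrun hN hf hd hg
        omega
      · have := Δ.run_piece hrun hN hd hg
        omega
    rw [← Δ.card_face]
    calc _ ≤ ((Finset.univ.filter fun b : {d // Δ.Brk d} => Δ.face b.1 = some f).biUnion
          fun b => (Finset.range (Δ.len b)).image fun i => (Δ.φ ^ i) b.1).card := by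
          refine Finset.card_le_card fun e he => ?_
          simp only [Finset.mem_filter, Finset.mem_univ, true_and] at he
          obtain ⟨e', h1, i, h2, h3⟩ := Δ.exists_cover (b := b) (hb.trans he.symm)
          simp only [Finset.mem_biUnion, Finset.mem_filter, Finset.mem_univ, true_and,
            Finset.mem_image, Finset.mem_range]
          exact ⟨e', h1.trans he, i, h2, h3⟩
      _ ≤ _ := by
          refine Finset.card_biUnion_le.trans (Finset.sum_le_sum fun b _ => ?_)
          exact Finset.card_image_le.trans (by rw [Finset.card_range])
  case cnc =>
    refine ⟨Finset.univ.filter fun f => ¬ Δ.Clean C f, le_trans ?_ hC, fun f hf => by simpa using hf⟩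
    have hex : ∀ f, ∃ d, ¬ Δ.Clean C f → Δ.face d = some f ∧ Δ.face (Δ.α d) = none ∧
        Δ.idx (Δ.α d) ∈ C := by
      intro f
      by_cases hf : Δ.Clean C f
      · obtain ⟨d, -⟩ := Δ.exists_face f
        exact ⟨d, fun h => absurd hf h⟩
      · unfold Disc.Clean at hf
        push Not at hf
        obtain ⟨d, h⟩ := hf
        exact ⟨d, fun _ => h⟩
    choose w hw using hex
    refine Finset.card_le_card_of_injOn (fun f => Δ.idx (Δ.α (w f))) ?_ ?_
    · intro f hf
      exact (hw f (by simpa using hf)).2.2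
    · intro f hf g hg h
      have h1 := hw f (by simpa using hf)
      have h2 := hw g (by simpa using hg)
      have h4 := congrArg Δ.α (Δ.idx_inj _ _ h1.2.1 h2.2.1 h)
      rw [Δ.α_α, Δ.α_α] at h4
      have h5 := h1.1
      rw [h4, h2.1] at h5
      exact (Option.some.inj h5).symm
  case count =>
    have h1 := Δ.brk_count h3 hinj
    have h2 : Fintype.card {d // Δ.Brk d} =
        (Finset.univ.filter fun d => Δ.σ (Δ.σ d) ≠ d).card :=
      Fintype.card_of_subtype _ fun d => by simp [Disc.Brk]
    have h4 : (Finset.univ.filter fun b : {d // Δ.Brk d} =>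
        Δ.σ.subtypePerm Δ.brk_σ (Δ.σ.subtypePerm Δ.brk_σ (Δ.σ.subtypePerm Δ.brk_σ b)) ≠ b).card ≤
        (Finset.univ.filter fun d => Δ.σ (Δ.σ d) ≠ d ∧ Δ.σ (Δ.σ (Δ.σ d)) ≠ d).card := by
      refine Finset.card_le_card_of_injOn Subtype.val ?_ Subtype.val_injective.injOn
      intro b hb
      simp only [Finset.coe_filter, Finset.mem_univ, true_and, Set.mem_ofPred_eq] at hb ⊢
      exact ⟨b.2, fun h => hb (Subtype.ext h)⟩
    rw [h2]
    omega
  case dist_nx =>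
    intro b
    rw [Δ.nx_val, Δ.pos_pow]
    exact (dst_mul_elt_le P _ _).trans (length_rd _ _ _ _).le
  case pos_inj =>
    intro b e hb he h
    exact Subtype.ext (Δ.pos_inj hinj hb he h)
  case idx_nx =>
    intro b f hb hf hcl
    rw [Δ.face_ι] at hf
    obtain ⟨h1, -⟩ := Δ.idx_no_wrap (k := Δ.len b) h0 hb fun t ht => by
      have h1 := hcl (Δ.α ((Δ.φ ^ t) b.1)) (by rw [Δ.face_α_run (Δ.not_brk_of_lt b) ht, hf])
      rw [Δ.α_α] at h1
      exact h1 (by rw [Δ.face_pow, hb])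
    rw [Δ.nx_val, Δ.idx_pow hb]
    rcases h1.eq_or_lt with h | h
    · left
      rw [h, Nat.mod_self]
    · right
      exact Nat.mod_eq_of_lt h
  case geo =>
    intro b e hb he h1 h2
    rw [Δ.pos_idx _ hb, Δ.pos_idx _ he]
    exact hgeo _ _ h1 h2
  case far =>
    intro b e hb he h1 h2 h4
    rw [Δ.pos_idx _ hb, Δ.pos_idx _ he]
    exact hfar _ _ h1 h2 (Δ.idx_lt _ he) h4
  case idx_nx_of_le =>
    intro b hb hle
    obtain ⟨k, hk1, hkK, hk⟩ := hbrk b.1 hb hle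
    have h1 := Δ.len_le b hk1 hk
    refine ⟨?_, h1.trans hkK⟩
    rw [Δ.nx_val, Δ.idx_pow hb, Nat.mod_eq_of_lt (by omega)]
  case exists_start =>
    intro hle
    obtain ⟨d, hd, hd'⟩ := Δ.exists_idx A₀ (by omega)
    obtain ⟨k, hk1, hkK, hk⟩ := hbrk d hd (by omega)
    refine ⟨⟨_, hk⟩, by rw [Δ.face_pow, hd], ?_⟩
    rw [Δ.idx_pow hd, Nat.mod_eq_of_lt (by omega)]
    omega

namespace BMap

variable {K A₀ A₁ L : ℕ} (M : BMap K A₀ A₁ L)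

theorem face_sum (b : M.B) (w : M.B → ℕ) :
    ∑ e ∈ Finset.univ.filter (fun e => M.face e = M.face b), w e =
      ∑ k ∈ Finset.range (Finset.univ.filter fun e => M.face e = M.face b).card,
        w ((M.nx ^ k) b) := by
  obtain ⟨-, h2, h3⟩ := perm_pow_eq_iff M.face_nx M.exists_pow b
  conv_lhs => rw [h2]
  exact Finset.sum_image h3

theorem nx_pow_card (b : M.B) :
    (M.nx ^ (Finset.univ.filter fun e => M.face e = M.face b).card) b = b :=
  ((perm_pow_eq_iff M.face_nx M.exists_pow b).1 _).2 dvd_rfl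

/-- The number of outer edges of a face. -/
def outer (f : M.F) : ℕ :=
  (Finset.univ.filter fun b => M.face b = some f ∧ M.face (M.ι b) = none).card

/-- The number of edges of a face. -/
def deg (f : M.F) : ℕ := (Finset.univ.filter fun b => M.face b = some f).card

theorem two_mul_outer_le (f : M.F) : 2 * M.outer f ≤ M.deg f := by
  have h : (Finset.univ.filter fun b => M.face b = some f ∧ M.face (M.ι b) = none).card ≤
      (Finset.univ.filter fun b => M.face b = some f ∧ M.face (M.ι b) ≠ none).card := by
    refine Finset.card_le_card_of_injOn M.nx ?_ M.nx.injective.injOn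
    intro b hb
    simp only [Finset.coe_filter, Finset.mem_univ, true_and, Set.mem_ofPred_eq] at hb ⊢
    exact ⟨(M.face_nx b).trans hb.1, M.not_pinched b (by simp [hb.1]) hb.2⟩
  have h2 := Finset.card_filter_add_card_filter_not (s := Finset.univ.filter fun b => M.face b = some f)
    (fun b => M.face (M.ι b) = none)
  rw [Finset.filter_filter, Finset.filter_filter] at h2
  change 2 * Finset.card _ ≤ Finset.card _
  simp only [ne_eq] at h
  omega

theorem sum_deg_add_outer : ∑ f, (M.deg f + M.outer f) = Fintype.card M.B := by
  have h1 : ∀ f, M.deg f + M.outer f = ∑ b, ((if M.face b = some f then 1 else 0) +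
      if M.face b = some f ∧ M.face (M.ι b) = none then 1 else 0) := by
    intro f
    rw [Finset.sum_add_distrib, ← Finset.card_filter, ← Finset.card_filter]
    rfl
  simp only [h1]
  rw [Finset.sum_comm]
  have h2 : ∀ b, ∑ f, ((if M.face b = some f then 1 else 0) +
      if M.face b = some f ∧ M.face (M.ι b) = none then 1 else 0) +
      (if M.face b = none then 1 else 0) = 1 + if M.face (M.ι b) = none then 1 else 0 := by
    intro b
    rcases hb : M.face b with _ | f
    · simp [M.inner_ι b hb]
    · by_cases h : M.face (M.ι b) = none <;> simp [h, Finset.sum_add_distrib]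
  have h3 := Finset.sum_congr (rfl : (Finset.univ : Finset M.B) = Finset.univ) fun b _ => h2 b
  have h4 : ∑ b, (if M.face (M.ι b) = none then 1 else 0) = ∑ b, if M.face b = none then 1 else 0 :=
    Equiv.sum_comp (Function.Involutive.toPerm M.ι M.ι_ι) fun b => if M.face b = none then 1 else 0
  rw [Finset.sum_add_distrib, Finset.sum_add_distrib, h4] at h3
  simpa using h3

theorem len_sum (f : M.F) (hf : M.Clean f) :
    6 * M.N f + M.deg f ≤ (M.deg f + 2 * M.outer f) * M.N f + M.outer f := by
  have h1 : ∀ b ∈ Finset.univ.filter (fun b => M.face b = some f), 6 * M.len b + 1 ≤ M.N f +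
      (if M.face (M.ι b) = none then 2 * M.N f + 1 else 0) := by
    intro b hb
    have hb := (Finset.mem_filter.1 hb).2
    split_ifs with h
    · have := M.clean_len b f hf hb h
      omega
    · have := M.piece b f hb h
      omega
  have h2 := Finset.sum_le_sum h1
  rw [Finset.sum_add_distrib, Finset.sum_add_distrib, ← Finset.mul_sum, ← Finset.sum_filter,
    Finset.filter_filter] at h2
  simp only [Finset.sum_const, smul_eq_mul] at h2
  have h3 := M.N_le f hf
  change _ + M.deg f * 1 ≤ M.deg f * M.N f + M.outer f * (2 * M.N f + 1) at h2
  nlinarith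

/-- The possible degrees of a face of nonnegative curvature. -/
theorem degrees (f : M.F) (hf : M.Clean f) : 6 ≤ M.deg f + M.outer f ∧
    (M.deg f + M.outer f = 6 →
      (M.deg f = 5 ∧ M.outer f = 1) ∨ (M.deg f = 4 ∧ M.outer f = 2)) := by
  have h1 := M.len_sum f hf
  have h2 := M.two_mul_outer_le f
  have h3 := M.N_pos f
  have h4 : 6 < M.deg f + 2 * M.outer f ∨ M.deg f ≤ M.outer f := by
    by_contra! h
    have := Nat.mul_le_mul_right (M.N f) h.1
    omega
  have h5 : M.deg f ≤ M.outer f → False := by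
    intro h
    have h6 : M.deg f = 0 := by omega
    have h7 : M.outer f = 0 := by omega
    rw [h6, h7] at h1
    omega
  have h6 := h4.resolve_right h5
  omega

/-- A face which is clean and has curvature zero. -/
def Flat (f : M.F) : Prop :=
  M.Clean f ∧ ((M.deg f = 5 ∧ M.outer f = 1) ∨ (M.deg f = 4 ∧ M.outer f = 2))

/-- A dart at a vertex of degree three lying on a flat face or on the outer face. -/
def Good (b : M.B) : Prop :=
  M.σ (M.σ (M.σ b)) = b ∧ ∀ f, M.face b = some f → M.Flat f

open Classical in
theorem card_not_good : (Finset.univ.filter fun b => ¬ M.Good b).card ≤ 420 := by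
  obtain ⟨s, hs, hclean⟩ := M.card_not_clean
  set X : Finset M.F := Finset.univ.filter fun f => ¬ M.Flat f with hX
  set b₃ := (Finset.univ.filter fun b => M.σ (M.σ (M.σ b)) ≠ b).card with hb₃
  have hsum := M.sum_deg_add_outer
  have hcount := M.count
  have h1 : ∀ f, 6 + (if f ∈ X then 1 else 0) ≤
      M.deg f + M.outer f + (if f ∈ s then 7 else 0) := by
    intro f
    by_cases hf : f ∈ s
    · simp only [hf, if_true]
      split_ifs <;> omega
    · obtain ⟨h2, h3⟩ := M.degrees f (hclean f hf)
      simp only [hf, if_false]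
      split_ifs with h4
      · have h5 : M.deg f + M.outer f ≠ 6 := fun h =>
          (Finset.mem_filter.1 h4).2 ⟨hclean f hf, h3 h⟩
        omega
      · omega
  have h2 := Finset.sum_le_sum fun f (_ : f ∈ Finset.univ) => h1 f
  rw [Finset.sum_add_distrib, Finset.sum_add_distrib, hsum] at h2
  simp only [Finset.sum_const, smul_eq_mul, Finset.sum_ite_mem, Finset.univ_inter,
    Finset.card_univ, mul_one] at h2
  have h3 : ∑ f ∈ X, M.deg f ≤ 6 * X.card := by
    have h4 : ∑ f ∈ Finset.univ.filter (fun f => ¬ ¬ M.Flat f), (M.deg f + M.outer f) =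
        (Finset.univ.filter (fun f => ¬ ¬ M.Flat f)).card * 6 := by
      rw [Finset.sum_const_nat]
      intro f hf
      have h := (not_not.1 (Finset.mem_filter.1 hf).2).2
      omega
    have h5 := Finset.sum_filter_add_sum_filter_not Finset.univ (fun f => ¬ M.Flat f)
      fun f => M.deg f + M.outer f
    have h6 := Finset.card_filter_add_card_filter_not (s := (Finset.univ : Finset M.F))
      fun f => ¬ M.Flat f
    have h7 : ∑ f ∈ X, M.deg f ≤ ∑ f ∈ X, (M.deg f + M.outer f) :=
      Finset.sum_le_sum fun f _ => Nat.le_add_right _ _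
    rw [h4, hsum] at h5
    simp only [← hX] at h5 h6
    rw [Finset.card_univ] at h6
    omega
  have h4 : (Finset.univ.filter fun b => ¬ M.Good b) ⊆
      (Finset.univ.filter fun b => M.σ (M.σ (M.σ b)) ≠ b) ∪
        X.biUnion fun f => Finset.univ.filter fun b => M.face b = some f := by
    intro b hb
    have hb := (Finset.mem_filter.1 hb).2
    by_cases h : M.σ (M.σ (M.σ b)) = b
    · have h5 : ∃ f, M.face b = some f ∧ ¬ M.Flat f := by
        by_contra! h6
        exact hb ⟨h, h6⟩
      obtain ⟨f, h6, h7⟩ := h5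
      exact Finset.mem_union_right _ (Finset.mem_biUnion.2
        ⟨f, by simp [hX, h7], by simp [h6]⟩)
    · exact Finset.mem_union_left _ (by simp [h])
  have h5 := (Finset.card_le_card h4).trans (Finset.card_union_le _ _)
  have h6 : (X.biUnion fun f => Finset.univ.filter fun b => M.face b = some f).card ≤
      ∑ f ∈ X, M.deg f := Finset.card_biUnion_le
  omega

end BMap

namespace BMap

variable {K A₀ A₁ L : ℕ} (M : BMap K A₀ A₁ L)

theorem face_sum_deg {b : M.B} {f : M.F} (hb : M.face b = some f) (w : M.B → ℕ) :
    ∑ e ∈ Finset.univ.filter (fun e => M.face e = some f), w e =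
      ∑ k ∈ Finset.range (M.deg f), w ((M.nx ^ k) b) := by
  have h := M.face_sum b w
  rw [hb] at h
  exact h

theorem pow_deg {b : M.B} {f : M.F} (hb : M.face b = some f) : (M.nx ^ M.deg f) b = b := by
  have h := M.nx_pow_card b
  rw [hb] at h
  exact h

theorem outer_eq {b : M.B} {f : M.F} (hb : M.face b = some f) :
    M.outer f = ∑ k ∈ Finset.range (M.deg f),
      if M.face (M.ι ((M.nx ^ k) b)) = none then 1 else 0 := by
  rw [← M.face_sum_deg hb fun e => if M.face (M.ι e) = none then 1 else 0, ← Finset.card_filter,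
    Finset.filter_filter]
  rfl

theorem N_le' {b : M.B} {f : M.F} (hb : M.face b = some f) (hf : M.Clean f) :
    M.N f ≤ ∑ k ∈ Finset.range (M.deg f), M.len ((M.nx ^ k) b) := by
  rw [← M.face_sum_deg hb]
  exact M.N_le f hf

theorem len_le_of_inner {b e : M.B} {f : M.F} (hb : M.face b = some f)
    (he : M.face e = M.face b) (h : M.face (M.ι e) ≠ none) : 6 * M.len e + 1 ≤ M.N f :=
  M.piece e f (he.trans hb) h

/-- The arrangement of the edges of a flat face, starting at an outer edge. -/
theorem flat_outer {b : M.B} {f : M.F} (hb : M.face b = some f) (hf : M.Flat f)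
    (h : M.face (M.ι b) = none) :
    ((M.nx (M.nx (M.nx (M.nx (M.nx b)))) = b) ∧ M.face (M.ι (M.nx b)) ≠ none ∧
      M.face (M.ι (M.nx (M.nx b))) ≠ none ∧ M.face (M.ι (M.nx (M.nx (M.nx b)))) ≠ none ∧
      M.face (M.ι (M.nx (M.nx (M.nx (M.nx b))))) ≠ none ∧
      M.N f ≤ M.len b + M.len (M.nx b) + M.len (M.nx (M.nx b)) + M.len (M.nx (M.nx (M.nx b))) +
        M.len (M.nx (M.nx (M.nx (M.nx b))))) ∨
    ((M.nx (M.nx (M.nx (M.nx b))) = b) ∧ M.face (M.ι (M.nx b)) ≠ none ∧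
      M.face (M.ι (M.nx (M.nx b))) = none ∧ M.face (M.ι (M.nx (M.nx (M.nx b)))) ≠ none ∧
      M.N f ≤ M.len b + M.len (M.nx b) + M.len (M.nx (M.nx b)) +
        M.len (M.nx (M.nx (M.nx b)))) := by
  have h1 := M.outer_eq hb
  have h2 := M.N_le' hb hf.1
  have h3 := M.pow_deg hb
  have h4 := M.not_pinched b (by simp [hb]) h
  rcases hf.2 with ⟨hd, ho⟩ | ⟨hd, ho⟩
  · left
    rw [hd] at h1 h2 h3
    rw [ho] at h1
    simp only [Finset.sum_range_succ, Finset.sum_range_zero, pow_succ, pow_zero, one_mul,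
      Equiv.Perm.mul_apply, Equiv.Perm.one_apply, h, if_true] at h1 h2 h3
    refine ⟨h3, h4, ?_, ?_, ?_, by omega⟩ <;>
    · intro h5
      simp only [h5, if_true] at h1
      omega
  · right
    rw [hd] at h1 h2 h3
    rw [ho] at h1
    simp only [Finset.sum_range_succ, Finset.sum_range_zero, pow_succ, pow_zero, one_mul,
      Equiv.Perm.mul_apply, Equiv.Perm.one_apply, h, h4, if_true, if_false] at h1 h2 h3
    have h5 : M.face (M.ι (M.nx (M.nx (M.nx b)))) ≠ none := by
      intro h6
      refine M.not_pinched (M.nx (M.nx (M.nx b))) ?_ h6 ?_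
      · simp [M.face_nx, hb]
      · rw [h3, h]
    simp only [h5, if_false] at h1
    refine ⟨h3, h4, ?_, h5, by omega⟩
    by_contra h6
    simp only [h6, if_false] at h1
    omega

/-- A flat face with four consecutive inner edges has exactly one more edge. -/
theorem flat_inner {b : M.B} {f : M.F} (hb : M.face b = some f) (hf : M.Flat f)
    (h0 : M.face (M.ι b) ≠ none) (h1 : M.face (M.ι (M.nx b)) ≠ none)
    (h2 : M.face (M.ι (M.nx (M.nx b))) ≠ none)
    (h3 : M.face (M.ι (M.nx (M.nx (M.nx b)))) ≠ none) :
    M.nx (M.nx (M.nx (M.nx (M.nx b)))) = b ∧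
      M.face (M.ι (M.nx (M.nx (M.nx (M.nx b))))) = none ∧
      M.N f ≤ M.len b + M.len (M.nx b) + M.len (M.nx (M.nx b)) + M.len (M.nx (M.nx (M.nx b))) +
        M.len (M.nx (M.nx (M.nx (M.nx b)))) := by
  have h4 := M.outer_eq hb
  have h5 := M.N_le' hb hf.1
  have h6 := M.pow_deg hb
  rcases hf.2 with ⟨hd, ho⟩ | ⟨hd, ho⟩
  · rw [hd] at h4 h5 h6
    rw [ho] at h4
    simp only [Finset.sum_range_succ, Finset.sum_range_zero, pow_succ, pow_zero, one_mul,
      Equiv.Perm.mul_apply, Equiv.Perm.one_apply, h0, h1, h2, h3, if_false] at h4 h5 h6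
    refine ⟨h6, ?_, by omega⟩
    by_contra h7
    simp only [h7, if_false] at h4
    omega
  · rw [hd] at h4
    rw [ho] at h4
    simp only [Finset.sum_range_succ, Finset.sum_range_zero, pow_succ, pow_zero, one_mul,
      Equiv.Perm.mul_apply, Equiv.Perm.one_apply, h0, h1, h2, h3, if_false] at h4
    omega

theorem geo_abs {b e : M.B} (hb : M.face b = none) (he : M.face e = none) (hbL : M.idx b ≤ L)
    (heL : M.idx e ≤ L) : M.idx e ≤ M.idx b + M.dist (M.pos b) (M.pos e) ∧
      M.idx b ≤ M.idx e + M.dist (M.pos b) (M.pos e) := by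
  rcases le_total (M.idx b) (M.idx e) with h | h
  · have := M.geo b e hb he h heL
    omega
  · have := M.geo e b he hb h hbL
    rw [M.dist_comm] at this
    omega

theorem pos_nx_ι (b : M.B) : M.pos (M.nx (M.ι b)) = M.pos b := by
  rw [← M.σ_ι, M.ι_ι, M.pos_σ]

theorem face_eq {b : M.B} (h : M.face (M.ι b) = none) : ∃ f, M.face b = some f := by
  have := M.inner_ι _ h
  rw [M.ι_ι] at this
  exact Option.ne_none_iff_exists'.1 this

/-- A good outer dart in the middle part of the geodesic. -/
def OGood (o : M.B) : Prop :=
  M.face o = none ∧ A₀ ≤ M.idx o ∧ M.idx o ≤ A₁ ∧ M.Good o ∧ M.Good (M.σ o) ∧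
    M.Good (M.nx (M.σ o)) ∧ M.Good (M.nx (M.nx (M.σ o))) ∧ M.Good (M.σ (M.nx (M.σ o)))

theorem idx_of_near {o e : M.B} (ho : M.face o = none) (he : M.face e = none) (h0 : A₀ ≤ M.idx o)
    (h1 : M.idx o ≤ A₁) (h : M.dist (M.pos o) (M.pos e) ≤ 2 * K) :
    M.idx e ≠ 0 ∧ M.idx e < L := by
  constructor
  · intro h2
    have := M.far o e ho he h0 h1 (Or.inl h2)
    omega
  · by_contra! h2
    have := M.far o e ho he h0 h1 (Or.inr h2)
    omega

/-- The face across a good outer edge has one outer edge and four short inner edges. -/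
theorem OGood.pentagon {M : BMap K A₀ A₁ L} (hA : A₁ + K + 1 ≤ L) {o : M.B} (h : M.OGood o) :
    ((M.nx (M.nx (M.nx (M.nx (M.nx (M.ι o))))) = M.ι o) ∧ M.face (M.ι (M.nx (M.ι o))) ≠ none ∧
      M.face (M.ι (M.nx (M.nx (M.ι o)))) ≠ none ∧
      M.face (M.ι (M.nx (M.nx (M.nx (M.ι o))))) ≠ none ∧
      M.face (M.ι (M.nx (M.nx (M.nx (M.nx (M.ι o)))))) ≠ none ∧
      2 * M.len (M.nx (M.ι o)) < K ∧ 2 * M.len (M.nx (M.nx (M.ι o))) < K ∧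
      2 * M.len (M.nx (M.nx (M.nx (M.ι o)))) < K) := by
  obtain ⟨ho, h0, h1, -, hσ, -⟩ := h
  have hιι := M.ι_ι o
  obtain ⟨f, hf⟩ := M.face_eq (b := M.ι o) (by rw [hιι, ho])
  obtain ⟨hnx, hK⟩ := M.idx_nx_of_le o ho (by omega)
  rw [← M.len_ι] at hK
  have hσf : M.face (M.σ o) = some f := by
    rw [← hιι, M.σ_ι, M.face_nx, hf]
  have hflat := hσ.2 f hσf
  have hN := M.N_pos f
  set x := M.ι o with hx
  have hx1 : M.face (M.nx x) = M.face x := M.face_nx x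
  have hx2 : M.face (M.nx (M.nx x)) = M.face x := (M.face_nx _).trans hx1
  have hx3 : M.face (M.nx (M.nx (M.nx x))) = M.face x := (M.face_nx _).trans hx2
  have hx4 : M.face (M.nx (M.nx (M.nx (M.nx x)))) = M.face x := (M.face_nx _).trans hx3
  rcases M.flat_outer hf hflat (by rw [hιι, ho]) with ⟨e, i1, i2, i3, i4, hle⟩ |
    ⟨e, i1, i2, i3, hle⟩
  · have l1 := M.len_le_of_inner hf hx1 i1
    have l2 := M.len_le_of_inner hf hx2 i2
    have l3 := M.len_le_of_inner hf hx3 i3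
    have l4 := M.len_le_of_inner hf hx4 i4
    exact ⟨e, i1, i2, i3, i4, by omega, by omega, by omega⟩
  · exfalso
    have l1 := M.len_le_of_inner hf hx1 i1
    have l3 := M.len_le_of_inner hf hx3 i3
    have l2 := M.clean_len _ f hflat.1 (hx2.trans hf) i2
    have p1 := M.dist_nx (M.nx x)
    have p3 := M.dist_nx (M.nx (M.nx (M.nx x)))
    have q1 : M.pos (M.nx x) = M.pos o := by rw [hx, M.pos_nx_ι]
    have q2 : M.pos (M.nx (M.ι (M.nx (M.nx x)))) = M.pos (M.nx (M.nx x)) := M.pos_nx_ι _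
    have q3 : M.pos (M.nx (M.nx (M.nx x))) = M.pos (M.ι (M.nx (M.nx x))) := by
      rw [← M.pos_nx_ι (M.ι (M.nx (M.nx x))), M.ι_ι]
    have q4 : M.pos (M.nx o) = M.pos x := by rw [← hιι, M.pos_nx_ι]
    rw [q1, ← q2] at p1
    rw [e, q3, ← q4] at p3
    have f2 : M.face (M.nx (M.ι (M.nx (M.nx x)))) = none := (M.face_nx _).trans i2
    obtain ⟨n1, n2⟩ := M.idx_of_near ho f2 h0 h1 (by omega)
    have n3 := M.idx_nx (M.ι (M.nx (M.nx x))) f i2 (by rw [M.ι_ι, hx2, hf]) hflat.1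
    rw [M.len_ι] at n3
    have hlo : M.len x = M.len o := M.len_ι o
    have n4 := n3.resolve_left n1
    have g1 := M.geo_abs ho f2 (by omega) (by omega)
    have g2 := M.geo_abs i2 ((M.face_nx o).trans ho) (by omega) (by omega)
    omega

/-- For an outer dart `o`, the edge of the second layer shared by the faces following the one
across `o`. -/
def v (o : M.B) : M.B := M.nx (M.ι (M.nx (M.nx (M.nx (M.ι o)))))

/-- The outer dart on the other side of the second layer. -/
def θ (o : M.B) : M.B := M.ι (M.nx (M.v o))

theorem σ_eq (b : M.B) : M.σ b = M.nx (M.ι b) := by rw [← M.σ_ι, M.ι_ι]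

theorem nx_ι_v {o : M.B} (h : M.OGood o) :
    M.nx (M.ι (M.v o)) = M.ι (M.nx (M.nx (M.ι o))) := by
  have h1 := h.2.2.2.2.2.2.1.1
  rw [M.σ_eq o] at h1
  rw [← M.σ_ι (M.nx (M.nx (M.ι o)))] at h1
  have h2 := M.σ.injective h1
  rw [M.σ_ι, M.σ_eq (M.nx (M.nx (M.nx (M.ι o)))), M.σ_eq] at h2
  exact h2

/-- Consecutive good outer darts. -/
structure OPair (o : M.B) : Prop where
  left : M.OGood o
  right : M.OGood (M.nx o)

variable {M}

theorem OPair.ι_side (hA : A₁ + K + 1 ≤ L) {o : M.B} (h : M.OPair o) :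
    M.ι (M.nx (M.ι (M.nx o))) = M.nx (M.nx (M.nx (M.nx (M.ι o)))) := by
  have h1 := h.right.2.2.2.1.1
  have h2 : M.nx o = M.σ (M.ι o) := (M.σ_ι o).symm
  conv_rhs at h1 => rw [h2]
  have h3 := M.σ.injective h1
  rw [M.σ_eq (M.nx o), M.σ_eq] at h3
  have h4 := (h.left.pentagon hA).1
  exact M.nx.injective (h3.trans h4.symm)

theorem OPair.nx_ι_second (hA : A₁ + K + 1 ≤ L) {o : M.B} (h : M.OPair o) :
    M.nx (M.ι (M.nx (M.nx (M.ι (M.nx o))))) = M.ι (M.nx (M.nx (M.nx (M.ι o)))) := by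
  have h1 := h.right.2.2.2.2.2.1.1
  rw [M.σ_eq (M.nx o)] at h1
  have h2 : M.nx (M.nx (M.ι (M.nx o))) = M.σ (M.nx (M.nx (M.nx (M.nx (M.ι o))))) := by
    rw [← h.ι_side hA, M.σ_ι]
  conv_rhs at h1 => rw [h2]
  have h3 := M.σ.injective h1
  rw [← M.σ_ι (M.nx (M.nx (M.nx (M.ι o))))] at h3
  have h4 := M.σ.injective h3
  rw [M.σ_eq] at h4
  exact h4

/-- The second layer: the face `f` following the faces across two consecutive good outer darts
has one outer edge, on the far side. -/
theorem OPair.second_layer (hA : A₁ + K + 1 ≤ L) {o : M.B} (h : M.OPair o) :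
    ∃ f, M.Clean f ∧ M.face (M.ι (M.θ o)) = some f ∧ M.face (M.θ o) = none ∧
      M.σ (M.θ o) = M.ι (M.v (M.nx o)) ∧ M.dist (M.pos (M.nx o)) (M.pos (M.θ o)) < 2 * K := by
  have hz := M.nx_ι_v h.right
  have hu := h.nx_ι_second hA
  obtain ⟨-, -, a2, a3, -, a5, a6, a7⟩ := h.left.pentagon hA
  obtain ⟨-, -, b2, b3, -, b5, b6, b7⟩ := h.right.pentagon hA
  have hu' : M.nx (M.ι (M.nx (M.nx (M.nx (M.ι o))))) = M.v o := rfl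
  have hσ : M.σ (M.nx (M.σ (M.nx o))) = M.nx (M.ι (M.nx (M.nx (M.ι (M.nx o))))) := by
    rw [M.σ_eq (M.nx o), M.σ_eq]
  have hface : M.face (M.ι (M.v (M.nx o))) = M.face (M.ι (M.nx (M.nx (M.ι (M.nx o))))) := by
    rw [← hz, M.face_nx]
  obtain ⟨f, hf⟩ := Option.ne_none_iff_exists'.1 (hface ▸ b2)
  have hflat : M.Flat f := by
    refine h.right.2.2.2.2.2.2.2.2 f ?_
    rw [hσ, M.face_nx, ← hface, hf]
  have c0 : M.face (M.ι (M.ι (M.v (M.nx o)))) ≠ none := by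
    rw [M.ι_ι, v, M.face_nx]
    exact b3
  have ho1 := h.left.1
  have ho2 := h.right.1
  have c1 : M.face (M.ι (M.nx (M.ι (M.v (M.nx o))))) ≠ none := by
    rw [hz, M.ι_ι, M.face_nx, M.face_nx]
    exact M.inner_ι _ ho2
  have c2 : M.face (M.ι (M.nx (M.nx (M.ι (M.v (M.nx o)))))) ≠ none := by
    rw [hz, hu, M.ι_ι, M.face_nx, M.face_nx, M.face_nx]
    exact M.inner_ι _ ho1
  have c3 : M.face (M.ι (M.nx (M.nx (M.nx (M.ι (M.v (M.nx o))))))) ≠ none := by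
    rw [hz, hu, hu', ← M.face_nx, M.nx_ι_v h.left]
    exact a2
  obtain ⟨d1, d2, d3⟩ := M.flat_inner hf hflat c0 c1 c2 c3
  have l0 := M.len_le_of_inner hf rfl c0
  have l3 := M.len_le_of_inner hf ((M.face_nx _).trans <| (M.face_nx _).trans <| M.face_nx _) c3
  have l4 := M.clean_len _ f hflat.1
    (((M.face_nx _).trans <| (M.face_nx _).trans <| (M.face_nx _).trans <| M.face_nx _).trans hf) d2
  rw [hz, hu, hu'] at d1 d2 d3 l3 l4
  rw [M.len_ι (M.nx (M.nx (M.ι (M.nx o)))), M.len_ι (M.nx (M.nx (M.nx (M.ι o))))] at d3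
  have hθ : M.ι (M.θ o) = M.nx (M.v o) := M.ι_ι _
  have hσθ : M.σ (M.θ o) = M.ι (M.v (M.nx o)) := by rw [M.σ_eq, hθ, d1]
  refine ⟨f, hflat.1, ?_, d2, hσθ, ?_⟩
  · rw [hθ, ← M.face_nx, d1, hf]
  · have e1 := M.dist_nx (M.nx (M.ι (M.nx o)))
    have e2 := M.dist_nx (M.nx (M.nx (M.ι (M.nx o))))
    have e3 := M.dist_nx (M.ι (M.v (M.nx o)))
    rw [M.pos_nx_ι] at e1
    rw [hz, ← M.pos_nx_ι (M.ι (M.nx (M.nx (M.ι (M.nx o))))), M.ι_ι, ← hσθ, M.pos_σ, M.dist_comm]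
      at e3
    rw [hσθ] at e3
    have t1 := M.dist_triangle (M.pos (M.nx o)) (M.pos (M.nx (M.nx (M.ι (M.nx o)))))
      (M.pos (M.nx (M.nx (M.nx (M.ι (M.nx o))))))
    have t2 := M.dist_triangle (M.pos (M.nx o)) (M.pos (M.nx (M.nx (M.nx (M.ι (M.nx o))))))
      (M.pos (M.θ o))
    omega

theorem OPair.near (hA : A₁ + K + 1 ≤ L) {o : M.B} (h : M.OPair o) :
    M.idx (M.θ o) ≠ 0 ∧ M.idx (M.nx o) < M.idx (M.θ o) + 2 * K ∧
      M.idx (M.θ o) < M.idx (M.nx o) + 2 * K := by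
  obtain ⟨f, -, -, h1, -, h2⟩ := h.second_layer hA
  obtain ⟨n1, n2⟩ := M.idx_of_near h.right.1 h1 h.right.2.1 h.right.2.2.1 h2.le
  have h3 := h.right.2.2.1
  have := M.geo_abs h.right.1 h1 (by omega) n2.le
  exact ⟨n1, by omega, by omega⟩

theorem OPair.idx_θ_lt (hA : A₁ + K + 1 ≤ L) {o : M.B} (h : M.OPair o) (h' : M.OPair (M.nx o)) :
    M.idx (M.θ (M.nx o)) < M.idx (M.θ o) := by
  obtain ⟨f, -, -, h1, h2, -⟩ := h.second_layer hA
  obtain ⟨f', h3, h4, h5, -, -⟩ := h'.second_layer hA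
  have h6 : M.nx (M.θ (M.nx o)) = M.θ o := by
    refine M.pos_inj _ _ ((M.face_nx _).trans h5) h1 ?_
    rw [← M.σ_ι, M.pos_σ, show M.ι (M.θ (M.nx o)) = M.nx (M.v (M.nx o)) from M.ι_ι _, ← M.σ_ι,
      M.pos_σ, ← h2, M.pos_σ]
  have h7 := M.idx_nx _ _ h5 h4 h3
  rw [h6] at h7
  have := M.len_pos (M.θ (M.nx o))
  have := (h.near hA).1
  omega

variable (M)

theorem idx_pow (hA : A₁ + K + 1 ≤ L) {o : M.B} (ho : M.face o = none) {n : ℕ}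
    (hn : M.idx o + n * K ≤ A₁) : M.face ((M.nx ^ n) o) = none ∧
      M.idx ((M.nx ^ n) o) ≤ M.idx o + n * K := by
  induction n with
  | zero => simp [ho]
  | succ n ih =>
    rw [Nat.succ_mul] at hn ⊢
    obtain ⟨h1, h2⟩ := ih (by omega)
    rw [pow_succ', Equiv.Perm.mul_apply]
    have := M.idx_nx_of_le _ h1 (by omega)
    exact ⟨(M.face_nx _).trans h1, by omega⟩

theorem idx_pow_lt (hA : A₁ + K + 1 ≤ L) {o : M.B} (ho : M.face o = none) {n m : ℕ}
    (hn : M.idx o + n * K ≤ A₁) (hm : m ≤ n) :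
    M.idx ((M.nx ^ m) o) + (n - m) ≤ M.idx ((M.nx ^ n) o) := by
  induction n, hm using Nat.le_induction with
  | base => simp
  | succ n hmn ih =>
    rw [Nat.succ_mul] at hn
    have h1 := ih (by omega)
    obtain ⟨h2, h3⟩ := M.idx_pow hA ho (n := n) (by omega)
    rw [pow_succ', Equiv.Perm.mul_apply]
    have := M.idx_nx_of_le _ h2 (by omega)
    have := M.len_pos ((M.nx ^ n) o)
    omega

/-- There is no long sequence of consecutive good outer darts. -/
theorem exists_not_ogood (hA : A₁ + K + 1 ≤ L) {o : M.B} :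
    ∃ t ≤ 2 * K + 2, ¬ M.OGood ((M.nx ^ t) o) := by
  by_contra! H
  have hp : ∀ t ≤ 2 * K + 1, M.OPair ((M.nx ^ t) o) := fun t ht => by
    refine ⟨H t (by omega), ?_⟩
    rw [← Equiv.Perm.mul_apply, ← pow_succ']
    exact H (t + 1) (by omega)
  have key : ∀ t ≤ 2 * K + 1, M.idx (M.θ ((M.nx ^ t) o)) + t ≤ M.idx (M.θ o) ∧
      M.idx (M.nx o) + t ≤ M.idx (M.nx ((M.nx ^ t) o)) := by
    intro t
    induction t with
    | zero => simp
    | succ t ih =>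
      intro ht
      obtain ⟨h1, h2⟩ := ih (by omega)
      have h3 := (hp t (by omega)).idx_θ_lt hA (by
        rw [← Equiv.Perm.mul_apply, ← pow_succ']
        exact hp (t + 1) (by omega))
      have h4 := (hp t (by omega)).right
      have h5 := M.idx_nx_of_le _ h4.1 (by have := h4.2.2.1; omega)
      have h6 := M.len_pos (M.nx ((M.nx ^ t) o))
      rw [pow_succ', Equiv.Perm.mul_apply]
      omega
  obtain ⟨h1, h2⟩ := key (2 * K + 1) le_rfl
  have h3 := (hp 0 (by omega)).near hA
  have h4 := (hp (2 * K + 1) le_rfl).near hA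
  simp only [pow_zero, Equiv.Perm.one_apply] at h3
  omega

/-- The five darts occurring in the definition of a good outer dart. -/
def probe : Fin 5 → Equiv.Perm M.B :=
  ![1, M.σ, M.nx * M.σ, M.nx * M.nx * M.σ, M.σ * M.nx * M.σ]

theorem exists_probe {o : M.B} (ho : M.face o = none) (h0 : A₀ ≤ M.idx o) (h1 : M.idx o ≤ A₁)
    (h : ¬ M.OGood o) : ∃ i, ¬ M.Good (M.probe i o) := by
  by_contra! H
  exact h ⟨ho, h0, h1, H 0, H 1, H 2, H 3, H 4⟩

/-- The length bound for the part of the geodesic which is far from the rest of the boundary. -/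
theorem bound (M : BMap K A₀ A₁ L) (hA : A₁ + K + 1 ≤ L) : A₁ < A₀ + K + 2101 * (2 * K + 3) * K := by
  classical
  by_contra! hlt
  obtain ⟨o, ho, h0, h1⟩ := M.exists_start (by omega)
  have hle : ∀ n ≤ 2101 * (2 * K + 3), M.idx o + n * K ≤ A₁ := fun n hn => by
    have := Nat.mul_le_mul_right K hn
    omega
  have hex : ∀ j : Fin 2101, ∃ t, (2 * K + 3) * j ≤ t ∧ t < (2 * K + 3) * (j + 1) ∧
      ∃ i, ¬ M.Good (M.probe i ((M.nx ^ t) o)) := by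
    intro j
    obtain ⟨t, ht, hbad⟩ := M.exists_not_ogood hA (o := (M.nx ^ ((2 * K + 3) * (j : ℕ))) o)
    rw [← Equiv.Perm.mul_apply, ← pow_add] at hbad
    have h2 : t + (2 * K + 3) * (j : ℕ) < (2 * K + 3) * (j + 1) := by
      rw [Nat.mul_succ]
      omega
    have h3 : (2 * K + 3) * ((j : ℕ) + 1) ≤ 2101 * (2 * K + 3) := by
      rw [mul_comm]
      exact Nat.mul_le_mul_right _ j.2
    refine ⟨_, Nat.le_add_left _ t, h2, ?_⟩
    have h4 := hle _ (h2.le.trans h3)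
    have h5 := M.idx_pow hA ho h4
    have h6 := M.idx_pow_lt hA ho h4 (Nat.zero_le _)
    simp only [pow_zero, Equiv.Perm.one_apply] at h6
    rw [add_comm t] at h4 h5 h6 hbad ⊢
    exact M.exists_probe h5.1 (by omega) (by omega) hbad
  choose t ht1 ht2 i hi using hex
  have htle : ∀ j, t j ≤ 2101 * (2 * K + 3) := fun j => by
    refine (ht2 j).le.trans ?_
    rw [mul_comm]
    exact Nat.mul_le_mul_right _ j.2
  have hcard := Finset.card_le_card_of_injOn (s := (Finset.univ : Finset (Fin 2101)))
    (t := (Finset.univ : Finset (Fin 5)) ×ˢ Finset.univ.filter fun b => ¬ M.Good b)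
    (fun j => (i j, M.probe (i j) ((M.nx ^ t j) o))) (fun j _ => by simpa using hi j) (by
      intro j _ k _ hjk
      simp only [Prod.mk.injEq] at hjk
      obtain ⟨h2, h3⟩ := hjk
      rw [h2] at h3
      have h4 := (M.probe (i k)).injective h3
      have key : ∀ j k, t j < t k → (M.nx ^ t j) o ≠ (M.nx ^ t k) o := fun j k hlt h => by
        have := M.idx_pow_lt hA ho (hle _ (htle k)) hlt.le
        rw [h] at this
        omega
      have h5 : t j = t k := by
        rcases lt_trichotomy (t j) (t k) with h | h | h
        · exact absurd h4 (key _ _ h)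
        · exact h
        · exact absurd h4.symm (key _ _ h)
      have key2 : ∀ j k : Fin 2101, t j = t k → ¬ j < k := fun j k h hlt => by
        have h6 := Nat.mul_le_mul_left (2 * K + 3) (show (j : ℕ) + 1 ≤ k from hlt)
        have := ht2 j
        have := ht1 k
        omega
      exact le_antisymm (not_lt.1 (key2 _ _ h5.symm)) (not_lt.1 (key2 _ _ h5)))
  rw [Finset.card_product, Finset.card_univ, Finset.card_univ, Fintype.card_fin,
    Fintype.card_fin] at hcard
  have := M.card_not_good
  omega

end BMap

section

variable {S : Type} (P : C6Presentation S)

/-- The point `z` lies on the path labelled `w` starting at `x`. -/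
def OnPath (x : P.Grp) (w : Word S) (z : P.Grp) : Prop :=
  ∃ i ≤ w.length, z = x * P.elt (w.take i)

theorem OnPath.append_iff {x z : P.Grp} {v w : Word S} :
    OnPath P x (v ++ w) z ↔ OnPath P x v z ∨ OnPath P (x * P.elt v) w z := by
  constructor
  · rintro ⟨i, hi, rfl⟩
    rcases le_total i v.length with h | h
    · exact Or.inl ⟨i, h, by rw [List.take_append_of_le_length h]⟩
    · refine Or.inr ⟨i - v.length, by simp at hi; omega, ?_⟩
      rw [List.take_append, List.take_of_length_le h, elt_append, mul_assoc]
  · rintro (⟨i, hi, rfl⟩ | ⟨i, hi, rfl⟩)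
    · exact ⟨i, by simp; omega, by rw [List.take_append_of_le_length hi]⟩
    · refine ⟨v.length + i, by simp; omega, ?_⟩
      rw [List.take_length_add_append, elt_append, mul_assoc]

theorem geo_dst_take {w : Word S} (h : Geo P w) {i j : ℕ} (hij : i ≤ j) (hj : j ≤ w.length) :
    dst P (P.elt (w.take i)) (P.elt (w.take j)) = j - i := by
  have h1 : w.take j = w.take i ++ (w.take j).drop i := by
    conv_lhs => rw [← List.take_append_drop i (w.take j), List.take_take, min_eq_left hij]
  have h2 : Geo P ((w.take j).drop i) :=
    h.subword P ((List.drop_suffix _ _).isInfix.trans (List.take_prefix _ _).isInfix)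
  conv_lhs => rw [h1, elt_append]
  rw [h2.dst P]
  simp
  omega

theorem geo_take_injective {w : Word S} (h : Geo P w) {i j : ℕ} (hi : i ≤ w.length)
    (hj : j ≤ w.length) (hij : P.elt (w.take i) = P.elt (w.take j)) : i = j := by
  rcases le_total i j with h1 | h1
  · have := geo_dst_take P h h1 hj
    rw [hij, dst_self] at this
    omega
  · have := geo_dst_take P h h1 hi
    rw [hij, dst_self] at this
    omega

theorem exists_drop {ws : List (Word S)} (h : ∀ w ∈ ws, Geo P w) (i : ℕ) :
    ∃ ws' : List (Word S), ws'.length = ws.length ∧ (∀ w ∈ ws', Geo P w) ∧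
      ws'.flatten = ws.flatten.drop i := by
  induction ws generalizing i with
  | nil => exact ⟨[], rfl, by simp, by simp⟩
  | cons w ws ih =>
    obtain ⟨ws', h1, h2, h3⟩ := ih (fun w hw => h w (by simp [hw])) (i - w.length)
    refine ⟨w.drop i :: ws', by simp [h1], ?_, ?_⟩
    · intro v hv
      rcases List.mem_cons.1 hv with rfl | hv
      · exact (h w (by simp)).subword P (List.drop_suffix _ _).isInfix
      · exact h2 v hv
    · rw [List.flatten_cons, List.flatten_cons, List.drop_append, h3]

/-- Loop erasure in a piecewise geodesic path. -/
theorem exists_erase {ws : List (Word S)} (h : ∀ w ∈ ws, Geo P w) :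
    ∃ ws' : List (Word S), ws'.length = ws.length ∧ (∀ w ∈ ws', Geo P w) ∧
      P.elt ws'.flatten = P.elt ws.flatten ∧
      (∀ x z, OnPath P x ws'.flatten z → OnPath P x ws.flatten z) ∧
      ∀ i ≤ ws'.flatten.length, ∀ j ≤ ws'.flatten.length,
        P.elt (ws'.flatten.take i) = P.elt (ws'.flatten.take j) → i = j := by
  classical
  induction ws with
  | nil => exact ⟨[], rfl, by simp, rfl, by simp, by simp⟩
  | cons w ws ih =>
    obtain ⟨ws', h1, h2, h3, h4, h5⟩ := ih fun w hw => h w (by simp [hw])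
    have hw : Geo P w := h w (by simp)
    have hex : ∃ j, j ≤ w.length ∧ OnPath P (P.elt w) ws'.flatten (P.elt (w.take j)) :=
      ⟨w.length, le_rfl, 0, Nat.zero_le _, by simp [C6Presentation.elt]⟩
    set j := Nat.find hex with hj
    obtain ⟨hjw, i, hi, hji⟩ := Nat.find_spec hex
    rw [← hj] at hjw hji
    have hlt : ∀ k < j, ¬ OnPath P (P.elt w) ws'.flatten (P.elt (w.take k)) := fun k hk hon =>
      Nat.find_min hex hk ⟨by omega, hon⟩
    obtain ⟨vs, e1, e2, e3⟩ := exists_drop P h2 i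
    have hsuf : ∀ m, P.elt (w.take j) * P.elt ((ws'.flatten.drop i).take m) =
        P.elt w * P.elt (ws'.flatten.take (i + m)) := by
      intro m
      rw [hji, mul_assoc, ← elt_append, List.take_add]
    have hsub : ∀ x z, OnPath P x (w.take j :: vs).flatten z → OnPath P x (w :: ws').flatten z := by
      intro x z hz
      rw [List.flatten_cons, OnPath.append_iff] at hz ⊢
      rcases hz with ⟨k, hk, rfl⟩ | ⟨k, hk, rfl⟩
      · left
        rw [List.length_take] at hk
        refine ⟨k, by omega, ?_⟩
        rw [List.take_take, min_eq_left (by omega)]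
      · right
        rw [e3, List.length_drop] at hk
        exact ⟨i + k, by omega, by rw [mul_assoc, e3, hsuf, mul_assoc]⟩
    refine ⟨w.take j :: vs, by simp [e1, h1], ?_, ?_, ?_, ?_⟩
    · intro v hv
      rcases List.mem_cons.1 hv with rfl | hv
      · exact hw.subword P (List.take_prefix _ _).isInfix
      · exact e2 v hv
    · rw [List.flatten_cons, List.flatten_cons, elt_append, elt_append, ← h3, e3]
      have := hsuf (ws'.flatten.length - i)
      rwa [List.take_of_length_le (l := List.drop i ws'.flatten) (by rw [List.length_drop]),
        List.take_of_length_le (l := ws'.flatten) (by omega)] at this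
    · intro x z hz
      have h6 := hsub x z hz
      rw [List.flatten_cons, OnPath.append_iff] at h6 ⊢
      exact h6.imp_right (h4 _ _)
    · have hpt : ∀ k ≤ (w.take j :: vs).flatten.length, (k < j ∧
          P.elt ((w.take j :: vs).flatten.take k) = P.elt (w.take k)) ∨
          (j ≤ k ∧ i + (k - j) ≤ ws'.flatten.length ∧ P.elt ((w.take j :: vs).flatten.take k) =
            P.elt w * P.elt (ws'.flatten.take (i + (k - j)))) := by
        intro k hk
        rw [List.flatten_cons, e3] at hk ⊢
        rw [List.length_append, List.length_take, min_eq_left hjw, List.length_drop] at hk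
        rcases lt_or_ge k j with hkj | hkj
        · left
          refine ⟨hkj, ?_⟩
          rw [List.take_append_of_le_length (by simp; omega), List.take_take,
            min_eq_left hkj.le]
        · right
          refine ⟨hkj, by omega, ?_⟩
          rw [List.take_append, List.take_of_length_le (by simp; omega), elt_append, ← hsuf,
            List.length_take, min_eq_left hjw]
      intro k hk l hl hkl
      rcases hpt k hk with ⟨a1, a2⟩ | ⟨a1, a2, a3⟩ <;> rcases hpt l hl with ⟨b1, b2⟩ | ⟨b1, b2, b3⟩
      · exact geo_take_injective P hw (by omega) (by omega) (by rw [← a2, hkl, b2])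
      · exact absurd ⟨_, b2, by rw [← a2, hkl, b3]⟩ (hlt k a1)
      · exact absurd ⟨_, a2, by rw [← b2, ← hkl, a3]⟩ (hlt l b1)
      · rw [hkl, b3] at a3
        have := h5 _ b2 _ a2 (mul_left_cancel a3)
        omega

/-- The corners of a piecewise geodesic path. -/
theorem exists_corners {ws : List (Word S)} (h : ∀ w ∈ ws, Geo P w) :
    ∃ C : Finset ℕ, C.card ≤ ws.length ∧ (ws ≠ [] → 0 ∈ C) ∧
      ∀ j k, j + k ≤ ws.flatten.length → (∀ i, j ≤ i → i < j + k → i ∉ C) →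
        Geo P ((ws.flatten.drop j).take k) := by
  have hnil : Geo P [] := Nat.le_zero.1 (wordLength_elt_le P [])
  induction ws with
  | nil => exact ⟨∅, by simp, by simp, fun j k _ _ => by simpa using hnil⟩
  | cons w ws ih =>
    obtain ⟨C, h1, h2, h3⟩ := ih fun w hw => h w (by simp [hw])
    refine ⟨insert 0 (C.map (addRightEmbedding w.length)), ?_, by simp, ?_⟩
    · refine (Finset.card_insert_le _ _).trans ?_
      rw [Finset.card_map, List.length_cons]
      omega
    · intro j k hjk hC
      rw [List.flatten_cons] at hjk ⊢
      rw [List.length_append] at hjk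
      rcases le_or_gt w.length j with hj | hj
      · rw [List.drop_append, List.drop_of_length_le hj, List.nil_append]
        refine h3 _ _ (by omega) fun i hi1 hi2 hi => ?_
        refine hC (i + w.length) (by omega) (by omega) (Finset.mem_insert_of_mem ?_)
        exact Finset.mem_map_of_mem (addRightEmbedding w.length) hi
      · have hle : j + k ≤ w.length := by
          by_contra! hlt
          have hne : ws ≠ [] := by
            rintro rfl
            simp at hjk
            omega
          have h4 := Finset.mem_map_of_mem (addRightEmbedding w.length) (h2 hne)
          simp only [addRightEmbedding_apply, zero_add] at h4
          exact hC w.length hj.le hlt (Finset.mem_insert_of_mem h4)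
        rw [List.drop_append_of_le_length hj.le, List.take_append_of_le_length (by simp; omega)]
        exact (h w (by simp)).subword P
          ((List.take_prefix _ _).isInfix.trans (List.drop_suffix _ _).isInfix)

/-- A side of a geodesic hexagon along which relators have bounded overlap cannot have a long
subsegment far from the other sides. -/
theorem hexagon_bound {v : Word S} {ws : List (Word S)} (hv : Geo P v)
    (h : ∀ w ∈ ws, Geo P w) (hlen : ws.length ≤ 5) (h1 : P.elt v * P.elt ws.flatten = 1)
    {K A₀ A₁ : ℕ} (hK1 : 1 ≤ K) (hA : A₁ + K + 1 ≤ v.length)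
    (hK : ∀ a ≤ v.length, ∀ b ≤ v.length, ∀ r ∈ P.rels, ∀ p, p <+: r →
      P.elt (v.take a) * P.elt p = P.elt (v.take b) → a ≤ b + K)
    (hmeet : ∀ a ≤ v.length, OnPath P (P.elt v) ws.flatten (P.elt (v.take a)) →
      a = 0 ∨ a = v.length)
    (hfar : ∀ a z, A₀ ≤ a → a ≤ A₁ → OnPath P (P.elt v) ws.flatten z →
      2 * K < dst P (P.elt (v.take a)) z) :
    A₁ < A₀ + K + 2101 * (2 * K + 3) * K := by
  obtain ⟨us, e1, e2, e3, e4, e5⟩ := exists_erase P h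
  have hlen' : us.length ≤ 5 := e1 ▸ hlen
  replace h1 : P.elt v * P.elt us.flatten = 1 := by rw [e3, h1]
  replace hmeet := fun a ha hz => hmeet a ha (e4 _ _ hz)
  replace hfar := fun a z h0 h1 hz => hfar a z h0 h1 (e4 _ _ hz)
  obtain ⟨C, c1, c2, c3⟩ := exists_corners P (ws := v :: us) (by
    intro w hw
    rcases List.mem_cons.1 hw with rfl | hw
    · exact hv
    · exact e2 w hw)
  rw [List.flatten_cons] at c3
  rw [List.length_cons] at c1
  by_contra! hlt
  generalize us.flatten = u at h1 hmeet hfar e5 c3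
  have hvlen : 2 ≤ v.length := by omega
  have hu : 0 < u.length := by
    rw [List.length_pos_iff]
    rintro rfl
    have h2 : P.elt v = 1 := by simpa [C6Presentation.elt] using h1
    have h3 := hv.dst P 1
    rw [one_mul, h2, dst_self] at h3
    omega
  set W := v ++ u with hW
  have hWlen : W.length = v.length + u.length := List.length_append
  have ht1 : ∀ i ≤ v.length, W.take i = v.take i := fun i hi =>
    List.take_append_of_le_length hi
  have ht2 : ∀ i, v.length ≤ i → P.elt (W.take i) = P.elt v * P.elt (u.take (i - v.length)) := by
    intro i hi
    rw [hW, List.take_append, List.take_of_length_le hi, elt_append]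
  have hW1 : P.elt W = 1 := by rw [hW, elt_append, h1]
  have hmeet' : ∀ i < v.length, ∀ j, v.length ≤ j → j < W.length →
      P.elt (W.take i) ≠ P.elt (W.take j) := by
    intro i hi j hj hjW hij
    rw [ht1 i hi.le, ht2 j hj] at hij
    rcases hmeet i hi.le ⟨j - v.length, by omega, hij⟩ with rfl | h2
    · have h3 := e5 (j - v.length) (by omega) u.length le_rfl (by
        apply mul_left_cancel (a := P.elt v)
        rw [List.take_length, h1, ← hij]
        rfl)
      omega
    · omega
  have hinj : ∀ i < W.length, ∀ j < W.length,
      P.elt (W.take i) = P.elt (W.take j) → i = j := by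
    intro i hi j hj hij
    rcases lt_or_ge i v.length with hiv | hiv <;> rcases lt_or_ge j v.length with hjv | hjv
    · rw [ht1 i hiv.le, ht1 j hjv.le] at hij
      exact geo_take_injective P hv hiv.le hjv.le hij
    · exact absurd hij (hmeet' i hiv j hjv hj)
    · exact absurd hij.symm (hmeet' j hjv i hiv hi)
    · rw [ht2 i hiv, ht2 j hjv] at hij
      have := e5 _ (by omega) _ (by omega) (mul_left_cancel hij)
      omega
  have hne : v ≠ [] := by
    rintro rfl
    simp at hvlen
  obtain ⟨k, ⟨Δ⟩, hmin⟩ := exists_minimal_dia (v.head hne).1 hW1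
  obtain ⟨Δ⟩ := Δ.exists_disc hmin (by omega)
  obtain ⟨M⟩ := Δ.exists_bmap (by omega) hinj hW1 (by omega : C.card ≤ 6) (c2 (by simp))
    (fun j k hjk hC => by
      have h2 := (c3 j k hjk hC).dst P (P.elt (W.take j))
      rw [← elt_append, ← List.take_add, List.length_take, List.length_drop] at h2
      rw [h2]
      omega)
    (K := K) (A₀ := A₀) (A₁ := A₁) (L := v.length) (by omega)
    (fun i j hij hj => by
      rw [ht1 i (hij.trans hj), ht1 j hj]
      exact geo_dst_take P hv hij hj)
    (fun a ha b hb r hr p hp hab => by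
      rw [ht1 a ha, ht1 b hb] at hab
      exact hK a ha b hb r hr p hp hab)
    (fun a b h0 ha hb hb' => by
      rw [ht1 a (by omega)]
      refine hfar a _ h0 ha ?_
      rcases hb' with rfl | hb'
      · refine ⟨u.length, le_rfl, ?_⟩
        rw [List.take_length, h1]
        rfl
      · exact ⟨b - v.length, by omega, ht2 b hb'⟩)
  exact absurd (M.bound hA) (by omega)

end

section

variable {S : Type} (P : C6Presentation S)

theorem OnPath.mul_left {b x z : P.Grp} {w : Word S} (h : OnPath P x w z) :
    OnPath P (b * x) w (b * z) := by
  obtain ⟨i, hi, rfl⟩ := h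
  exact ⟨i, hi, (mul_assoc _ _ _).symm⟩

theorem Geo.dst_add {x z : P.Grp} {w : Word S} (hw : Geo P w) (h : OnPath P x w z) :
    GSC.dst P x z + GSC.dst P z (x * P.elt w) = GSC.dst P x (x * P.elt w) := by
  obtain ⟨i, hi, rfl⟩ := h
  have h1 : Geo P (w.take i) := hw.subword P (List.take_prefix _ _).isInfix
  have h2 : Geo P (w.drop i) := hw.subword P (List.drop_suffix _ _).isInfix
  have h3 := h2.dst P (x * P.elt (w.take i))
  rw [mul_assoc, ← elt_append, List.take_append_drop] at h3
  rw [h3, h1.dst P, hw.dst P]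
  simp
  omega

theorem exists_geo_between (x y : P.Grp) : ∃ w, Geo P w ∧ x * P.elt w = y := by
  obtain ⟨w, h1, h2⟩ := exists_geo P (x⁻¹ * y)
  exact ⟨w, h2, by rw [h1, mul_inv_cancel_left]⟩

/-- The labels of subsegments of a bi-infinite geodesic. -/
theorem exists_word_along {γ : ℤ → P.Grp} (hγ : ∀ m n, (dst P (γ m) (γ n) : ℤ) = |m - n|) (m : ℤ)
    (l : ℕ) : ∃ w, Geo P w ∧ w.length = l ∧ ∀ i ≤ l, γ m * P.elt (w.take i) = γ (m + i) := by
  have key : ∃ w : Word S, w.length = l ∧ ∀ i ≤ l, γ m * P.elt (w.take i) = γ (m + i) := by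
    induction l with
    | zero =>
      refine ⟨[], rfl, fun i hi => ?_⟩
      rw [Nat.le_zero.1 hi]
      simp [C6Presentation.elt]
    | succ l ih =>
      obtain ⟨w, h1, h2⟩ := ih
      obtain ⟨u, h3, h4⟩ := exists_geo_between P (γ (m + l)) (γ (m + l + 1))
      have h5 := h3.dst P (γ (m + l))
      have h6 := hγ (m + l) (m + l + 1)
      rw [h4] at h5
      rw [h5, show m + (l : ℤ) - (m + l + 1) = -1 by ring] at h6
      refine ⟨w ++ u, by simp at h6 ⊢; omega, fun i hi => ?_⟩
      rcases Nat.le_succ_iff.1 hi with hi | rfl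
      · rw [List.take_append_of_le_length (by omega), h2 i hi]
      · rw [List.take_of_length_le (by simp at h6 ⊢; omega), elt_append, ← mul_assoc]
        have h7 := h2 l le_rfl
        rw [List.take_of_length_le (by omega)] at h7
        rw [h7, h4]
        push_cast
        rw [add_assoc]
  obtain ⟨w, h1, h2⟩ := key
  refine ⟨w, ?_, h1, h2⟩
  have h3 := h2 l le_rfl
  rw [List.take_of_length_le h1.le] at h3
  have h4 := hγ m (m + l)
  rw [← h3, show m - (m + (l : ℤ)) = -l by ring, abs_neg, Nat.abs_cast] at h4
  unfold GSC.dst at h4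
  rw [inv_mul_cancel_left] at h4
  unfold Geo
  omega

/-- `y` is a closest point to `x` in `Y`. -/
def Closest (Y : Set P.Grp) (x y : P.Grp) : Prop := y ∈ Y ∧ ∀ y' ∈ Y, dst P x y ≤ dst P x y'

variable {P}

theorem Closest.near {Y : Set P.Grp} {x y a z q : P.Grp} (h : Closest P Y x y) {ε B : ℕ}
    (ha : dst P y a ≤ ε) (hz : ∃ y' ∈ Y, dst P z y' ≤ ε)
    (hq : dst P x q + dst P q a = dst P x a) (hzq : dst P z q ≤ B) :
    dst P z a ≤ 2 * B + 2 * ε := by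
  obtain ⟨y', hy', hz⟩ := hz
  have h1 := h.2 y' hy'
  have h2 := dst_triangle P x z y'
  have h3 := dst_triangle P x q z
  have h4 := dst_triangle P x y a
  have h5 := dst_triangle P z q a
  rw [dst_comm P q z] at h3
  omega

/-- A geodesic between two points with distant projections passes close to the projections. -/
theorem exists_between_near {γ : ℤ → P.Grp} (hγ : ∀ m n, (dst P (γ m) (γ n) : ℤ) = |m - n|)
    {K ε : ℕ} (hK1 : 1 ≤ K) (hK : ∀ a b, ∀ r ∈ P.rels, ∀ p, p <+: r → γ a * P.elt p = γ b →
      a ≤ b + K) {Y : Set P.Grp} (hY : ∀ n, ∃ y ∈ Y, dst P (γ n) y ≤ ε) :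
    ∃ D : ℕ, ∀ x x' y y' s t, Closest P Y x y → Closest P Y x' y' → dst P y (γ s) ≤ ε →
      dst P y' (γ t) ≤ ε → s ≤ t → D < t - s →
      ∃ z, dst P x z + dst P z x' = dst P x x' ∧ dst P z y ≤ D := by
  obtain ⟨l, hl⟩ : ∃ l, l = (2 * K + 1) + K + 2101 * (2 * K + 3) * K + (2 * K + 1) := ⟨_, rfl⟩
  obtain ⟨c₀, hc₀⟩ : ∃ c₀, c₀ = 4 * K + 2 * ε + 1 := ⟨_, rfl⟩
  refine ⟨2 * c₀ + l, fun x x' y y' s t hy hy' hs ht hst hD => ?_⟩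
  by_contra! H
  obtain ⟨v, hv, hvl, hvγ⟩ := exists_word_along P hγ (s + c₀) l
  obtain ⟨e, he⟩ : ∃ e : ℕ, s + c₀ + l + e = t := ⟨(t - (s + c₀ + l)).toNat, by omega⟩
  obtain ⟨u₁, hu₁, hu₁l, hu₁γ⟩ := exists_word_along P hγ (s + c₀ + l) e
  obtain ⟨u₂, hu₂, hu₂e⟩ := exists_geo_between P (γ t) x'
  obtain ⟨u₃, hu₃, hu₃e⟩ := exists_geo_between P x' x
  obtain ⟨u₄, hu₄, hu₄e⟩ := exists_geo_between P x (γ s)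
  obtain ⟨u₅, hu₅, hu₅l, hu₅γ⟩ := exists_word_along P hγ s c₀
  have hend : ∀ {w : Word S} {m : ℤ} {k : ℕ}, w.length = k →
      (∀ i ≤ k, γ m * P.elt (w.take i) = γ (m + i)) → γ m * P.elt w = γ (m + k) := by
    intro w m k h1 h2
    have := h2 k le_rfl
    rwa [List.take_of_length_le h1.le] at this
  have hve := hend hvl hvγ
  have hu₁e := hend hu₁l hu₁γ
  have hu₅e := hend hu₅l hu₅γ
  rw [he] at hu₁e
  have hrest : ∀ z, OnPath P (P.elt v) [u₁, u₂, u₃, u₄, u₅].flatten z →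
      (∃ n, s + c₀ + l ≤ n ∧ γ (s + c₀) * z = γ n) ∨ (∃ n, n ≤ s + c₀ ∧ γ (s + c₀) * z = γ n) ∨
      ∀ m, s + c₀ ≤ m → m ≤ s + c₀ + l → 2 * K < dst P (γ m) (γ (s + c₀) * z) := by
    intro z hz
    replace hz := hz.mul_left P (b := γ (s + c₀))
    generalize γ (s + c₀) * z = z at hz ⊢
    rw [hve] at hz
    simp only [List.flatten_cons, List.flatten_nil, List.append_nil, OnPath.append_iff, hu₁e, hu₂e,
      hu₃e, hu₄e] at hz
    rcases hz with hz | hz | hz | hz | hz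
    · left
      obtain ⟨i, hi, rfl⟩ := hz
      exact ⟨s + c₀ + l + i, by omega, hu₁γ i (by omega)⟩
    · right; right
      intro m hm1 hm2
      by_contra! hle
      have h1 := hu₂.dst_add P hz
      rw [hu₂e, dst_comm P _ x', dst_comm P _ x', dst_comm P _ z] at h1
      have h2 := hy'.near ht (hY m) (by omega) hle
      have h3 := hγ m t
      rw [abs_sub_comm, abs_of_nonneg (by omega)] at h3
      omega
    · right; right
      intro m hm1 hm2
      by_contra! hle
      have h1 := hu₃.dst_add P hz
      rw [hu₃e, dst_comm P _ x, dst_comm P _ x, dst_comm P _ z] at h1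
      have h2 := H z (by omega)
      have h3 := hγ m s
      rw [abs_of_nonneg (by omega)] at h3
      have h4 := dst_triangle P z (γ m) y
      have h5 := dst_triangle P (γ m) (γ s) y
      have h6 := dst_comm P z (γ m)
      have h7 := dst_comm P (γ s) y
      omega
    · right; right
      intro m hm1 hm2
      by_contra! hle
      have h1 := hu₄.dst_add P hz
      rw [hu₄e] at h1
      have h2 := hy.near hs (hY m) h1 hle
      have h3 := hγ m s
      rw [abs_of_nonneg (by omega)] at h3
      omega
    · right; left
      obtain ⟨i, hi, rfl⟩ := hz
      exact ⟨s + i, by omega, hu₅γ i (by omega)⟩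
  have hinj : ∀ m n, γ m = γ n → m = n := by
    intro m n h
    have h1 := hγ m n
    rw [h, dst_self] at h1
    have := abs_eq_zero.1 h1.symm
    omega
  have hbound := hexagon_bound P (v := v) (ws := [u₁, u₂, u₃, u₄, u₅]) hv (by simp [*]) (by simp)
    (K := K) (A₀ := 2 * K + 1) (A₁ := l - (2 * K + 1)) ?_ hK1 (by omega) ?_ ?_ ?_
  · omega
  · apply mul_left_cancel (a := γ (s + c₀))
    simp only [List.flatten_cons, List.flatten_nil, List.append_nil, elt_append, ← mul_assoc, hve,
      hu₁e, hu₂e, hu₃e, hu₄e, hu₅e, mul_one]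
  · intro a ha b hb r hr p hp hab
    have h1 := hK (s + c₀ + a) (s + c₀ + b) r hr p hp (by
      rw [← hvγ a (by omega), ← hvγ b (by omega), mul_assoc, hab])
    omega
  · intro a ha hz
    rcases hrest _ hz with ⟨n, hn, h1⟩ | ⟨n, hn, h1⟩ | h1
    · rw [hvγ a (by omega)] at h1
      have := hinj _ _ h1
      omega
    · rw [hvγ a (by omega)] at h1
      have := hinj _ _ h1
      omega
    · have h2 := h1 (s + c₀ + a) (by omega) (by omega)
      rw [hvγ a (by omega), dst_self] at h2
      omega
  · intro a z h0 h1 hz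
    rw [← dst_mul_left P (γ (s + c₀)), hvγ a (by omega)]
    rcases hrest z hz with ⟨n, hn, h2⟩ | ⟨n, hn, h2⟩ | h2
    · rw [h2]
      have h3 := hγ (s + c₀ + a) n
      rw [abs_sub_comm, abs_of_nonneg (by omega)] at h3
      omega
    · rw [h2]
      have h3 := hγ (s + c₀ + a) n
      rw [abs_of_nonneg (by omega)] at h3
      omega
    · exact h2 _ (by omega) (by omega)

/-- A set close to a bi-infinite geodesic with bounded relator overlaps has strongly contracting
closest point projection. -/
theorem exists_contraction {γ : ℤ → P.Grp} (hγ : ∀ m n, (dst P (γ m) (γ n) : ℤ) = |m - n|)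
    {K ε : ℕ} (hK : ∀ a b, ∀ r ∈ P.rels, ∀ p, p <+: r → γ a * P.elt p = γ b → |a - b| ≤ K)
    {Y : Set P.Grp} (hY : ∀ n, ∃ y ∈ Y, dst P (γ n) y ≤ ε)
    (hY' : ∀ y ∈ Y, ∃ n, dst P y (γ n) ≤ ε) :
    ∃ D : ℕ, ∀ x x' y y', Closest P Y x y → Closest P Y x' y' → dst P x x' ≤ dst P x y →
      dst P y y' ≤ D := by
  obtain ⟨D₁, h₁⟩ := exists_between_near (K := K + 1) hγ (by omega)
    (fun a b r hr p hp h => by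
      have := (le_abs_self _).trans (hK a b r hr p hp h)
      omega) hY
  obtain ⟨D₂, h₂⟩ := exists_between_near (K := K + 1) (γ := fun n => γ (-n))
    (fun m n => by rw [hγ, abs_sub_comm]; congr 1; ring) (by omega)
    (fun a b r hr p hp h => by
      have := (neg_abs_le _).trans' (neg_le_neg (hK (-a) (-b) r hr p hp h))
      omega) (fun n => hY (-n))
  obtain ⟨D, hD1, hD2⟩ : ∃ D, D₁ ≤ D ∧ D₂ ≤ D := ⟨max D₁ D₂, le_max_left _ _, le_max_right _ _⟩
  refine ⟨4 * D + 2 * ε, fun x x' y y' hy hy' hle => ?_⟩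
  obtain ⟨s, hs⟩ := hY' y hy.1
  obtain ⟨t, ht⟩ := hY' y' hy'.1
  have key : |s - t| ≤ D ∨ ∃ z, dst P x z + dst P z x' = dst P x x' ∧ dst P z y ≤ D := by
    by_contra! h
    rcases le_total s t with hst | hst
    · obtain ⟨z, hz1, hz2⟩ := h₁ x x' y y' s t hy hy' hs ht hst (by
        have h3 := h.1
        rw [abs_sub_comm, abs_of_nonneg (by omega)] at h3
        omega)
      have := h.2 z hz1
      omega
    · obtain ⟨z, hz1, hz2⟩ := h₂ x x' y y' (-s) (-t) hy hy' (by simpa using hs)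
        (by simpa using ht) (by omega) (by
          have h3 := h.1
          rw [abs_of_nonneg (by omega)] at h3
          omega)
      have := h.2 z hz1
      omega
  rcases key with h | ⟨z, hz1, hz2⟩
  · have h1 := hγ s t
    have h2 := dst_triangle P y (γ s) y'
    have h3 := dst_triangle P (γ s) (γ t) y'
    have h4 := dst_comm P (γ t) y'
    omega
  · have h1 := dst_triangle P x z y
    have h2 := dst_triangle P x' z y
    have h3 := hy'.2 y hy.1
    have h4 := dst_triangle P y x' y'
    have h5 := dst_comm P y x'
    have h6 := dst_comm P z x'
    omega

end

section

theorem Gen.wordLength_zpow_le {G : Type*} [Group G] {A : Set G} (hA : Gen A) (g : G) (n : ℤ) :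
    (wordLength A (g ^ n) : ℝ) ≤ |(n : ℝ)| * wordLength A g := by
  have key : ∀ k : ℕ, wordLength A (g ^ k) ≤ k * wordLength A g := by
    intro k
    induction k with
    | zero =>
      rw [pow_zero, zero_mul]
      exact wordLength_le [] (by simp)
    | succ k ih =>
      rw [pow_succ, Nat.succ_mul]
      exact (hA.wordLength_mul_le _ _).trans (by omega)
  rcases Int.eq_nat_or_neg n with ⟨k, rfl | rfl⟩
  · rw [zpow_natCast, Int.cast_natCast, Nat.abs_cast]
    exact_mod_cast key k
  · rw [zpow_neg, hA.wordLength_inv, zpow_natCast, Int.cast_neg, abs_neg, Int.cast_natCast,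
      Nat.abs_cast]
    exact_mod_cast key k

variable {S : Type} {P : C6Presentation S}

theorem closest_of_mem_proj {Y : Set P.Grp} {x y : P.Grp} (h : y ∈ proj P.gens Y x) :
    Closest P Y x y := by
  refine ⟨h.1, fun y' hy' => ?_⟩
  have h1 : setDist P.gens x Y ≤ wdist P.gens x y' :=
    csInf_le ⟨0, by rintro _ ⟨z, -, rfl⟩; exact Nat.cast_nonneg _⟩ ⟨y', hy', rfl⟩
  rw [← h.2, wdist_eq_dst, wdist_eq_dst] at h1
  exact_mod_cast h1

theorem admissible_id_const (D : ℕ) : Admissible (fun r => r) fun _ => (D : ℝ) := by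
  refine ⟨monotone_id, monotone_const, Filter.eventually_ge_atTop 0, Filter.Eventually.of_forall
    fun _ => Nat.cast_nonneg _, fun _ => le_rfl, fun M => ⟨M, le_rfl⟩, ?_⟩
  exact tendsto_const_nhds.div_atTop Filter.tendsto_id

theorem stronglyContracting_of_closest {Y : Set P.Grp} {D : ℕ}
    (h : ∀ x x' y y', Closest P Y x y → Closest P Y x' y' → dst P x x' ≤ dst P x y →
      dst P y y' ≤ D) : StronglyContracting P.gens Y := by
  refine ⟨D, admissible_id_const D, ?_⟩
  intro x _ x' _ hxx' y hy y' hy'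
  have key : ∀ y ∈ proj P.gens Y x, ∀ y' ∈ proj P.gens Y x', dst P y y' ≤ D := by
    intro y hy y' hy'
    refine h x x' y y' (closest_of_mem_proj hy) (closest_of_mem_proj hy') ?_
    change wdist P.gens x x' ≤ setDist P.gens x Y at hxx'
    rw [← hy.2, wdist_eq_dst, wdist_eq_dst] at hxx'
    exact_mod_cast hxx'
  rw [wdist_eq_dst]
  suffices dst P y y' ≤ D from (Nat.cast_le (α := ℝ)).2 this
  rcases hy with hy | hy <;> rcases hy' with hy' | hy'
  · exact h x x y y' (closest_of_mem_proj hy) (closest_of_mem_proj hy') (by simp)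
  · exact key y hy y' hy'
  · rw [dst_comm]
    exact key y' hy' y hy
  · exact h x' x' y y' (closest_of_mem_proj hy) (closest_of_mem_proj hy') (by simp)

/-- A geodesic close to a cyclic subgroup which embeds in the coned-off space has bounded
overlap with relators. -/
theorem exists_overlap_bound {g : P.Grp} {γ : ℤ → P.Grp}
    (hγ : ∀ m n, (dst P (γ m) (γ n) : ℤ) = |m - n|) {ε : ℕ}
    (hY : ∀ n, ∃ y ∈ (Subgroup.zpowers g : Set P.Grp), dst P (γ n) y ≤ ε) {L A : ℝ} (hL : 1 ≤ L)
    (hhyp : ∀ m n : ℤ,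
      L⁻¹ * |(m : ℝ) - (n : ℝ)| - A ≤ wdist (conedGens P) (g ^ m) (g ^ n)) :
    ∃ K : ℕ, ∀ a b, ∀ r ∈ P.rels, ∀ p, p <+: r → γ a * P.elt p = γ b → |a - b| ≤ K := by
  obtain ⟨K, hK⟩ := exists_nat_ge (2 * ε + L * (A + 2 * ε + 1) * wordLength P.gens g)
  refine ⟨K, fun a b r hr p hp hab => ?_⟩
  obtain ⟨_, ⟨m, rfl⟩, hm⟩ := hY a
  obtain ⟨_, ⟨n, rfl⟩, hn⟩ := hY b
  simp only at hm hn
  have hcone := gen_coned P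
  have h1 : wordLength (conedGens P) ((g ^ m)⁻¹ * g ^ n) ≤ 2 * ε + 1 := by
    have e : (g ^ m)⁻¹ * g ^ n = ((γ a)⁻¹ * g ^ m)⁻¹ * (P.elt p * ((γ b)⁻¹ * g ^ n)) := by
      rw [← hab]
      group
    have h2 := hcone.wordLength_mul_le ((γ a)⁻¹ * g ^ m)⁻¹ (P.elt p * ((γ b)⁻¹ * g ^ n))
    have h3 := hcone.wordLength_mul_le (P.elt p) ((γ b)⁻¹ * g ^ n)
    rw [hcone.wordLength_inv] at h2
    have h4 := (coned_le_gens P ((γ a)⁻¹ * g ^ m)).trans hm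
    have h5 := (coned_le_gens P ((γ b)⁻¹ * g ^ n)).trans hn
    have h6 := coned_prefix_le P hr hp
    rw [e]
    omega
  have h2 := hhyp m n
  unfold wdist at h2
  have h1' : (wordLength (conedGens P) ((g ^ m)⁻¹ * g ^ n) : ℝ) ≤ 2 * ε + 1 := by exact_mod_cast h1
  have h3 : |(m : ℝ) - n| ≤ L * (A + 2 * ε + 1) := by
    rw [← inv_mul_le_iff₀ (by linarith)]
    linarith
  have h4 := (gen_gens P).wordLength_zpow_le g (n - m)
  rw [sub_eq_neg_add, zpow_add, zpow_neg, ← sub_eq_neg_add, Int.cast_sub, abs_sub_comm] at h4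
  have h5 := mul_le_mul_of_nonneg_right h3 (Nat.cast_nonneg (α := ℝ) (wordLength P.gens g))
  have h6 : dst P (γ a) (γ b) ≤ 2 * ε + dst P (g ^ m) (g ^ n) := by
    have t1 := dst_triangle P (γ a) (g ^ m) (γ b)
    have t2 := dst_triangle P (g ^ m) (g ^ n) (γ b)
    have t3 := dst_comm P (γ b) (g ^ n)
    omega
  have h7 : (dst P (γ a) (γ b) : ℝ) ≤ 2 * ε + dst P (g ^ m) (g ^ n) := by exact_mod_cast h6
  have h8 : (dst P (g ^ m) (g ^ n) : ℝ) = wordLength P.gens ((g ^ m)⁻¹ * g ^ n) := rfl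
  have h9 : (dst P (γ a) (γ b) : ℝ) ≤ K := by linarith
  rw [← hγ]
  exact_mod_cast h9

end

end GSC
namespace GSC

/-- If an infinite-order element `g` of a classical C'(1/6) group has
`⟨g⟩` at finite Hausdorff distance from a bi-infinite geodesic, and `g` is hyperbolic
for the action on the coned-off space, then `⟨g⟩` is strongly contracting in `Cay(G,S)`. -/
theorem statement10 {S : Type} (P : C6Presentation S) (g : P.Grp)
    (hg : ¬ IsOfFinOrder g)
    (hgeo : ∃ γ : Set P.Grp, IsBiInfGeodesic P.gens γ ∧
      FinHausdorffDist P.gens ((Subgroup.zpowers g : Subgroup P.Grp) : Set P.Grp) γ)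
    (hhyp : ∃ L A : ℝ, 1 ≤ L ∧ 0 ≤ A ∧ ∀ m n : ℤ,
        L⁻¹ * |(m : ℝ) - (n : ℝ)| - A ≤ wdist (conedGens P) (g ^ m) (g ^ n) ∧
        wdist (conedGens P) (g ^ m) (g ^ n) ≤ L * |(m : ℝ) - (n : ℝ)| + A) :
    StronglyContracting P.gens ((Subgroup.zpowers g : Subgroup P.Grp) : Set P.Grp) := by
  obtain ⟨_, ⟨γ, hγ, rfl⟩, ε₀, hY', hY⟩ := hgeo
  obtain ⟨L, A, hL, -, hhyp⟩ := hhyp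
  obtain ⟨ε, hε⟩ := exists_nat_ge ε₀
  replace hγ : ∀ m n, (dst P (γ m) (γ n) : ℤ) = |m - n| := fun m n => by
    have h := hγ m n
    rw [wdist_eq_dst] at h
    exact_mod_cast h
  replace hY' : ∀ y ∈ (Subgroup.zpowers g : Set P.Grp), ∃ n, dst P y (γ n) ≤ ε := fun y hy => by
    obtain ⟨_, ⟨n, rfl⟩, h⟩ := hY' y hy
    rw [wdist_eq_dst] at h
    exact ⟨n, by exact_mod_cast h.trans hε⟩
  replace hY : ∀ n, ∃ y ∈ (Subgroup.zpowers g : Set P.Grp), dst P (γ n) y ≤ ε := fun n => by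
    obtain ⟨y, hy, h⟩ := hY (γ n) ⟨n, rfl⟩
    rw [wdist_eq_dst, dst_comm] at h
    exact ⟨y, hy, by exact_mod_cast h.trans hε⟩
  obtain ⟨K, hK⟩ := exists_overlap_bound hγ hY hL fun m n => (hhyp m n).1
  obtain ⟨D, hD⟩ := exists_contraction hγ hK hY hY'
  exact stronglyContracting_of_closest hD

end GSC
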